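/- Let m ≥ 3 and n ≥ 1. For every extended real ω̂ with m/n ≤ ω̂ ≤ +∞ there exists a totally irrational matrix ξ ∈ ℝ^{n×m} that satisfies Property (B), is not badly approximable (not Property (A)), and has uniform exponent ω̂(ξ) = ω̂. -/

import Mathlib

open Filter

/-- The sup-norm of the `i`-th integer vector `x i`, viewed in `ℝ^m`. -/
noncomputable def Xval {m : ℕ} (x : ℕ → Fin m → ℤ) (i : ℕ) : ℝ :=
  ‖(fun j => (x i j : ℝ))‖

/-- The sup-norm of the remainder `ξ 𝒙ᵢ − 𝒚ᵢ`. -/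
noncomputable def Lval {m n : ℕ} (ξ : Matrix (Fin n) (Fin m) ℝ)
    (x : ℕ → Fin m → ℤ) (y : ℕ → Fin n → ℤ) (i : ℕ) : ℝ :=
  ‖(ξ.mulVec (fun j => (x i j : ℝ)) - (fun k => (y i k : ℝ)))‖

/-- `ξ` is totally irrational: `‖ξ𝒙 − 𝒚‖ > 0` for every nonzero integer pair `(𝒙,𝒚)`. -/
def TotallyIrrational {m n : ℕ} (ξ : Matrix (Fin n) (Fin m) ℝ) : Prop :=
  ∀ (u : Fin m → ℤ) (v : Fin n → ℤ), (u, v) ≠ 0 →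
    0 < ‖(ξ.mulVec (fun j => (u j : ℝ)) - (fun k => (v k : ℝ)))‖

/-- `(𝒙ᵢ, 𝒚ᵢ)_{i}` is a sequence of best approximation vectors for `ξ`
(with respect to the sup norms). -/
structure IsBestApproxSeq {m n : ℕ} (ξ : Matrix (Fin n) (Fin m) ℝ)
    (x : ℕ → Fin m → ℤ) (y : ℕ → Fin n → ℤ) : Prop where
  nonzero : ∀ i, x i ≠ 0
  first : Xval x 0 = 1
  xStrictMono : StrictMono (Xval x)
  lStrictAnti : StrictAnti (Lval ξ x y)
  best : ∀ (i : ℕ) (u : Fin m → ℤ) (v : Fin n → ℤ), u ≠ 0 →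
    ‖(fun j => (u j : ℝ))‖ < Xval x (i + 1) →
    Lval ξ x y i ≤ ‖(ξ.mulVec (fun j => (u j : ℝ)) - (fun k => (v k : ℝ)))‖

/-- Property (A): `ξ` is badly approximable. -/
def PropA {m n : ℕ} (ξ : Matrix (Fin n) (Fin m) ℝ) : Prop :=
  ∃ c : ℝ, 0 < c ∧ ∀ (u : Fin m → ℤ) (v : Fin n → ℤ), u ≠ 0 →
    c ≤ ‖(fun j => (u j : ℝ))‖ ^ m *
        ‖(ξ.mulVec (fun j => (u j : ℝ)) - (fun k => (v k : ℝ)))‖ ^ n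

/-- Property (B): the ratios `X_{i+1}/X_i` are bounded. -/
def PropB {m : ℕ} (x : ℕ → Fin m → ℤ) : Prop :=
  ∃ M : ℝ, ∀ i : ℕ, Xval x (i + 1) / Xval x i ≤ M

/-- Property (C): the ratios `L_i/L_{i+1}` are bounded. -/
def PropC {m n : ℕ} (ξ : Matrix (Fin n) (Fin m) ℝ)
    (x : ℕ → Fin m → ℤ) (y : ℕ → Fin n → ℤ) : Prop :=
  ∃ M : ℝ, ∀ i : ℕ, Lval ξ x y i / Lval ξ x y (i + 1) ≤ M

/-- The ordinary exponent `ω(ξ) = limsup (−log Lᵢ)/(log Xᵢ)`, as a value in `[0,+∞]`. -/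
noncomputable def ordExp {m n : ℕ} (ξ : Matrix (Fin n) (Fin m) ℝ)
    (x : ℕ → Fin m → ℤ) (y : ℕ → Fin n → ℤ) : EReal :=
  limsup (fun i => ((-Real.log (Lval ξ x y i) / Real.log (Xval x i) : ℝ) : EReal)) atTop

/-- The uniform exponent `ω̂(ξ) = liminf (−log Lᵢ)/(log X_{i+1})`, as a value in `[0,+∞]`. -/
noncomputable def unifExp {m n : ℕ} (ξ : Matrix (Fin n) (Fin m) ℝ)
    (x : ℕ → Fin m → ℤ) (y : ℕ → Fin n → ℤ) : EReal :=
  liminf (fun i => ((-Real.log (Lval ξ x y i) / Real.log (Xval x (i + 1)) : ℝ) : EReal)) atTop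

/-- Products `s₀ s₂ ⋯ sᵢ` or `s₁ s₃ ⋯ sᵢ` along indices of the same parity. -/
def parityProd (s : ℕ → ℕ) : ℕ → ℕ
  | 0 => s 0
  | 1 => s 1
  | i + 2 => parityProd s i * s (i + 2)

/-- Numerical data of a chain: lengths `y i`, heights `h i`, and integer multipliers `s i`. -/
structure Chain where
  n : ℕ
  n_pos : 1 ≤ n
  X : ℝ
  X_pos : 0 < X
  y : ℕ → ℝ
  s : ℕ → ℕ
  h : ℕ → ℝ
  s_pos : ∀ i, 1 ≤ s i
  h_pos : ∀ i, 0 < h i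
  y_add_two : ∀ i, y (i + 2) = y i * s i
  le_y_zero : X ≤ y 0
  y_zero_le : y 0 ≤ 2 * X
  sep : ∀ i ≤ n, 16 * 2 ^ n * y i ≤ y (i + 1)
  pow_le : ∀ j, 1 ≤ j → j < n →
    (h j / s j) ^ j * y j ≤ X * ∏ i ∈ Finset.range j, (h i / s i)
  le_pow : ∀ j, 1 ≤ j → j < n →
    X * ∏ i ∈ Finset.range j, (h i / s i) ≤ (2 * (h j / s j)) ^ j * y j
  small : ∀ i < n, 2 * (h 0 / s 0) ≤ h i

namespace Chain

variable (K : Chain)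

noncomputable def lam (i : ℕ) : ℝ := K.h i / K.s i

noncomputable def P (j : ℕ) : ℝ := K.X * ∏ i ∈ Finset.range j, K.lam i

/-- The scales `Q t = 4 ^ t X / 2`. -/
noncomputable def Q (t : ℕ) : ℝ := 4 ^ t * (K.X / 2)

open Classical in
/-- The number of active rows at scale `Q t`. -/
noncomputable def k (t : ℕ) : ℕ :=
  Nat.find (p := fun k => 1 ≤ k ∧ (K.n ≤ k ∨ 16 * K.Q t ≤ K.y k)) ⟨K.n, K.n_pos, Or.inl le_rfl⟩

/-- The value of the dominant forms at scale `Q t`. -/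
noncomputable def G (t : ℕ) : ℝ := (K.P (K.k t) / K.Q t) ^ (1 / (K.k t : ℝ))

/-- The `i`-th linear form. -/
noncomputable def form (θ : ℕ → ℝ) (c₀ : ℤ) (c d : ℕ → ℤ) (i : ℕ) : ℝ :=
  d i + c (i % 2) / parityProd K.s i + c₀ * θ i

noncomputable def size (c₀ : ℤ) (c : ℕ → ℤ) : ℝ :=
  max (|(c₀ : ℝ)| * K.X) (max (|(c 0 : ℝ)| * K.y 0) (|(c 1 : ℝ)| * K.y 1))

theorem s_pos' (i : ℕ) : (0 : ℝ) < K.s i := by exact_mod_cast K.s_pos i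

theorem lam_pos (i : ℕ) : 0 < K.lam i := div_pos (K.h_pos i) (K.s_pos' i)

theorem P_pos (j : ℕ) : 0 < K.P j :=
  mul_pos K.X_pos (Finset.prod_pos fun i _ => K.lam_pos i)

theorem P_succ (j : ℕ) : K.P (j + 1) = K.P j * K.lam j := by
  simp [P, Finset.prod_range_succ, mul_assoc]

theorem Q_pos (t : ℕ) : 0 < K.Q t := by have := K.X_pos; unfold Q; positivity

theorem Q_succ (t : ℕ) : K.Q (t + 1) = 4 * K.Q t := by unfold Q; ring

theorem Q_zero : K.Q 0 = K.X / 2 := by simp [Q]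

theorem Q_mono {a b : ℕ} (h : a ≤ b) : K.Q a ≤ K.Q b :=
  monotone_nat_of_le_succ (fun t => by rw [K.Q_succ]; linarith [K.Q_pos t]) h

theorem k_spec (t : ℕ) : 1 ≤ K.k t ∧ (K.n ≤ K.k t ∨ 16 * K.Q t ≤ K.y (K.k t)) := by
  classical
  unfold k
  exact Nat.find_spec (p := fun k => 1 ≤ k ∧ (K.n ≤ k ∨ 16 * K.Q t ≤ K.y k)) _

theorem k_pos (t : ℕ) : 1 ≤ K.k t := (K.k_spec t).1

theorem k_le (t : ℕ) : K.k t ≤ K.n := by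
  classical
  unfold k
  exact Nat.find_min' _ ⟨K.n_pos, Or.inl le_rfl⟩

theorem y_pos : ∀ i, i ≤ K.n + 1 → 0 < K.y i := by
  intro i
  induction i with
  | zero => intro _; linarith [K.X_pos, K.le_y_zero]
  | succ i ih =>
    intro h
    have := ih (by omega)
    refine lt_of_lt_of_le ?_ (K.sep i (by omega))
    positivity

theorem y_le_succ {i : ℕ} (hi : i ≤ K.n) : K.y i ≤ K.y (i + 1) := by
  refine le_trans ?_ (K.sep i hi)
  have := K.y_pos i (by omega)
  have h2 : (1 : ℝ) ≤ 2 ^ K.n := one_le_pow₀ (by norm_num)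
  nlinarith

theorem y_mono {i j : ℕ} (hij : i ≤ j) (hj : j ≤ K.n + 1) : K.y i ≤ K.y j := by
  induction j, hij using Nat.le_induction with
  | base => rfl
  | succ j hij ih => exact (ih (by omega)).trans (K.y_le_succ (by omega))

theorem y_zero_le_Q (t : ℕ) : K.y 0 ≤ 16 * K.Q t := by
  have := K.Q_mono (Nat.zero_le t)
  rw [K.Q_zero] at this
  linarith [K.y_zero_le, K.X_pos]

theorem y_lt_of_lt_k {t i : ℕ} (hi : 1 ≤ i) (h : i < K.k t) : K.y i < 16 * K.Q t := by
  classical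
  by_contra hc
  unfold k at h
  exact Nat.find_min _ h ⟨hi, Or.inr (not_lt.1 hc)⟩

theorem y_le_of_lt_k {t i : ℕ} (h : i < K.k t) : K.y i ≤ 16 * K.Q t := by
  rcases Nat.eq_zero_or_pos i with rfl | hi
  · exact K.y_zero_le_Q t
  · exact (K.y_lt_of_lt_k hi h).le

theorem le_y_of_k_le {t i : ℕ} (ht : 16 * K.Q t ≤ K.y K.n) (h : K.k t ≤ i) (hi : i ≤ K.n + 1) :
    16 * K.Q t ≤ K.y i := by
  refine le_trans ?_ (K.y_mono h hi)
  rcases (K.k_spec t).2 with h1 | h1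
  · rwa [le_antisymm (K.k_le t) h1]
  · exact h1

theorem k_mono {a b : ℕ} (h : a ≤ b) : K.k a ≤ K.k b := by
  by_contra hc
  push Not at hc
  have h1 := K.y_lt_of_lt_k (K.k_pos b) hc
  have h2 := K.Q_mono h
  rcases (K.k_spec b).2 with h3 | h3
  · have := K.k_le a; omega
  · linarith

theorem k_zero : K.k 0 = 1 := by
  classical
  refine le_antisymm ?_ (K.k_pos 0)
  unfold k
  refine Nat.find_min' _ ⟨le_rfl, Or.inr ?_⟩
  refine le_trans ?_ (K.sep 0 (Nat.zero_le _))
  have h2 : (1 : ℝ) ≤ 2 ^ K.n := one_le_pow₀ (by norm_num)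
  have := K.X_pos
  have := K.le_y_zero
  rw [K.Q_zero]
  nlinarith

theorem G_pos (t : ℕ) : 0 < K.G t := Real.rpow_pos_of_pos (div_pos (K.P_pos _) (K.Q_pos t)) _

theorem G_pow (t : ℕ) : K.G t ^ K.k t * K.Q t = K.P (K.k t) := by
  have hk : (K.k t : ℝ) ≠ 0 := by have := K.k_pos t; positivity
  have hq := K.Q_pos t
  rw [G, ← Real.rpow_natCast, ← Real.rpow_mul (div_pos (K.P_pos _) hq).le, one_div_mul_cancel hk,
    Real.rpow_one, div_mul_cancel₀ _ hq.ne']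

theorem lam_succ_le {j : ℕ} (hj : j + 1 < K.n) : K.lam (j + 1) ≤ K.lam j := by
  have h1 := K.pow_le (j + 1) (by omega) hj
  have hl := K.lam_pos j
  have hy := K.y_pos (j + 1) (by omega)
  have hyj := K.y_pos j (by omega)
  change K.lam (j + 1) ^ (j + 1) * K.y (j + 1) ≤ K.P (j + 1) at h1
  rw [P_succ] at h1
  refine le_of_pow_le_pow_left₀ (n := j + 1) (by omega) hl.le ?_
  refine le_of_mul_le_mul_right (h1.trans ?_) hy
  have hs := K.sep j (by omega)
  rcases Nat.eq_zero_or_pos j with rfl | hj0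
  · simp only [P, Finset.range_zero, Finset.prod_empty, mul_one, zero_add, pow_one]
    have : K.X ≤ K.y 1 := K.le_y_zero.trans (K.y_le_succ (Nat.zero_le _))
    nlinarith
  · have h2 : K.P j ≤ (2 * K.lam j) ^ j * K.y j := K.le_pow j hj0 (by omega)
    have h3 : (2 : ℝ) ^ j ≤ 2 ^ K.n := pow_le_pow_right₀ (by norm_num) (by omega)
    calc K.P j * K.lam j ≤ (2 * K.lam j) ^ j * K.y j * K.lam j := by gcongr
      _ = K.lam j ^ (j + 1) * (2 ^ j * K.y j) := by rw [mul_pow]; ring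
      _ ≤ K.lam j ^ (j + 1) * K.y (j + 1) := by
          gcongr
          nlinarith [mul_le_mul_of_nonneg_right h3 hyj.le, mul_pos (pow_pos (two_pos (α := ℝ)) K.n) hyj]

theorem lam_anti {i j : ℕ} (hij : i ≤ j) (hj : j < K.n) : K.lam j ≤ K.lam i := by
  induction j, hij using Nat.le_induction with
  | base => rfl
  | succ j hij ih => exact (K.lam_succ_le hj).trans (ih (by omega))

theorem G_le_lam {t i : ℕ} (hi : i < K.k t) : K.G t ≤ 32 * K.lam i := by
  have hk := K.k_le t
  obtain ⟨j, hj⟩ : ∃ j, K.k t = j + 1 := ⟨K.k t - 1, by omega⟩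
  refine le_trans ?_ (mul_le_mul_of_nonneg_left (K.lam_anti (show i ≤ j by omega) (by omega))
    (by norm_num))
  have hl := K.lam_pos j
  have hQ := K.Q_pos t
  have hG := K.G_pow t
  rw [hj, P_succ] at hG
  have hyj := K.y_pos j (by omega)
  refine le_of_pow_le_pow_left₀ (n := j + 1) (by omega) (by positivity) ?_
  refine le_of_mul_le_mul_right ?_ hQ
  rw [hG]
  rcases Nat.eq_zero_or_pos j with rfl | hj0
  · simp only [P, Finset.range_zero, Finset.prod_empty, mul_one, zero_add, pow_one]
    have := K.Q_mono (Nat.zero_le t)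
    rw [K.Q_zero] at this
    nlinarith
  · have h2 : K.P j ≤ (2 * K.lam j) ^ j * K.y j := K.le_pow j hj0 (by omega)
    have h4 : K.y j ≤ 16 * K.Q t := K.y_le_of_lt_k (by omega)
    calc K.P j * K.lam j ≤ (2 * K.lam j) ^ j * (16 * K.Q t) * K.lam j := by
          refine mul_le_mul_of_nonneg_right (h2.trans ?_) hl.le
          gcongr
      _ = 2 ^ j * 16 * (K.lam j ^ (j + 1) * K.Q t) := by rw [mul_pow]; ring
      _ ≤ 32 ^ (j + 1) * (K.lam j ^ (j + 1) * K.Q t) := by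
          gcongr
          rw [pow_succ]
          have : (2 : ℝ) ^ j ≤ 32 ^ j := by gcongr; norm_num
          nlinarith [pow_pos (show (0 : ℝ) < 32 by norm_num) j]
      _ = _ := by rw [mul_pow]; ring

theorem lam_le_G {t i : ℕ} (ht : 16 * K.Q t ≤ K.y K.n) (h : K.k t ≤ i) (hi : i < K.n) :
    K.lam i ≤ K.G t := by
  have h1 := K.k_pos t
  refine (K.lam_anti h hi).trans ?_
  refine le_of_pow_le_pow_left₀ (n := K.k t) (by omega) (K.G_pos t).le ?_
  have hQ := K.Q_pos t
  refine le_of_mul_le_mul_right ?_ hQ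
  rw [K.G_pow]
  refine le_trans ?_ (K.pow_le _ h1 (by omega))
  have := K.le_y_of_k_le ht le_rfl ((K.k_le t).trans (Nat.le_succ _))
  have h3 := K.lam_pos (K.k t)
  exact mul_le_mul_of_nonneg_left (by linarith) (pow_pos h3 _).le

theorem G_succ_pow {t : ℕ} (ht : 16 * K.Q t ≤ K.y K.n) :
    4 * K.G (t + 1) ^ K.k (t + 1) ≤ K.G t ^ K.k (t + 1) := by
  have hQ := K.Q_pos t
  have h1 := K.G_pow (t + 1)
  rw [Q_succ] at h1
  have key : ∀ j, K.k t ≤ j → j ≤ K.n → K.P j ≤ K.G t ^ j * K.Q t := by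
    intro j hj
    induction j, hj using Nat.le_induction with
    | base => intro _; exact (K.G_pow t).ge
    | succ j hj ih =>
      intro hn
      rw [P_succ, pow_succ]
      have := ih (by omega)
      have h2 := K.lam_le_G ht hj (by omega)
      have h3 := K.lam_pos j
      have h4 := K.P_pos j
      have h5 := K.G_pos t
      calc _ ≤ (K.G t ^ j * K.Q t) * K.G t := by gcongr
        _ = _ := by ring
  refine le_of_mul_le_mul_right ?_ hQ
  linarith [key _ (K.k_mono (Nat.le_succ t)) (K.k_le _)]

theorem G_succ_le {t : ℕ} (ht : 16 * K.Q t ≤ K.y K.n) :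
    K.G (t + 1) ≤ (1 / 4 : ℝ) ^ (1 / (K.n : ℝ)) * K.G t := by
  have h := K.G_succ_pow ht
  have hk := K.k_pos (t + 1)
  have hG := K.G_pos t
  have hn : (0 : ℝ) < K.n := by exact_mod_cast K.n_pos
  have hk' : (0 : ℝ) < K.k (t + 1) := by exact_mod_cast hk
  refine le_of_pow_le_pow_left₀ (n := K.k (t + 1)) (by omega) (by positivity) ?_
  rw [mul_pow, ← Real.rpow_natCast ((1 / 4 : ℝ) ^ (1 / (K.n : ℝ))), ← Real.rpow_mul (by norm_num)]
  have : (1 / 4 : ℝ) ^ (1 : ℝ) ≤ (1 / 4 : ℝ) ^ (1 / (K.n : ℝ) * (K.k (t + 1) : ℝ)) := by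
    refine Real.rpow_le_rpow_of_exponent_ge (by norm_num) (by norm_num) ?_
    rw [one_div_mul_eq_div, div_le_one hn]
    exact_mod_cast K.k_le _
  rw [Real.rpow_one] at this
  have h2 := mul_le_mul_of_nonneg_right this (pow_pos hG (K.k (t + 1))).le
  linarith

theorem G_le_of_succ {t : ℕ} (ht : 16 * K.Q t ≤ K.y K.n) : K.G (t + 1) ≤ K.G t := by
  refine (K.G_succ_le ht).trans ?_
  have : (1 / 4 : ℝ) ^ (1 / (K.n : ℝ)) ≤ 1 :=
    Real.rpow_le_one (by norm_num) (by norm_num) (by positivity)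
  nlinarith [K.G_pos t]

theorem G_anti {a b : ℕ} (hab : a ≤ b) (hb : 16 * K.Q b ≤ K.y K.n) : K.G b ≤ K.G a := by
  induction b, hab using Nat.le_induction with
  | base => rfl
  | succ b hab ih =>
    have : 16 * K.Q b ≤ K.y K.n := by linarith [K.Q_mono (Nat.le_succ b)]
    exact (K.G_le_of_succ this).trans (ih this)

theorem G_add_le {t τ : ℕ} (ht : 16 * K.Q (t + τ) ≤ K.y K.n) :
    K.G (t + τ) ≤ ((1 / 4 : ℝ) ^ (1 / (K.n : ℝ))) ^ τ * K.G t := by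
  induction τ with
  | zero => simp
  | succ τ ih =>
    have h1 : 16 * K.Q (t + τ) ≤ K.y K.n := by
      linarith [K.Q_mono (show t + τ ≤ t + (τ + 1) by omega)]
    rw [← add_assoc, pow_succ', mul_assoc]
    exact (K.G_succ_le h1).trans (mul_le_mul_of_nonneg_left (ih h1) (by positivity))

theorem G_le_h {t i : ℕ} (ht : 16 * K.Q t ≤ K.y K.n) (hi : i < K.n) : K.G t ≤ K.h i := by
  refine (K.G_anti (Nat.zero_le t) ht).trans (le_trans ?_ (K.small i hi))
  have h := K.G_pow 0
  rw [K.k_zero, pow_one, K.Q_zero] at h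
  simp only [P, Finset.prod_range_one] at h
  have := K.X_pos
  change K.G 0 ≤ 2 * K.lam 0
  nlinarith

end Chain

open Finset in
theorem Matrix.abs_det_le_of_col_bound {k : ℕ} (M : Matrix (Fin k) (Fin k) ℝ) (B : Fin k → ℝ)
    (h : ∀ i j, |M i j| ≤ B j) : |M.det| ≤ k.factorial * ∏ i, B i := by
  rw [Matrix.det_apply]
  refine (abs_sum_le_sum_abs _ _).trans ?_
  have : ∀ σ ∈ (univ : Finset (Equiv.Perm (Fin k))),
      |Equiv.Perm.sign σ • ∏ i, M (σ i) i| ≤ ∏ i, B i := by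
    intro σ _
    have h1 : |Equiv.Perm.sign σ • ∏ i, M (σ i) i| = ∏ i, |M (σ i) i| := by
      rw [← abs_prod]
      rcases Int.units_eq_one_or (Equiv.Perm.sign σ) with hs | hs <;> simp [hs]
    rw [h1]
    exact prod_le_prod (fun _ _ => abs_nonneg _) fun i _ => h _ _
  refine (sum_le_card_nsmul _ _ _ this).trans ?_
  simp [Fintype.card_perm]

/-- Integer vectors on which the forms `Φ` are small lie in a common hyperplane. -/
theorem Matrix.exists_relation_of_small {k : ℕ} (Φ : Matrix (Fin k) (Fin k) ℝ) (B : Fin k → ℝ)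
    (h : k.factorial * ∏ i, B i < |Φ.det|) :
    ∃ w : Fin k → ℝ, w ≠ 0 ∧ ∀ z : Fin k → ℤ,
      (∀ i, |(Φ.mulVec fun j => (z j : ℝ)) i| ≤ B i) →
      ∑ i, w i * (Φ.mulVec fun j => (z j : ℝ)) i = 0 := by
  classical
  set S : Set (Fin k → ℝ) := {v | ∃ z : Fin k → ℤ, v = Φ.mulVec (fun j => (z j : ℝ)) ∧
    ∀ i, |v i| ≤ B i} with hS
  by_cases hT : Submodule.span ℝ S = ⊤
  · exfalso
    obtain ⟨f, hf, -, hli⟩ := Submodule.exists_fun_fin_finrank_span_eq ℝ S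
    have hk : Module.finrank ℝ (Submodule.span ℝ S) = k := by rw [hT]; simp
    let e := finCongr hk
    set g : Fin k → Fin k → ℝ := fun i => f (e.symm i) with hg
    have hgli : LinearIndependent ℝ g := hli.comp _ e.symm.injective
    have hgS : ∀ i, g i ∈ S := fun i => hf _
    choose z hz hb using hgS
    set M : Matrix (Fin k) (Fin k) ℝ := Matrix.of g with hM
    have hdet : M.det ≠ 0 := by
      have : IsUnit M := Matrix.linearIndependent_rows_iff_isUnit.1 hgli
      exact ((Matrix.isUnit_iff_isUnit_det _).1 this).ne_zero
    set Z : Matrix (Fin k) (Fin k) ℤ := Matrix.of z with hZ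
    have hMZ : M = (Z.map (Int.castRingHom ℝ)) * Φ.transpose := by
      ext i j
      rw [Matrix.mul_apply]
      change g i j = _
      rw [hz i]
      simp [Matrix.mulVec, dotProduct, hZ, mul_comm]
    have h2 : M.det = (Z.det : ℝ) * Φ.det := by
      rw [hMZ, Matrix.det_mul, Matrix.det_transpose]
      congr 1
      exact ((Int.castRingHom ℝ).map_det Z).symm
    have h3 : Z.det ≠ 0 := by
      intro h0; rw [h2, h0] at hdet; simp at hdet
    have h4 : (1 : ℝ) ≤ |(Z.det : ℝ)| := by exact_mod_cast Int.one_le_abs h3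
    have h5 := Matrix.abs_det_le_of_col_bound M B (fun i j => hb i j)
    rw [h2, abs_mul] at h5
    nlinarith [abs_nonneg Φ.det]
  · obtain ⟨f, hf0, hf⟩ := Submodule.exists_le_ker_of_lt_top _ (lt_top_iff_ne_top.2 hT)
    have hfx : ∀ v : Fin k → ℝ, f v = ∑ i, f (Pi.single i 1) * v i := by
      intro v
      conv_lhs => rw [pi_eq_sum_univ' v]
      simp [map_sum, mul_comm]
    refine ⟨fun i => f (Pi.single i 1), ?_, ?_⟩
    · intro h0
      apply hf0
      ext v
      simpa using congrFun h0 v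
    · intro z hz
      rw [← hfx]
      exact hf (Submodule.subset_span ⟨z, rfl, hz⟩)

open MeasureTheory in
/-- Minkowski's theorem on linear forms. -/
theorem Matrix.exists_small_of_prod_gt {k : ℕ} (Φ : Matrix (Fin k) (Fin k) ℝ) (B : Fin k → ℝ)
    (hB : ∀ i, 0 < B i) (hΦ : Φ.det ≠ 0) (h : |Φ.det| < ∏ i, B i) :
    ∃ z : Fin k → ℤ, z ≠ 0 ∧ ∀ i, |(Φ.mulVec fun j => (z j : ℝ)) i| ≤ B i := by
  classical
  set b := Pi.basisFun ℝ (Fin k) with hb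
  set box : Set (Fin k → ℝ) := Set.Icc (fun i => -B i) B with hbox
  set f : (Fin k → ℝ) →ₗ[ℝ] (Fin k → ℝ) := Matrix.toLin' Φ with hf
  have hdet : LinearMap.det f = Φ.det := LinearMap.det_toLin' Φ
  have hmem : ∀ v : Fin k → ℝ, v ∈ f ⁻¹' box ↔ ∀ i, |(Φ.mulVec v) i| ≤ B i := by
    intro v
    simp only [hbox, hf, Set.mem_preimage, Matrix.toLin'_apply, Set.mem_Icc, Pi.le_def, abs_le]
    exact ⟨fun h i => ⟨h.1 i, h.2 i⟩, fun h => ⟨fun i => (h i).1, fun i => (h i).2⟩⟩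
  have hvol : volume (f ⁻¹' box) = ENNReal.ofReal (|Φ.det|⁻¹ * ∏ i, (2 * B i)) := by
    rw [Measure.addHaar_preimage_linearMap _ (by rwa [hdet]), hdet, hbox, Real.volume_Icc_pi,
      ENNReal.ofReal_mul (by positivity), abs_inv, ENNReal.ofReal_prod_of_nonneg]
    · congr 2
      funext i
      ring_nf
    · intro i _; linarith [hB i]
  have fund := ZSpan.isAddFundamentalDomain b volume
  have hlt : volume (ZSpan.fundamentalDomain b) * 2 ^ Module.finrank ℝ (Fin k → ℝ)
      < volume (f ⁻¹' box) := by
    rw [hvol]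
    have h1 : volume (ZSpan.fundamentalDomain b) = 1 := by
      rw [ZSpan.volume_fundamentalDomain]
      have : Matrix.of ⇑b = (1 : Matrix (Fin k) (Fin k) ℝ) := by
        ext i j
        simp [hb, Matrix.one_apply, Pi.single_apply, eq_comm]
      rw [this]; simp
    rw [h1, one_mul, Module.finrank_fin_fun]
    have h2 : (2 : ENNReal) ^ k = ENNReal.ofReal (2 ^ k) := by
      rw [ENNReal.ofReal_pow (by norm_num)]; simp
    rw [h2]
    have hd : 0 < |Φ.det| := abs_pos.2 hΦ
    refine (ENNReal.ofReal_lt_ofReal_iff_of_nonneg (by positivity)).2 ?_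
    rw [Finset.prod_mul_distrib, Finset.prod_const, Finset.card_univ, Fintype.card_fin,
      mul_comm, mul_assoc]
    refine lt_mul_of_one_lt_right (by positivity) ?_
    rw [← div_eq_mul_inv]
    exact (one_lt_div hd).2 h
  have : Countable (Submodule.span ℤ (Set.range b)).toAddSubgroup :=
    inferInstanceAs (Countable (Submodule.span ℤ (Set.range b)))
  obtain ⟨x, hx0, hxs⟩ := exists_ne_zero_mem_lattice_of_measure_mul_two_pow_lt_measure
    (L := (Submodule.span ℤ (Set.range b)).toAddSubgroup) fund
    (by
      intro x hx
      rw [hmem] at hx ⊢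
      intro i
      simpa [Matrix.mulVec_neg] using hx i)
    (by
      rw [hbox]
      exact (convex_Icc _ _).linear_preimage f) hlt
  have hx1 := (Module.Basis.mem_span_iff_repr_mem ℤ b (x : Fin k → ℝ)).1 x.2
  choose z hz using hx1
  have hxz : (fun j => (z j : ℝ)) = (x : Fin k → ℝ) := by
    funext j
    simpa [hb] using hz j
  refine ⟨z, ?_, ?_⟩
  · rintro rfl
    apply hx0
    ext j
    have := congrFun hxz j
    simpa using this.symm
  · rw [hxz]
    exact (hmem _).1 hxs

theorem parityProd_mul_succ (s : ℕ → ℕ) (m : ℕ) :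
    parityProd s m * parityProd s (m + 1) = ∏ i ∈ Finset.range (m + 2), s i := by
  induction m with
  | zero => simp [parityProd, Finset.prod_range_succ]
  | succ m ih =>
    rw [Finset.prod_range_succ, ← ih]
    simp only [parityProd]
    ring

theorem parityProd_pos {s : ℕ → ℕ} (hs : ∀ i, 1 ≤ s i) : ∀ i, 1 ≤ parityProd s i
  | 0 => hs 0
  | 1 => hs 1
  | i + 2 => Nat.mul_pos (parityProd_pos hs i) (hs _)

namespace Chain

variable (K : Chain)

/-- The matrix of the first `k` forms (and `c₀`, last) in terms of the integer coordinates
`d 0, …, d (k - 3)`, the two column coordinates, and `c₀`. -/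
noncomputable def formMatrix (θ : ℕ → ℝ) (k : ℕ) : Matrix (Fin (k + 1)) (Fin (k + 1)) ℝ :=
  Matrix.of fun i j =>
    if (i : ℕ) = k then (if (j : ℕ) = k then 1 else 0)
    else if (j : ℕ) = k then θ i
    else if (j : ℕ) + 2 < k then (if (i : ℕ) = j then 1 else 0)
    else if (i : ℕ) % 2 = (j : ℕ) % 2 then (parityProd K.s i : ℝ)⁻¹ else 0

def coords (k : ℕ) (c₀ : ℤ) (c d : ℕ → ℤ) (j : Fin (k + 1)) : ℤ :=
  if (j : ℕ) = k then c₀ else if (j : ℕ) + 2 < k then d j else c ((j : ℕ) % 2)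

theorem den_pos (i : ℕ) : (0 : ℝ) < parityProd K.s i := by
  exact_mod_cast parityProd_pos K.s_pos i

theorem det_formMatrix (θ : ℕ → ℝ) {k : ℕ} (hk : 1 ≤ k) :
    (K.formMatrix θ k).det * ∏ i ∈ Finset.range k, (K.s i : ℝ) = 1 := by
  have hU : (K.formMatrix θ k).BlockTriangular id := by
    intro i j hij
    simp only [id, Fin.lt_def] at hij
    simp only [formMatrix, Matrix.of_apply]
    have := i.2
    split_ifs <;> first | rfl | omega
  rw [Matrix.det_of_isUpperTriangular hU, Fin.prod_univ_castSucc]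
  have hlast : K.formMatrix θ k (Fin.last k) (Fin.last k) = 1 := by simp [formMatrix]
  have hcast : ∀ i : Fin k, K.formMatrix θ k i.castSucc i.castSucc =
      if (i : ℕ) + 2 < k then 1 else (parityProd K.s i : ℝ)⁻¹ := by
    intro i
    have := i.2
    simp [formMatrix, this.ne]
  rw [hlast, mul_one, Finset.prod_congr rfl fun i _ => hcast i,
    Fin.prod_univ_eq_prod_range
      (fun i => if i + 2 < k then (1 : ℝ) else (parityProd K.s i : ℝ)⁻¹)]
  obtain rfl | ⟨m, rfl⟩ : k = 1 ∨ ∃ m, k = m + 2 := by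
    rcases Nat.lt_or_ge k 2 with h | h
    · left; omega
    · right; exact ⟨k - 2, by omega⟩
  · have := (K.s_pos' 0).ne'
    simp [parityProd, this]
  · have h1 : ∏ i ∈ Finset.range (m + 2), (K.s i : ℝ)
        = parityProd K.s m * parityProd K.s (m + 1) := by
      exact_mod_cast (parityProd_mul_succ K.s m).symm
    rw [h1, Finset.prod_range_succ, Finset.prod_range_succ]
    rw [Finset.prod_eq_one (s := Finset.range m)]
    · have h2 := (K.den_pos m).ne'
      have h3 := (K.den_pos (m + 1)).ne'
      simp
      field_simp
    · intro i hi
      rw [Finset.mem_range] at hi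
      rw [if_pos (by omega)]

theorem formMatrix_mulVec_last (θ : ℕ → ℝ) (k : ℕ) (c₀ : ℤ) (c d : ℕ → ℤ) :
    ((K.formMatrix θ k).mulVec fun j => (coords k c₀ c d j : ℝ)) (Fin.last k) = c₀ := by
  rw [Matrix.mulVec, dotProduct, Fin.sum_univ_castSucc, Finset.sum_eq_zero]
  · simp [formMatrix, coords]
  · intro j _
    have := j.2
    simp [formMatrix, this.ne]

theorem formMatrix_mulVec_castSucc (θ : ℕ → ℝ) {k : ℕ} (c₀ : ℤ) (c d : ℕ → ℤ)
    (hd : ∀ i, k ≤ i + 2 → i < k → d i = 0) (i : Fin k) :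
    ((K.formMatrix θ k).mulVec fun j => (coords k c₀ c d j : ℝ)) i.castSucc
      = K.form θ c₀ c d i := by
  have hi := i.2
  rw [Matrix.mulVec, dotProduct, Fin.sum_univ_castSucc, form]
  congr 1
  · obtain ⟨j', hj', hpar, hge⟩ : ∃ j', j' < k ∧ j' % 2 = (i : ℕ) % 2 ∧ k ≤ j' + 2 := by
      by_cases h : (k - 1) % 2 = (i : ℕ) % 2
      · exact ⟨k - 1, by omega, h, by omega⟩
      · exact ⟨k - 2, by omega, by omega, by omega⟩
    have hterm : ∀ j : Fin k, K.formMatrix θ k i.castSucc j.castSucc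
        * (coords k c₀ c d j.castSucc : ℝ)
        = (if j = i then (d i : ℝ) else 0)
          + (if j = ⟨j', hj'⟩ then (c ((i : ℕ) % 2) / parityProd K.s i : ℝ) else 0) := by
      intro j
      have hj := j.2
      simp only [formMatrix, coords, Matrix.of_apply, Fin.val_castSucc, hi.ne, hj.ne, if_false,
        Fin.ext_iff]
      by_cases h1 : (j : ℕ) + 2 < k
      · rw [if_pos h1, if_pos h1, if_neg (show ¬ (j : ℕ) = j' by omega), add_zero]
        by_cases h2 : (i : ℕ) = j
        · rw [if_pos h2, if_pos h2.symm, h2, one_mul]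
        · rw [if_neg h2, if_neg (Ne.symm h2), zero_mul]
      · rw [if_neg h1, if_neg h1]
        have h3 : (if (j : ℕ) = i then (d i : ℝ) else 0) = 0 := by
          split_ifs with h4
          · rw [hd i (by omega) hi]; simp
          · rfl
        rw [h3, zero_add]
        by_cases h2 : (i : ℕ) % 2 = (j : ℕ) % 2
        · rw [if_pos h2, if_pos (by omega), h2, div_eq_inv_mul]
        · rw [if_neg h2, if_neg (by omega), zero_mul]
    rw [Finset.sum_congr rfl fun j _ => hterm j, Finset.sum_add_distrib]
    simp
  · simp [formMatrix, coords, hi.ne, mul_comm]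

theorem exists_coords_eq {k : ℕ} (hk : 1 ≤ k) (q : Fin (k + 1) → ℤ) :
    ∃ (c₀ : ℤ) (c d : ℕ → ℤ), coords k c₀ c d = q ∧ (∀ i, k ≤ i + 2 → d i = 0) ∧
      (k = 1 → c 1 = 0) := by
  have hkk : k - 1 < k + 1 := by omega
  have hkk2 : k - 2 < k + 1 := by omega
  refine ⟨q (Fin.last k), fun r => if (k - 1) % 2 = r then q ⟨k - 1, hkk⟩ else
    if 2 ≤ k then q ⟨k - 2, hkk2⟩ else 0,
    fun i => if h : i + 2 < k then q ⟨i, by omega⟩ else 0, ?_, ?_, ?_⟩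
  · funext j
    have hj := j.2
    simp only [coords]
    split_ifs with h1 h2 h3 h4
    · congr 1; exact Fin.ext h1.symm
    · rfl
    · congr 1; apply Fin.ext; simp only; omega
    · congr 1; apply Fin.ext; simp only; omega
    · omega
  · intro i hi
    simp only
    rw [dif_neg (by omega)]
  · rintro rfl
    simp

end Chain

namespace Chain

variable (K : Chain)

noncomputable def eps : ℝ := 1 / (8192 * (K.n + 1).factorial)

theorem eps_pos : 0 < K.eps := by unfold eps; positivity

theorem eps_le : K.eps ≤ 1 / 8192 := by
  unfold eps
  have : (1 : ℝ) ≤ (K.n + 1).factorial := by exact_mod_cast Nat.one_le_iff_ne_zero.2 (Nat.factorial_ne_zero _)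
  exact one_div_le_one_div_of_le (by norm_num) (by linarith)

noncomputable def rad (t i : ℕ) : ℝ := K.eps * K.G t * K.X / (K.Q t * K.h i)

theorem rad_pos (t i : ℕ) : 0 < K.rad t i := by
  have := K.eps_pos; have := K.G_pos t; have := K.X_pos; have := K.Q_pos t; have := K.h_pos i
  unfold rad; positivity

theorem y_mod_mul_den (i : ℕ) : K.y (i % 2) * parityProd K.s i = K.y (i + 2) := by
  induction i using Nat.twoStepInduction with
  | zero => rw [K.y_add_two]; simp [parityProd]
  | one => rw [K.y_add_two]; simp [parityProd]
  | more i ih _ =>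
    rw [K.y_add_two (i + 2), ← ih, Nat.add_mod_right]
    simp [parityProd, mul_assoc]

theorem y_add_two_pos {i : ℕ} (hi : i < K.n) : 0 < K.y (i + 2) := by
  rw [K.y_add_two]; exact mul_pos (K.y_pos i (by omega)) (K.s_pos' i)

theorem abs_div_den (i : ℕ) (c : ℤ) :
    |(c : ℝ) / parityProd K.s i| = |(c : ℝ)| * K.y (i % 2) / K.y (i + 2) := by
  have h1 := K.den_pos i
  have h2 : 0 < K.y (i % 2) := K.y_pos _ (by have := Nat.mod_lt i (show 2 > 0 by norm_num); have := K.n_pos; omega)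
  rw [abs_div, abs_of_pos h1, ← K.y_mod_mul_den]
  field_simp

theorem rad_le {t i : ℕ} (hi : i < K.k t) : K.rad t i ≤ 512 * K.eps * K.X / K.y (i + 2) := by
  have h1 := K.eps_pos; have h2 := K.G_pos t; have h3 := K.X_pos; have h4 := K.Q_pos t
  have h5 := K.h_pos i
  have hn := K.k_le t
  have h6 := K.y_pos i (by omega)
  have h7 := K.s_pos' i
  rw [K.y_add_two, rad, div_le_div_iff₀ (by positivity) (by positivity)]
  have h8 := K.G_le_lam hi
  rw [lam, ← mul_div_assoc, le_div_iff₀ h7] at h8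
  have h9 := K.y_le_of_lt_k hi
  calc K.eps * K.G t * K.X * (K.y i * K.s i) = K.eps * K.X * ((K.G t * K.s i) * K.y i) := by ring
    _ ≤ K.eps * K.X * ((32 * K.h i) * (16 * K.Q t)) := by gcongr
    _ = _ := by ring

theorem rad_succ_le {t : ℕ} (ht : 16 * K.Q t ≤ K.y K.n) (i : ℕ) :
    K.rad (t + 1) i ≤ K.rad t i / 4 := by
  have h1 := K.eps_pos; have h2 := K.G_pos t; have h3 := K.X_pos; have h4 := K.Q_pos t
  have h5 := K.h_pos i
  have h6 := K.G_le_of_succ ht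
  rw [rad, rad, K.Q_succ, div_div, div_le_div_iff₀ (by positivity) (by positivity)]
  calc K.eps * K.G (t + 1) * K.X * (K.Q t * K.h i * 4)
      = (K.eps * K.X * (K.Q t * K.h i * 4)) * K.G (t + 1) := by ring
    _ ≤ (K.eps * K.X * (K.Q t * K.h i * 4)) * K.G t := by gcongr
    _ = _ := by ring

/-- Shifts `θ` compatible with the scales up to `Q t`. -/
def Adm (t : ℕ) (θ : ℕ → ℝ) : Prop :=
  (∀ i < K.k t, |θ i| ≤ 512 * K.eps * K.X / K.y (i + 2)) ∧
    ∀ i, K.k t ≤ i → i < K.n → |θ i| ≤ K.rad t i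

variable {K}

theorem column_le {t : ℕ} {θ : ℕ → ℝ} (hθ : K.Adm t θ) {c₀ : ℤ} {c d : ℕ → ℤ} {b : ℝ}
    (hb : 0 ≤ b) (hd : ∀ i, K.k t ≤ i + 2 → i < K.k t → d i = 0) (h1 : K.k t = 1 → c 1 = 0)
    (hf : ∀ i, K.k t ≤ i + 2 → i < K.k t → |K.form θ c₀ c d i| * K.h i ≤ b * K.G t)
    {r : ℕ} (hr : r < 2) :
    |(c r : ℝ)| * K.y r ≤ 32 * b * K.y (K.k t - 1) + 512 * K.eps * (|(c₀ : ℝ)| * K.X) := by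
  have hk := K.k_pos t
  have hn := K.k_le t
  have hX := K.X_pos
  have he := K.eps_pos
  have hyk := K.y_pos (K.k t - 1) (by omega)
  have hyp : ∀ {i}, i < K.k t → 0 < K.y i := fun hi => K.y_pos _ (by omega)
  by_cases hc : K.k t = 1 ∧ r = 1
  · rw [hc.2, h1 hc.1]
    simp only [Int.cast_zero, abs_zero, zero_mul]
    positivity
  · obtain ⟨j, hj, hpar, hge⟩ : ∃ j, j < K.k t ∧ j % 2 = r ∧ K.k t ≤ j + 2 := by
      by_cases h : (K.k t - 1) % 2 = r
      · exact ⟨K.k t - 1, by omega, h, by omega⟩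
      · exact ⟨K.k t - 2, by omega, by omega, by omega⟩
    have hy2 := K.y_add_two_pos (show j < K.n by omega)
    have hyj := hyp hj
    have hh := K.h_pos j
    have hs := K.s_pos' j
    have e1 : |(c r : ℝ)| * K.y r = |(c r : ℝ) / parityProd K.s j| * K.y (j + 2) := by
      have := K.abs_div_den j (c r)
      rw [this, hpar]; field_simp
    have e2 : (c r : ℝ) / parityProd K.s j = K.form θ c₀ c d j - c₀ * θ j := by
      rw [form, hd j hge hj, hpar]; simp
    have e3 : |K.form θ c₀ c d j| * K.y (j + 2) ≤ 32 * b * K.y (K.k t - 1) := by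
      have hG := K.G_le_lam hj
      rw [lam, ← mul_div_assoc, le_div_iff₀ hs] at hG
      have hy := K.y_mono (show j ≤ K.k t - 1 by omega) (by omega)
      have hf' := hf j hge hj
      rw [K.y_add_two]
      refine le_of_mul_le_mul_right ?_ hh
      calc |K.form θ c₀ c d j| * (K.y j * K.s j) * K.h j
          = (|K.form θ c₀ c d j| * K.h j) * K.s j * K.y j := by ring
        _ ≤ (b * K.G t) * K.s j * K.y j := by gcongr
        _ = b * (K.G t * K.s j) * K.y j := by ring
        _ ≤ b * (32 * K.h j) * K.y (K.k t - 1) := by gcongr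
        _ = _ := by ring
    have e4 : |(c₀ : ℝ) * θ j| * K.y (j + 2) ≤ 512 * K.eps * (|(c₀ : ℝ)| * K.X) := by
      have := hθ.1 j hj
      rw [le_div_iff₀ hy2] at this
      rw [abs_mul]
      nlinarith [mul_le_mul_of_nonneg_left this (abs_nonneg (c₀ : ℝ))]
    rw [e1, e2]
    calc _ ≤ (|K.form θ c₀ c d j| + |(c₀ : ℝ) * θ j|) * K.y (j + 2) := by
          gcongr; exact abs_sub _ _
      _ ≤ _ := by linarith

theorem le_y_add_two {t i : ℕ} (ht : 16 * K.Q t ≤ K.y K.n) (h : K.k t ≤ i + 2) (hi : i < K.n) :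
    16 * K.Q t ≤ K.y (i + 2) := K.le_y_of_k_le ht h (by omega)

theorem abs_mul_shift_le {t i : ℕ} (ht : 16 * K.Q t ≤ K.y K.n) {θ : ℕ → ℝ} (hθ : K.Adm t θ)
    (hi : i < K.n) (h : K.k t ≤ i + 2) {c₀ : ℤ} (hc : |(c₀ : ℝ)| * K.X ≤ 4 * K.Q t) :
    |(c₀ : ℝ) * θ i| ≤ 128 * K.eps := by
  have h1 := K.eps_pos; have h2 := K.G_pos t; have h3 := K.X_pos; have h4 := K.Q_pos t
  have h5 := K.h_pos i
  rw [abs_mul]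
  rcases lt_or_ge i (K.k t) with hk | hk
  · have h6 := hθ.1 i hk
    have hy := K.y_add_two_pos hi
    have h7 := le_y_add_two ht h hi
    calc |(c₀ : ℝ)| * |θ i| ≤ |(c₀ : ℝ)| * (512 * K.eps * K.X / K.y (i + 2)) := by gcongr
      _ = (|(c₀ : ℝ)| * K.X) * (512 * K.eps) / K.y (i + 2) := by ring
      _ ≤ (4 * K.Q t) * (512 * K.eps) / (16 * K.Q t) := by gcongr
      _ = 128 * K.eps := by field_simp; norm_num
  · have h6 := hθ.2 i hk hi
    have h7 := K.G_le_h ht hi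
    calc |(c₀ : ℝ)| * |θ i| ≤ |(c₀ : ℝ)| * K.rad t i := by gcongr
      _ = (|(c₀ : ℝ)| * K.X) * (K.eps * K.G t) / (K.Q t * K.h i) := by rw [rad]; ring
      _ ≤ (4 * K.Q t) * (K.eps * K.h i) / (K.Q t * K.h i) := by gcongr
      _ = 4 * K.eps := by field_simp
      _ ≤ _ := by linarith

/-- A nontrivial vector of size about `Q t` with all forms too small for that size. -/
structure Danger (K : Chain) (t : ℕ) (θ : ℕ → ℝ) (c₀ : ℤ) (c d : ℕ → ℤ) : Prop where
  lt_size : K.Q t < K.size c₀ c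
  size_le : K.size c₀ c ≤ 4 * K.Q t
  form_lt : ∀ i < K.n, |K.form θ c₀ c d i| * K.h i < K.eps / 16 * K.G t

theorem size_le_iff {c₀ : ℤ} {c : ℕ → ℤ} {B : ℝ} : K.size c₀ c ≤ B ↔
    |(c₀ : ℝ)| * K.X ≤ B ∧ |(c 0 : ℝ)| * K.y 0 ≤ B ∧ |(c 1 : ℝ)| * K.y 1 ≤ B := by
  simp [size]

theorem int_eq_zero_of_abs_lt {a : ℤ} (h : |(a : ℝ)| < 1) : a = 0 := by
  rw [← Int.abs_lt_one_iff]; exact_mod_cast h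

theorem column_one_eq_zero {t : ℕ} (ht : 16 * K.Q t ≤ K.y K.n) (hk : K.k t = 1) {c₀ : ℤ}
    {c : ℕ → ℤ} (hs : K.size c₀ c ≤ 4 * K.Q t) : c 1 = 0 := by
  have h1 := (size_le_iff.1 hs).2.2
  have h2 := K.le_y_of_k_le ht hk.le (Nat.le_add_left _ _)
  apply int_eq_zero_of_abs_lt
  have := K.Q_pos t
  by_contra hc
  push Not at hc
  nlinarith

theorem coeff_eq_zero {t i : ℕ} (ht : 16 * K.Q t ≤ K.y K.n) {θ : ℕ → ℝ} (hθ : K.Adm t θ)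
    (hi : i < K.n) (h : K.k t ≤ i + 2) {c₀ : ℤ} {c d : ℕ → ℤ} (hs : K.size c₀ c ≤ 4 * K.Q t)
    (hf : |K.form θ c₀ c d i| < 1 / 4) : d i = 0 := by
  have h1 := abs_mul_shift_le ht hθ hi h (size_le_iff.1 hs).1
  have h2 : |(c (i % 2) : ℝ) / parityProd K.s i| ≤ 1 / 4 := by
    have hy := K.y_add_two_pos hi
    have h7 := le_y_add_two ht h hi
    have h3 : |(c (i % 2) : ℝ)| * K.y (i % 2) ≤ 4 * K.Q t := by
      rcases Nat.mod_two_eq_zero_or_one i with h | h <;> rw [h]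
      exacts [(size_le_iff.1 hs).2.1, (size_le_iff.1 hs).2.2]
    rw [K.abs_div_den i, div_le_iff₀ hy]
    linarith
  have h4 := K.eps_le
  apply int_eq_zero_of_abs_lt
  have e : (d i : ℝ) = K.form θ c₀ c d i - (c (i % 2) : ℝ) / parityProd K.s i - c₀ * θ i := by
    rw [form]; ring
  rw [e]
  rw [abs_lt] at *
  rw [abs_le] at *
  constructor <;> linarith [h2.1, h2.2, h1.1, h1.2]

theorem Danger.form_lt_quarter {t : ℕ} (ht : 16 * K.Q t ≤ K.y K.n) {θ : ℕ → ℝ} {c₀ : ℤ}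
    {c d : ℕ → ℤ} (D : K.Danger t θ c₀ c d) {i : ℕ} (hi : i < K.n) :
    |K.form θ c₀ c d i| < 1 / 4 := by
  have h1 := D.form_lt i hi
  have h2 := K.G_le_h ht hi
  have h3 := K.h_pos i
  have h4 := K.eps_pos
  have h5 := K.eps_le
  refine lt_of_mul_lt_mul_right (h1.trans_le ?_) h3.le
  nlinarith

theorem Danger.facts {t : ℕ} (ht : 16 * K.Q t ≤ K.y K.n) {θ : ℕ → ℝ} (hθ : K.Adm t θ) {c₀ : ℤ}
    {c d : ℕ → ℤ} (D : K.Danger t θ c₀ c d) :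
    (∀ i, K.k t ≤ i + 2 → i < K.n → d i = 0) ∧ K.Q t < |(c₀ : ℝ)| * K.X := by
  have hd : ∀ i, K.k t ≤ i + 2 → i < K.n → d i = 0 := fun i h hi =>
    coeff_eq_zero ht hθ hi h D.size_le (D.form_lt_quarter ht hi)
  refine ⟨hd, ?_⟩
  by_contra hc
  push Not at hc
  have hk := K.k_le t
  have he := K.eps_pos
  have he' := K.eps_le
  have hQ := K.Q_pos t
  have key : ∀ r, r < 2 → |(c r : ℝ)| * K.y r ≤ K.Q t := by
    intro r hr
    have h1 := column_le hθ (c₀ := c₀) (b := K.eps / 16) (by positivity)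
      (fun i h hi => hd i h (by omega))
      (fun h => column_one_eq_zero ht h D.size_le) (fun i _ hi => (D.form_lt i (by omega)).le) hr
    have h2 := K.y_le_of_lt_k (t := t) (i := K.k t - 1) (by have := K.k_pos t; omega)
    nlinarith
  have := D.lt_size
  exact absurd (size_le_iff.2 ⟨hc, key 0 (by norm_num), key 1 (by norm_num)⟩) (not_le.2 this)

end Chain

namespace Chain

variable {K : Chain}

theorem form_sub (θ θ' : ℕ → ℝ) (c₀ : ℤ) (c d : ℕ → ℤ) (i : ℕ) :
    K.form θ' c₀ c d i = K.form θ c₀ c d i + c₀ * (θ' i - θ i) := by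
  unfold form; ring

/-- All dangerous vectors at scale `Q t` satisfy a common linear relation. -/
theorem exists_relation {t : ℕ} (ht : 16 * K.Q t ≤ K.y K.n) {θ : ℕ → ℝ}
    (hAdm : ∀ θ' : ℕ → ℝ, (∀ i < K.n, |θ' i - θ i| ≤ K.rad t i) → K.Adm t θ') :
    ∃ w : Fin (K.k t + 1) → ℝ, w ≠ 0 ∧ ∀ θ' : ℕ → ℝ, (∀ i < K.n, |θ' i - θ i| ≤ K.rad t i) →
      ∀ c₀ c d, K.Danger t θ' c₀ c d →
        w (Fin.last _) * c₀ + ∑ i : Fin (K.k t), w i.castSucc * K.form θ c₀ c d i = 0 := by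
  have hk := K.k_pos t
  have hkn := K.k_le t
  have he := K.eps_pos
  have hG := K.G_pos t
  have hQ := K.Q_pos t
  have hX := K.X_pos
  set B : Fin (K.k t + 1) → ℝ :=
    Fin.lastCases (4 * K.Q t / K.X) (fun i => 5 * K.eps * K.G t / K.h i) with hB
  have hprod : (K.k t + 1).factorial * ∏ i, B i < |(K.formMatrix θ (K.k t)).det| := by
    have hdet := K.det_formMatrix θ hk
    set S := ∏ i ∈ Finset.range (K.k t), (K.s i : ℝ) with hS
    have hSpos : 0 < S := Finset.prod_pos fun i _ => K.s_pos' i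
    have hdet' : (K.formMatrix θ (K.k t)).det = S⁻¹ := eq_inv_of_mul_eq_one_left hdet
    have h1 : ∏ i, B i = 4 * (5 * K.eps) ^ K.k t * S⁻¹ := by
      rw [Fin.prod_univ_castSucc]
      simp only [hB, Fin.lastCases_castSucc, Fin.lastCases_last]
      rw [Fin.prod_univ_eq_prod_range (fun i => 5 * K.eps * K.G t / K.h i), Finset.prod_div_distrib,
        Finset.prod_const, Finset.card_range, mul_pow _ (K.G t)]
      have h2 := K.G_pow t
      have hH : 0 < ∏ i ∈ Finset.range (K.k t), K.h i := Finset.prod_pos fun i _ => K.h_pos i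
      have h3 : K.P (K.k t) = K.X * ((∏ i ∈ Finset.range (K.k t), K.h i) / S) := by
        simp [P, lam, Finset.prod_div_distrib, hS]
      rw [h3] at h2
      field_simp
      field_simp at h2
      linarith
    rw [h1, hdet', abs_of_pos (inv_pos.2 hSpos)]
    have h4 : ((K.k t + 1).factorial : ℝ) ≤ (K.n + 1).factorial := by
      exact_mod_cast Nat.factorial_le (by omega)
    have h5 : (5 * K.eps) ^ K.k t ≤ 5 * K.eps :=
      pow_le_of_le_one (by positivity) (by linarith [K.eps_le]) (by omega)
    have h6 : ((K.n + 1).factorial : ℝ) * K.eps = 1 / 8192 := by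
      unfold eps; field_simp
    have h7 : ((K.k t + 1).factorial : ℝ) * (4 * (5 * K.eps) ^ K.k t) < 1 := by
      calc _ ≤ ((K.n + 1).factorial : ℝ) * (4 * (5 * K.eps)) := by gcongr
        _ = 20 * (((K.n + 1).factorial : ℝ) * K.eps) := by ring
        _ < 1 := by rw [h6]; norm_num
    rw [← mul_assoc]
    exact mul_lt_of_lt_one_left (inv_pos.2 hSpos) h7
  obtain ⟨w, hw0, hw⟩ := Matrix.exists_relation_of_small _ B hprod
  refine ⟨w, hw0, fun θ' hθ' c₀ c d D => ?_⟩
  obtain ⟨hd, -⟩ := D.facts ht (hAdm θ' hθ')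
  have hd' : ∀ i, K.k t ≤ i + 2 → i < K.k t → d i = 0 := fun i h hi => hd i h (by omega)
  have hc : |(c₀ : ℝ)| * K.X ≤ 4 * K.Q t := (size_le_iff.1 D.size_le).1
  have := hw (coords (K.k t) c₀ c d) ?_
  · rw [Fin.sum_univ_castSucc, K.formMatrix_mulVec_last] at this
    simp only [K.formMatrix_mulVec_castSucc θ c₀ c d hd'] at this
    linarith
  · intro i
    refine Fin.lastCases ?_ (fun i => ?_) i
    · rw [K.formMatrix_mulVec_last]
      simp only [hB, Fin.lastCases_last]
      rwa [le_div_iff₀ hX]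
    · have hi := i.2
      have hh := K.h_pos i
      rw [K.formMatrix_mulVec_castSucc θ c₀ c d hd']
      simp only [hB, Fin.lastCases_castSucc]
      rw [form_sub θ' θ]
      have h1 := D.form_lt i (by omega)
      have h2 := hθ' i (by omega)
      rw [abs_sub_comm] at h2
      rw [le_div_iff₀ hh]
      have h3 : |(c₀ : ℝ) * (θ i - θ' i)| * K.h i ≤ 4 * K.eps * K.G t := by
        rw [abs_mul]
        calc |(c₀ : ℝ)| * |θ i - θ' i| * K.h i ≤ |(c₀ : ℝ)| * K.rad t i * K.h i := by gcongr
          _ = (|(c₀ : ℝ)| * K.X) * (K.eps * K.G t) / K.Q t := by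
            rw [rad]; field_simp
          _ ≤ (4 * K.Q t) * (K.eps * K.G t) / K.Q t := by gcongr
          _ = _ := by field_simp
      have h4 := abs_add_le (K.form θ' c₀ c d i) (c₀ * (θ i - θ' i))
      nlinarith

theorem exists_avoiding_shift {t : ℕ} (ht : 16 * K.Q t ≤ K.y K.n) {θ : ℕ → ℝ}
    (hAdm : ∀ θ' : ℕ → ℝ, (∀ i < K.n, |θ' i - θ i| ≤ K.rad t i) → K.Adm t θ') :
    ∃ η : ℕ → ℝ, (∀ i, K.k t ≤ i → η i = θ i) ∧
      (∀ i, |η i - θ i| ≤ K.rad t i - K.rad (t + 1) i) ∧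
      ∀ θ' : ℕ → ℝ, (∀ i < K.n, |θ' i - η i| ≤ K.rad (t + 1) i) →
        ∀ c₀ c d, ¬ K.Danger t θ' c₀ c d := by
  obtain ⟨w, hw0, hw⟩ := exists_relation ht hAdm
  have hkn := K.k_le t
  have hr : ∀ i, K.rad (t + 1) i ≤ K.rad t i / 4 := K.rad_succ_le ht
  have hr0 : ∀ i, 0 < K.rad t i := K.rad_pos t
  have hr1 : ∀ i, 0 < K.rad (t + 1) i := K.rad_pos (t + 1)
  -- the sign of the shift
  obtain ⟨e, he, hew⟩ : ∃ e : ℝ, |e| = 1 ∧ e * w (Fin.last _) ≤ 0 := by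
    rcases le_total 0 (w (Fin.last _)) with h | h
    · exact ⟨-1, by simp, by linarith⟩
    · exact ⟨1, by simp, by linarith⟩
  set σ : ℕ → ℝ := fun i => if h : i < K.k t then
    e * SignType.sign (w (Fin.castSucc ⟨i, h⟩)) * (K.rad t i - K.rad (t + 1) i) else 0 with hσ
  have hσle : ∀ i, |σ i| ≤ K.rad t i - K.rad (t + 1) i := by
    intro i
    have h0 : 0 ≤ K.rad t i - K.rad (t + 1) i := by linarith [hr i, hr0 i]
    simp only [hσ]
    split_ifs with h
    · rw [abs_mul, abs_mul, he, one_mul, abs_of_nonneg h0]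
      refine mul_le_of_le_one_left h0 ?_
      rcases SignType.sign (w (Fin.castSucc ⟨i, h⟩)) with _ | _ | _ <;> simp
    · simpa using h0
  refine ⟨fun i => θ i + σ i, ?_, ?_, ?_⟩
  · intro i hi
    simp [hσ, not_lt.2 hi]
  · intro i
    simpa using hσle i
  · intro θ' hθ' c₀ c d D
    have hbox : ∀ i < K.n, |θ' i - θ i| ≤ K.rad t i := by
      intro i hi
      have h1 := hθ' i hi
      have h2 := hσle i
      have : θ' i - θ i = (θ' i - (θ i + σ i)) + σ i := by ring
      rw [this]
      exact (abs_add_le _ _).trans (by linarith)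
    have hrel := hw θ' hbox c₀ c d D
    obtain ⟨-, hc⟩ := D.facts ht (hAdm θ' hbox)
    have hX := K.X_pos
    have hQ := K.Q_pos t
    have hG := K.G_pos t
    have heps := K.eps_pos
    have hc0 : 0 < |(c₀ : ℝ)| := by
      by_contra h
      have : |(c₀ : ℝ)| ≤ 0 := not_lt.1 h
      nlinarith
    set W : Fin (K.k t) → ℝ := fun i => w i.castSucc with hW
    -- `W` is nonzero
    have hWne : ∃ i, W i ≠ 0 := by
      by_contra hall
      push Not at hall
      have h1 : w (Fin.last _) * c₀ = 0 := by
        rw [Finset.sum_eq_zero] at hrel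
        · simpa using hrel
        · intro i _
          rw [show w i.castSucc = 0 from hall i, zero_mul]
      have h2 : w (Fin.last _) = 0 := by
        rcases mul_eq_zero.1 h1 with h | h
        · exact h
        · rw [h] at hc0; simp at hc0
      apply hw0
      funext i
      refine Fin.lastCases ?_ (fun i => ?_) i
      · exact h2
      · exact hall i
    -- relation at the new center
    have hsum : ∑ i, W i * K.form θ' c₀ c d i
        = c₀ * (-w (Fin.last _) + ∑ i : Fin (K.k t), W i * σ i)
          + c₀ * ∑ i : Fin (K.k t), W i * (θ' i - (θ i + σ i)) := by
      have : ∀ i : Fin (K.k t), W i * K.form θ' c₀ c d i = W i * K.form θ c₀ c d i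
          + c₀ * (W i * σ i) + c₀ * (W i * (θ' i - (θ i + σ i))) := by
        intro i; rw [form_sub θ θ']; ring
      rw [Finset.sum_congr rfl fun i _ => this i, Finset.sum_add_distrib, Finset.sum_add_distrib,
        ← Finset.mul_sum, ← Finset.mul_sum]
      linarith
    have hWσ : ∑ i : Fin (K.k t), W i * σ i
        = e * ∑ i : Fin (K.k t), |W i| * (K.rad t i - K.rad (t + 1) i) := by
      rw [Finset.mul_sum]
      refine Finset.sum_congr rfl fun i _ => ?_
      have h3 : σ i = e * SignType.sign (W i) * (K.rad t i - K.rad (t + 1) i) := by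
        simp only [hσ]
        rw [dif_pos i.2]
      rw [h3, ← self_mul_sign (W i)]
      ring
    set A := ∑ i : Fin (K.k t), |W i| * (K.rad t i - K.rad (t + 1) i) with hA
    set A' := ∑ i : Fin (K.k t), |W i| * K.rad (t + 1) i with hA'
    set A'' := ∑ i : Fin (K.k t), |W i| * K.rad t i with hA''
    have hAA : A = A'' - A' := by
      rw [hA, hA', hA'', ← Finset.sum_sub_distrib]
      exact Finset.sum_congr rfl fun i _ => by ring
    have hA4 : A' ≤ A'' / 4 := by
      rw [hA', hA'', Finset.sum_div]
      refine Finset.sum_le_sum fun i _ => ?_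
      rw [mul_div_assoc]
      exact mul_le_mul_of_nonneg_left (hr i) (abs_nonneg _)
    have hApos : 0 ≤ A := Finset.sum_nonneg fun i _ =>
      mul_nonneg (abs_nonneg _) (by linarith [hr i, hr0 i])
    have hlow : A ≤ |-w (Fin.last _) + ∑ i : Fin (K.k t), W i * σ i| := by
      have h1 : e * (-w (Fin.last _) + e * A) = -(e * w (Fin.last _)) + A := by
        have : e * e = 1 := by rw [← abs_mul_abs_self e, he]; norm_num
        linear_combination A * this
      rw [hWσ, ← one_mul |_|, ← he, ← abs_mul, h1]
      exact le_trans (by linarith) (le_abs_self _)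
    have hup : |∑ i : Fin (K.k t), W i * (θ' i - (θ i + σ i))| ≤ A' := by
      refine (Finset.abs_sum_le_sum_abs _ _).trans (Finset.sum_le_sum fun i _ => ?_)
      rw [abs_mul]
      exact mul_le_mul_of_nonneg_left (hθ' i (i.2.trans_le hkn)) (abs_nonneg _)
    have hmain : |(c₀ : ℝ)| * (A'' / 2) ≤ |∑ i, W i * K.form θ' c₀ c d i| := by
      rw [hsum]
      have h1 := abs_sub_abs_le_abs_add (↑c₀ * (-w (Fin.last _) + ∑ i : Fin (K.k t), W i * σ i))
        (c₀ * ∑ i : Fin (K.k t), W i * (θ' i - (θ i + σ i)))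
      rw [abs_mul, abs_mul] at h1
      refine le_trans ?_ h1
      have h2 := mul_le_mul_of_nonneg_left hlow hc0.le
      have h3 := mul_le_mul_of_nonneg_left hup hc0.le
      have h4 : |(c₀ : ℝ)| * (A'' / 2) ≤ |(c₀ : ℝ)| * A - |(c₀ : ℝ)| * A' := by
        rw [← mul_sub]
        exact mul_le_mul_of_nonneg_left (by linarith) hc0.le
      linarith
    have hstrict : |∑ i, W i * K.form θ' c₀ c d i|
        < ∑ i : Fin (K.k t), |W i| * (K.eps / 16 * K.G t / K.h i) := by
      refine (Finset.abs_sum_le_sum_abs _ _).trans_lt ?_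
      have hle : ∀ i : Fin (K.k t), |K.form θ' c₀ c d i| < K.eps / 16 * K.G t / K.h i := by
        intro i
        rw [lt_div_iff₀ (K.h_pos i)]
        exact D.form_lt i (i.2.trans_le hkn)
      obtain ⟨i, hi⟩ := hWne
      refine Finset.sum_lt_sum (fun i _ => ?_) ⟨i, Finset.mem_univ _, ?_⟩
      · rw [abs_mul]
        exact mul_le_mul_of_nonneg_left (hle i).le (abs_nonneg _)
      · rw [abs_mul]
        exact mul_lt_mul_of_pos_left (hle i) (abs_pos.2 hi)
    have hfin : ∑ i : Fin (K.k t), |W i| * (K.eps / 16 * K.G t / K.h i)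
        ≤ |(c₀ : ℝ)| * (A'' / 2) := by
      rw [hA'', Finset.sum_div, Finset.mul_sum]
      refine Finset.sum_le_sum fun i _ => ?_
      have hh := K.h_pos i
      have : K.eps / 16 * K.G t / K.h i ≤ |(c₀ : ℝ)| * (K.rad t i / 2) := by
        rw [rad, div_le_iff₀ hh]
        have : |(c₀ : ℝ)| * (K.eps * K.G t * K.X / (K.Q t * K.h i) / 2) * K.h i
            = (|(c₀ : ℝ)| * K.X) * (K.eps * K.G t) / (2 * K.Q t) := by field_simp
        rw [this, le_div_iff₀ (by positivity)]
        have := mul_le_mul_of_nonneg_right hc.le (mul_pos heps hG).le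
        nlinarith [mul_pos (mul_pos heps hG) hQ]
      have h5 := mul_le_mul_of_nonneg_left this (abs_nonneg (W i))
      nlinarith
    linarith

end Chain

namespace Chain

variable {K : Chain}

theorem exists_center (K : Chain) (T : ℕ) (hT : 16 * K.Q T ≤ K.y K.n) :
    ∃ θ : ℕ → ℝ, (∀ i, K.k T ≤ i → θ i = 0) ∧
      ∀ θ' : ℕ → ℝ, (∀ i < K.n, |θ' i - θ i| ≤ K.rad T i) →
        (∀ t ≤ T, K.Adm t θ') ∧ ∀ t < T, ∀ c₀ c d, ¬ K.Danger t θ' c₀ c d := by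
  induction T with
  | zero =>
    refine ⟨fun _ => 0, fun _ _ => rfl, fun θ' h => ⟨?_, by simp⟩⟩
    intro t ht
    obtain rfl : t = 0 := by omega
    have hk := K.k_le 0
    simp only [sub_zero] at h
    exact ⟨fun i hi => (h i (by omega)).trans (K.rad_le hi), fun i _ hi => h i hi⟩
  | succ T ih =>
    have hT' : 16 * K.Q T ≤ K.y K.n := by linarith [K.Q_mono (Nat.le_succ T)]
    obtain ⟨θ, hθ0, hθ⟩ := ih hT'
    obtain ⟨η, hη0, hη, hD⟩ := exists_avoiding_shift hT' fun θ' h => (hθ θ' h).1 T le_rfl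
    have hk : K.k T ≤ K.k (T + 1) := K.k_mono (Nat.le_succ T)
    have hkn := K.k_le (T + 1)
    have hz : ∀ i, K.k T ≤ i → η i = 0 := fun i hi => by rw [hη0 i hi, hθ0 i hi]
    refine ⟨η, fun i hi => hz i (by omega), fun θ' h => ?_⟩
    have hbox : ∀ i < K.n, |θ' i - θ i| ≤ K.rad T i := by
      intro i hi
      have e : θ' i - θ i = (θ' i - η i) + (η i - θ i) := by ring
      rw [e]
      exact (abs_add_le _ _).trans (by linarith [h i hi, hη i])
    obtain ⟨h1, h2⟩ := hθ θ' hbox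
    refine ⟨fun t ht => ?_, fun t ht => ?_⟩
    · rcases Nat.lt_or_ge t (T + 1) with h3 | h3
      · exact h1 t (by omega)
      · obtain rfl : t = T + 1 := by omega
        have hsmall : ∀ i, K.k T ≤ i → i < K.n → |θ' i| ≤ K.rad (T + 1) i := by
          intro i h4 h5
          simpa [hz i h4] using h i h5
        refine ⟨fun i hi => ?_, fun i hi h5 => hsmall i (by omega) h5⟩
        rcases Nat.lt_or_ge i (K.k T) with h4 | h4
        · exact (h1 T le_rfl).1 i h4
        · exact (hsmall i h4 (by omega)).trans (K.rad_le hi)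
    · rcases Nat.lt_or_ge t T with h3 | h3
      · exact h2 t h3
      · obtain rfl : t = T := by omega
        exact hD θ' h

/-- No nonzero vector of size at most `4 Q t` has all its forms small. -/
def Low (K : Chain) (T : ℕ) (θ : ℕ → ℝ) : Prop :=
  ∀ t < T, ∀ (c₀ : ℤ) (c d : ℕ → ℤ), K.size c₀ c ≤ 4 * K.Q t →
    (∀ i < K.n, |K.form θ c₀ c d i| * K.h i < K.eps / 16 * K.G t) →
    c₀ = 0 ∧ c 0 = 0 ∧ c 1 = 0 ∧ ∀ i < K.n, d i = 0

theorem low_of_not_danger {T : ℕ} {θ : ℕ → ℝ} (hT : 16 * K.Q T ≤ K.y K.n)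
    (h : ∀ t < T, ∀ c₀ c d, ¬ K.Danger t θ c₀ c d) : K.Low T θ := by
  intro t ht c₀ c d hs hf
  by_cases hsmall : K.size c₀ c ≤ K.Q 0
  · have h1 := size_le_iff.1 hsmall
    rw [K.Q_zero] at h1
    have hX := K.X_pos
    have hy0 := K.le_y_zero
    have hy1 := K.y_le_succ (Nat.zero_le K.n)
    have z : ∀ (a : ℤ) (r : ℝ), K.X ≤ r → |(a : ℝ)| * r ≤ K.X / 2 → a = 0 := by
      intro a r hr ha
      apply int_eq_zero_of_abs_lt
      by_contra hc
      push Not at hc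
      nlinarith
    have z0 := z c₀ _ le_rfl h1.1
    have z1 := z (c 0) _ hy0 h1.2.1
    have z2 := z (c 1) _ (hy0.trans hy1) h1.2.2
    refine ⟨z0, z1, z2, fun i hi => ?_⟩
    have h2 : K.form θ c₀ c d i = d i := by
      rcases Nat.mod_two_eq_zero_or_one i with h | h <;> simp [form, h, z0, z1, z2]
    have h3 := hf i hi
    have h4 := K.h_pos i
    have h5 : K.G t ≤ K.h i := K.G_le_h (by linarith [K.Q_mono ht.le]) hi
    have h6 := K.eps_pos
    have h7 := K.eps_le
    rw [h2] at h3
    apply int_eq_zero_of_abs_lt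
    by_contra hc
    push Not at hc
    nlinarith
  · exfalso
    push Not at hsmall
    -- the scale of the vector
    have hex : ∃ s, K.size c₀ c ≤ 4 * K.Q s := ⟨t, hs⟩
    classical
    set s := Nat.find hex with hsdef
    have h1 : K.size c₀ c ≤ 4 * K.Q s := Nat.find_spec hex
    have h2 : s ≤ t := Nat.find_min' hex hs
    have h3 : K.Q s < K.size c₀ c := by
      rcases Nat.eq_zero_or_pos s with h0 | h0
      · rwa [h0]
      · have := Nat.find_min hex (show s - 1 < Nat.find hex by omega)
        have e : K.Q s = 4 * K.Q (s - 1) := by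
          rw [← K.Q_succ]; congr 1; omega
        rw [e]
        exact not_le.1 this
    refine h s (by omega) c₀ c d ⟨h3, h1, fun i hi => (hf i hi).trans_le ?_⟩
    have := K.G_anti h2 (by linarith [K.Q_mono ht.le])
    have h6 := K.eps_pos
    gcongr

theorem exists_small_active {t : ℕ} {θ : ℕ → ℝ} (hθ : K.Adm t θ) :
    ∃ (c₀ : ℤ) (c d : ℕ → ℤ), (c₀ ≠ 0 ∨ c 0 ≠ 0 ∨ c 1 ≠ 0 ∨ ∃ i < K.n, d i ≠ 0) ∧
      (∀ i, K.k t ≤ i + 2 → d i = 0) ∧ K.size c₀ c ≤ 600 * K.Q t ∧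
      (∀ r < 2, |(c r : ℝ)| * K.y r ≤ 32 * K.y (K.k t - 1) + 512 * K.eps * (|(c₀ : ℝ)| * K.X)) ∧
      |(c₀ : ℝ)| * K.X ≤ 2 * K.Q t ∧
      ∀ i < K.k t, |K.form θ c₀ c d i| * K.h i ≤ K.G t := by
  have hk := K.k_pos t
  have hkn := K.k_le t
  have hX := K.X_pos
  have hQ := K.Q_pos t
  have hG := K.G_pos t
  set B : Fin (K.k t + 1) → ℝ :=
    Fin.lastCases (2 * K.Q t / K.X) (fun i => K.G t / K.h i) with hB
  have hdet := K.det_formMatrix θ hk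
  set S := ∏ i ∈ Finset.range (K.k t), (K.s i : ℝ) with hS
  have hSpos : 0 < S := Finset.prod_pos fun i _ => K.s_pos' i
  have hdet' : (K.formMatrix θ (K.k t)).det = S⁻¹ := eq_inv_of_mul_eq_one_left hdet
  have hBpos : ∀ i, 0 < B i := by
    intro i
    refine Fin.lastCases ?_ (fun i => ?_) i
    · simp only [hB, Fin.lastCases_last]; positivity
    · simp only [hB, Fin.lastCases_castSucc]; exact div_pos hG (K.h_pos i)
  have hprod : ∏ i, B i = 2 * S⁻¹ := by
    rw [Fin.prod_univ_castSucc]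
    simp only [hB, Fin.lastCases_castSucc, Fin.lastCases_last]
    rw [Fin.prod_univ_eq_prod_range (fun i => K.G t / K.h i), Finset.prod_div_distrib,
      Finset.prod_const, Finset.card_range]
    have h2 := K.G_pow t
    have hH : 0 < ∏ i ∈ Finset.range (K.k t), K.h i := Finset.prod_pos fun i _ => K.h_pos i
    have h3 : K.P (K.k t) = K.X * ((∏ i ∈ Finset.range (K.k t), K.h i) / S) := by
      simp [P, lam, Finset.prod_div_distrib, hS]
    rw [h3] at h2
    field_simp
    field_simp at h2
    linarith
  obtain ⟨q, hq0, hq⟩ := Matrix.exists_small_of_prod_gt _ B hBpos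
    (by rw [hdet']; exact (inv_pos.2 hSpos).ne')
    (by rw [hdet', hprod, abs_of_pos (inv_pos.2 hSpos)]; linarith [inv_pos.2 hSpos])
  obtain ⟨c₀, c, d, rfl, hd, hc1⟩ := exists_coords_eq hk q
  have hf : ∀ i < K.k t, |K.form θ c₀ c d i| * K.h i ≤ K.G t := by
    intro i hi
    have := hq (Fin.castSucc ⟨i, hi⟩)
    rw [K.formMatrix_mulVec_castSucc θ c₀ c d fun i h _ => hd i h] at this
    simp only [hB, Fin.lastCases_castSucc] at this
    rwa [le_div_iff₀ (K.h_pos i)] at this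
  have hc0 : |(c₀ : ℝ)| * K.X ≤ 2 * K.Q t := by
    have := hq (Fin.last _)
    rw [K.formMatrix_mulVec_last] at this
    simp only [hB, Fin.lastCases_last] at this
    rwa [le_div_iff₀ hX] at this
  have hcol : ∀ r < 2,
      |(c r : ℝ)| * K.y r ≤ 32 * K.y (K.k t - 1) + 512 * K.eps * (|(c₀ : ℝ)| * K.X) := by
    intro r hr
    have := column_le hθ (c₀ := c₀) zero_le_one (fun i h _ => hd i h) hc1
      (fun i _ hi => by rw [one_mul]; exact hf i hi) hr
    rwa [mul_one] at this
  have hy := K.y_le_of_lt_k (t := t) (i := K.k t - 1) (by omega)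
  have he := K.eps_le
  have hcol' : ∀ r < 2, |(c r : ℝ)| * K.y r ≤ 600 * K.Q t := by
    intro r hr
    have h1 : K.eps * (|(c₀ : ℝ)| * K.X) ≤ 1 / 8192 * (2 * K.Q t) :=
      mul_le_mul he hc0 (by positivity) (by norm_num)
    linarith [hcol r hr]
  refine ⟨c₀, c, d, ?_, hd, ?_, hcol, hc0, hf⟩
  · by_contra hcon
    push Not at hcon
    obtain ⟨z0, z1, z2, z3⟩ := hcon
    apply hq0
    funext j
    have hj := j.2
    simp only [coords, Pi.zero_apply]
    split_ifs with h1 h2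
    · exact z0
    · exact z3 _ (by omega)
    · rcases Nat.mod_two_eq_zero_or_one (j : ℕ) with h | h <;> rw [h] <;> assumption
  · exact size_le_iff.2 ⟨by linarith, hcol' 0 (by norm_num), hcol' 1 (by norm_num)⟩

theorem exists_small {t : ℕ} (ht : 16 * K.Q t ≤ K.y K.n) {θ : ℕ → ℝ} (hθ : K.Adm t θ) :
    ∃ (c₀ : ℤ) (c d : ℕ → ℤ), (c₀ ≠ 0 ∨ c 0 ≠ 0 ∨ c 1 ≠ 0 ∨ ∃ i < K.n, d i ≠ 0) ∧
      K.size c₀ c ≤ 600 * K.Q t ∧ ∀ i < K.n, |K.form θ c₀ c d i| * K.h i ≤ 50 * K.G t := by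
  obtain ⟨c₀, c, d, hne, hd, hs, -, hc0, hf⟩ := exists_small_active hθ
  refine ⟨c₀, c, d, hne, hs, fun i hi => ?_⟩
  have hG := K.G_pos t
  rcases Nat.lt_or_ge i (K.k t) with hik | hik
  · linarith [hf i hik]
  · have hh := K.h_pos i
    have hQ := K.Q_pos t
    have hX := K.X_pos
    have he := K.eps_le
    have he0 := K.eps_pos
    have hsz := size_le_iff.1 hs
    have hcm : |(c (i % 2) : ℝ)| * K.y (i % 2) ≤ 600 * K.Q t := by
      rcases Nat.mod_two_eq_zero_or_one i with h | h <;> rw [h]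
      exacts [hsz.2.1, hsz.2.2]
    have hyi := K.le_y_of_k_le ht hik (by omega)
    have hl := K.lam_le_G ht hik hi
    have hsi := K.s_pos' i
    rw [lam, div_le_iff₀ hsi] at hl
    have e1 : |(c (i % 2) : ℝ) / parityProd K.s i| * K.h i ≤ 38 * K.G t := by
      rw [K.abs_div_den i, K.y_add_two]
      have hypos := K.y_pos i (by omega)
      rw [div_mul_eq_mul_div, div_le_iff₀ (by positivity)]
      calc _ ≤ 600 * K.Q t * (K.G t * K.s i) := by gcongr
        _ = (600 / 16) * (16 * K.Q t) * (K.G t * K.s i) := by ring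
        _ ≤ 38 * K.y i * (K.G t * K.s i) := by gcongr; norm_num
        _ = _ := by ring
    have e2 : |(c₀ : ℝ) * θ i| * K.h i ≤ 2 * K.eps * K.G t := by
      rw [abs_mul]
      have := hθ.2 i hik hi
      calc |(c₀ : ℝ)| * |θ i| * K.h i ≤ |(c₀ : ℝ)| * K.rad t i * K.h i := by gcongr
        _ = (|(c₀ : ℝ)| * K.X) * (K.eps * K.G t) / K.Q t := by rw [rad]; field_simp
        _ ≤ (2 * K.Q t) * (K.eps * K.G t) / K.Q t := by gcongr
        _ = _ := by field_simp
    have e3 : K.form θ c₀ c d i = (c (i % 2) : ℝ) / parityProd K.s i + c₀ * θ i := by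
      rw [form, hd i (by omega)]; simp
    rw [e3]
    have := abs_add_le ((c (i % 2) : ℝ) / parityProd K.s i) (c₀ * θ i)
    nlinarith

theorem exists_shift_with_kernel (K : Chain) {T τ : ℕ} (hT0 : 1 ≤ T)
    (hT : 16 * K.Q (T + τ) ≤ K.y K.n) (hk : K.k T = K.n) (hy : 64 * K.y (K.n - 1) ≤ K.Q T)
    (hτ : ((1 / 4 : ℝ) ^ (1 / (K.n : ℝ))) ^ τ ≤ K.eps / 32) :
    ∃ θ : ℕ → ℝ, (∀ t ≤ T, K.Adm t θ) ∧ K.Low T θ ∧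
      ∃ (c₀ : ℤ) (c d : ℕ → ℤ), c₀ ≠ 0 ∧ K.size c₀ c ≤ 600 * K.Q (T + τ) ∧
        ∀ i < K.n, K.form θ c₀ c d i = 0 := by
  have hT' : 16 * K.Q T ≤ K.y K.n := by linarith [K.Q_mono (Nat.le_add_right T τ)]
  obtain ⟨θ, hθ0, hθ⟩ := K.exists_center T hT'
  have hrefl : ∀ i < K.n, |θ i - θ i| ≤ K.rad T i := fun i _ => by
    simpa using (K.rad_pos T i).le
  obtain ⟨hA, hD⟩ := hθ θ hrefl
  have hk' : K.k (T + τ) = K.n :=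
    le_antisymm (K.k_le _) (hk ▸ K.k_mono (Nat.le_add_right T τ))
  have hA' : K.Adm (T + τ) θ := by
    refine ⟨fun i hi => (hA T le_rfl).1 i (by omega), fun i h1 h2 => by omega⟩
  obtain ⟨c₀, c, d, hne, -, hs, hcol, -, hf⟩ := exists_small_active hA'
  rw [hk'] at hf hcol
  have hG := K.G_pos T
  have hGe : K.G (T + τ) ≤ K.eps / 32 * K.G T :=
    (K.G_add_le hT).trans (mul_le_mul_of_nonneg_right hτ hG.le)
  have he := K.eps_pos
  have he' := K.eps_le
  have hX := K.X_pos
  have hQ := K.Q_pos T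
  have hsize : K.Q T < K.size c₀ c := by
    by_contra hc
    push Not at hc
    have e : K.Q T = 4 * K.Q (T - 1) := by rw [← K.Q_succ]; congr 1; omega
    have hGT := K.G_anti (show T - 1 ≤ T by omega) hT'
    have := low_of_not_danger hT' hD (T - 1) (by omega) c₀ c d (by rwa [← e]) (fun i hi => by
      have := hf i hi
      nlinarith)
    rcases hne with h | h | h | ⟨i, hi, h⟩
    · exact h this.1
    · exact h this.2.1
    · exact h this.2.2.1
    · exact h (this.2.2.2 i hi)
  have hc0 : K.Q T / 2 < |(c₀ : ℝ)| * K.X := by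
    by_contra hc
    push Not at hc
    have key : ∀ r < 2, |(c r : ℝ)| * K.y r ≤ K.Q T := by
      intro r hr
      have h1 := hcol r hr
      have h2 : K.eps * (|(c₀ : ℝ)| * K.X) ≤ 1 / 8192 * (K.Q T / 2) :=
        mul_le_mul he' hc (by positivity) (by norm_num)
      linarith
    exact absurd (size_le_iff.2 ⟨by linarith, key 0 (by norm_num), key 1 (by norm_num)⟩)
      (not_le.2 hsize)
  have hc0' : (c₀ : ℝ) ≠ 0 := by
    intro h
    rw [h] at hc0
    simp at hc0
    linarith
  set η : ℕ → ℝ := fun i => θ i - K.form θ c₀ c d i / c₀ with hη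
  obtain ⟨hB, hE⟩ := hθ η (by
    intro i hi
    have hh := K.h_pos i
    simp only [hη, sub_sub_cancel_left, abs_neg, abs_div]
    rw [div_le_iff₀ (abs_pos.2 hc0'), rad]
    refine le_of_mul_le_mul_right ((hf i hi).trans ?_) hh
    have e : K.eps * K.G T * K.X / (K.Q T * K.h i) * |(c₀ : ℝ)| * K.h i
        = K.eps * K.G T * (|(c₀ : ℝ)| * K.X) / K.Q T := by field_simp
    rw [e, le_div_iff₀ hQ]
    have h1 := mul_lt_mul_of_pos_left hc0 (mul_pos he hG)
    have h2 := mul_le_mul_of_nonneg_right hGe hQ.le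
    linarith [mul_pos (mul_pos he hG) hQ])
  refine ⟨η, hB, low_of_not_danger hT' hE, c₀, c, d, by exact_mod_cast hc0', hs, fun i hi => ?_⟩
  rw [form_sub θ η]
  simp only [hη]
  field_simp
  ring

end Chain

/-- Growth exponents of the lengths in a chain whose second exponent ratio is `ρ`. -/
noncomputable def growthExp (ρ : ℝ) : ℕ → ℝ
  | 0 => 0
  | 1 => 1
  | 2 => ρ
  | j + 3 => growthExp ρ (j + 1) + (2 * growthExp ρ (j + 1) + growthExp ρ (j + 2)) / (j + 1)

theorem exists_growthExp (n : ℕ) (r : ℝ) (h1 : 1 < r) (h2 : n * r < n + 3) :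
    ∃ ρ : ℝ, (∀ j ≤ n + 1, growthExp ρ j < growthExp ρ (j + 1)) ∧
      growthExp ρ (n + 2) = r * growthExp ρ (n + 1) ∧
      ∀ k, 1 ≤ k → k ≤ n + 1 → k * ((2 + r) / (n + 1)) * growthExp ρ k ≤
        2 * growthExp ρ k + growthExp ρ (k + 1) := by
  induction n generalizing r with
  | zero =>
    refine ⟨r, ?_, ?_, ?_⟩
    · intro j hj
      interval_cases j <;> simp [growthExp, h1]
    · simp [growthExp]
    · intro k hk hk'
      obtain rfl : k = 1 := by omega
      simp [growthExp]
  | succ n ih =>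
    push_cast at h2 ⊢
    set N : ℝ := (n : ℝ) + 1 with hN
    have hN1 : (1 : ℝ) ≤ N := by rw [hN]; have : (0 : ℝ) ≤ n := Nat.cast_nonneg n; linarith
    have hden : 0 < N * r - 1 := by nlinarith
    have hr' : 1 < (N + 2) / (N * r - 1) := by rw [one_lt_div hden]; linarith
    obtain ⟨ρ, i1, i2, i3⟩ := ih ((N + 2) / (N * r - 1)) hr' (by
      rw [← mul_div_assoc, div_lt_iff₀ hden]
      have : (n : ℝ) = N - 1 := by rw [hN]; ring
      rw [this]
      nlinarith [mul_pos (show 0 < N * (r - 1) by nlinarith) (show 0 < N + 2 by linarith)])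
    set r' := (N + 2) / (N * r - 1) with hr'def
    have hr'eq : r' * (N * r - 1) = N + 2 := div_mul_cancel₀ _ hden.ne'
    have hpos : ∀ j ≤ n + 1, 0 < growthExp ρ (j + 1) := by
      intro j hj
      induction j with
      | zero => simp [growthExp]
      | succ j ihj => exact (ihj (by omega)).trans (i1 _ (by omega))
    have hz : growthExp ρ (n + 3) = r * growthExp ρ (n + 2) := by
      rw [growthExp, i2, ← hN]
      have : N ≠ 0 := by positivity
      field_simp
      have hp := hpos n (by omega)
      linear_combination -growthExp ρ (n + 1) * hr'eq
    refine ⟨ρ, ?_, hz, ?_⟩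
    · intro j hj
      rcases Nat.lt_or_ge j (n + 2) with h | h
      · exact i1 j (by omega)
      · obtain rfl : j = n + 2 := by omega
        rw [hz]
        have := hpos (n + 1) le_rfl
        nlinarith
    · intro k hk hk'
      rcases Nat.lt_or_ge k (n + 2) with h | h
      · refine le_trans ?_ (i3 k hk (by omega))
        have hp : 0 < growthExp ρ k := by
          obtain ⟨j, rfl⟩ : ∃ j, k = j + 1 := ⟨k - 1, by omega⟩
          exact hpos j (by omega)
        have : (2 + r) / (N + 1) ≤ (2 + r') / N := by
          rw [div_le_div_iff₀ (by positivity) (by positivity)]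
          -- at the upper end `r = (N + 3) / N` both sides agree
          have hNr : N * r ≤ N + 3 := by linarith
          nlinarith
        gcongr
      · obtain rfl : k = n + 2 := by omega
        rw [hz]
        push_cast
        have : N + 1 ≠ 0 := by positivity
        have e : ((n : ℝ) + 2) = N + 1 := by rw [hN]; ring
        rw [e]
        field_simp
        exact le_of_eq (by ring)

section

open Topology

theorem growthExp_pos {ρ : ℝ} (hρ : 0 < ρ) : ∀ j, 0 < growthExp ρ (j + 1)
  | 0 => by simp [growthExp]
  | 1 => by simpa [growthExp] using hρ
  | j + 2 => by
    have h1 := growthExp_pos hρ j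
    have h2 := growthExp_pos hρ (j + 1)
    rw [growthExp]
    positivity

theorem exists_two_step_recursion (F : ℕ → ℝ → ℝ → ℕ) (a b : ℝ) :
    ∃ (y : ℕ → ℝ) (s : ℕ → ℕ), y 0 = a ∧ y 1 = b ∧ (∀ j, y (j + 2) = y j * s j) ∧
      ∀ j, s j = F j (y j) (y (j + 1)) := by
  let p : ℕ → ℝ × ℝ := fun j => Nat.rec (a, b) (fun j q => (q.2, q.1 * F j q.1 q.2)) j
  exact ⟨fun j => (p j).1, fun j => F j (p j).1 (p j).2, rfl, rfl, fun j => rfl, fun j => rfl⟩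

/-- `f T` grows like `T ^ (a + o(1))`. -/
def HasLogExp (f : ℕ → ℝ) (a : ℝ) : Prop :=
  (∀ᶠ T in atTop, 0 < f T) ∧
    Tendsto (fun T : ℕ => Real.log (f T) / Real.log T) atTop (𝓝 a)

namespace HasLogExp

theorem tendsto_log_natCast : Tendsto (fun T : ℕ => Real.log T) atTop atTop :=
  Real.tendsto_log_atTop.comp tendsto_natCast_atTop_atTop

theorem const {c : ℝ} (hc : 0 < c) : HasLogExp (fun _ => c) 0 :=
  ⟨Eventually.of_forall fun _ => hc, tendsto_log_natCast.const_div_atTop _⟩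

theorem natCast : HasLogExp (fun T => (T : ℝ)) 1 := by
  refine ⟨?_, ?_⟩
  · filter_upwards [eventually_gt_atTop 0] with T hT
    exact_mod_cast hT
  · refine tendsto_const_nhds.congr' ?_
    filter_upwards [tendsto_log_natCast.eventually_gt_atTop 0] with T hT
    rw [div_self hT.ne']

theorem mul {f g : ℕ → ℝ} {a b : ℝ} (hf : HasLogExp f a) (hg : HasLogExp g b) :
    HasLogExp (fun T => f T * g T) (a + b) := by
  refine ⟨by filter_upwards [hf.1, hg.1] with T h1 h2 using mul_pos h1 h2, ?_⟩
  refine (hf.2.add hg.2).congr' ?_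
  filter_upwards [hf.1, hg.1] with T h1 h2
  rw [Real.log_mul h1.ne' h2.ne', add_div]

theorem rpow {f : ℕ → ℝ} {a : ℝ} (hf : HasLogExp f a) (r : ℝ) :
    HasLogExp (fun T => f T ^ r) (r * a) := by
  refine ⟨by filter_upwards [hf.1] with T h1 using Real.rpow_pos_of_pos h1 _, ?_⟩
  refine (hf.2.const_mul r).congr' ?_
  filter_upwards [hf.1] with T h1
  rw [Real.log_rpow h1, mul_div_assoc]

theorem tendsto_log {f : ℕ → ℝ} {a : ℝ} (hf : HasLogExp f a) (ha : 0 < a) :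
    Tendsto (fun T => Real.log (f T)) atTop atTop := by
  refine (hf.2.pos_mul_atTop ha tendsto_log_natCast).congr' ?_
  filter_upwards [tendsto_log_natCast.eventually_gt_atTop 0] with T hT
  field_simp

theorem tendsto {f : ℕ → ℝ} {a : ℝ} (hf : HasLogExp f a) (ha : 0 < a) :
    Tendsto f atTop atTop := by
  refine (Real.tendsto_exp_atTop.comp (hf.tendsto_log ha)).congr' ?_
  filter_upwards [hf.1] with T h1
  exact Real.exp_log h1

theorem ceil {f : ℕ → ℝ} {a : ℝ} (hf : HasLogExp f a) (ha : 0 < a) :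
    HasLogExp (fun T => (⌈f T⌉₊ : ℝ)) a := by
  refine ⟨by filter_upwards [hf.1] with T h1 using by exact_mod_cast Nat.ceil_pos.2 h1, ?_⟩
  have h2 := ((const (c := 2) two_pos).mul hf).2
  rw [zero_add] at h2
  refine tendsto_of_tendsto_of_tendsto_of_le_of_le' hf.2 h2 ?_ ?_
  · filter_upwards [hf.1, tendsto_log_natCast.eventually_gt_atTop 0] with T h1 hT
    have := Nat.le_ceil (f T)
    gcongr
  · filter_upwards [(hf.tendsto ha).eventually_ge_atTop 1,
      tendsto_log_natCast.eventually_gt_atTop 0] with T h1 hT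
    have := (Nat.ceil_lt_add_one (show 0 ≤ f T by linarith)).le
    have h0 : (0 : ℝ) < ⌈f T⌉₊ := by exact_mod_cast Nat.ceil_pos.2 (by linarith)
    gcongr
    linarith

theorem div {f g : ℕ → ℝ} {a b : ℝ} (hf : HasLogExp f a) (hg : HasLogExp g b) :
    HasLogExp (fun T => f T / g T) (a - b) := by
  have := hf.mul (hg.rpow (-1))
  rw [show a + -1 * b = a - b by ring] at this
  refine ⟨by filter_upwards [hf.1, hg.1] with T h1 h2 using div_pos h1 h2, this.2.congr' ?_⟩
  filter_upwards [hg.1] with T h2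
  rw [Real.rpow_neg_one, ← div_eq_mul_inv]

/-- Comparison of logarithms for two functions of positive growth exponents. -/
theorem eventually_log_near {f g : ℕ → ℝ} {a b : ℝ} (hf : HasLogExp f a) (ha : 0 < a)
    (hg : HasLogExp g b) {δ : ℝ} (hδ : 0 < δ) :
    ∀ᶠ T in atTop, |Real.log (g T) - b / a * Real.log (f T)| ≤ δ * Real.log (f T) := by
  have h : Tendsto (fun T => Real.log (g T) / Real.log (f T)) atTop (𝓝 (b / a)) := by
    refine (hg.2.div hf.2 ha.ne').congr' ?_
    filter_upwards [tendsto_log_natCast.eventually_gt_atTop 0] with T hT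
    exact div_div_div_cancel_right₀ hT.ne' _ _
  filter_upwards [h.eventually (Metric.ball_mem_nhds _ hδ),
    (hf.tendsto_log ha).eventually_gt_atTop 0] with T h1 h2
  rw [Real.dist_eq] at h1
  have : Real.log (g T) - b / a * Real.log (f T) =
      (Real.log (g T) / Real.log (f T) - b / a) * Real.log (f T) := by field_simp
  rw [this, abs_mul, abs_of_pos h2]
  gcongr

end HasLogExp

theorem prod_div_mul_eq {y h : ℕ → ℝ} {s : ℕ → ℕ} (ys : ∀ j, y (j + 2) = y j * s j)
    (hs : ∀ j, 1 ≤ s j) (j : ℕ) :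
    (∏ i ∈ Finset.range j, h i / s i) * (y j * y (j + 1)) =
      y 0 * y 1 * ∏ i ∈ Finset.range j, h i := by
  induction j with
  | zero => simp
  | succ j ih =>
    rw [Finset.prod_range_succ _ j, Finset.prod_range_succ h, ← mul_assoc (y 0 * y 1), ← ih, ys]
    have : (s j : ℝ) ≠ 0 := by exact_mod_cast Nat.one_le_iff_ne_zero.1 (hs j)
    field_simp

theorem Chain.P_mul_y (K : Chain) (j : ℕ) :
    K.P j * (K.y j * K.y (j + 1)) = K.X * (K.y 0 * K.y 1) * ∏ i ∈ Finset.range j, K.h i := by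
  have := prod_div_mul_eq (h := K.h) K.y_add_two K.s_pos j
  rw [mul_assoc K.X, ← this, Chain.P]
  simp only [Chain.lam]
  ring

theorem exists_chain_family {n : ℕ} (hn : 1 ≤ n) {X XA X₁ κ ρ : ℝ} (hX : 0 < X) (hXA : X ≤ XA)
    (hXA' : XA ≤ 2 * X) (hX₁ : 0 < X₁) (hκ : 0 < κ) {h : ℕ → ℝ} (hh : ∀ i, 0 < h i)
    (hρ : ∀ j ≤ n, growthExp ρ j < growthExp ρ (j + 1)) :
    ∃ K : ℕ → Chain, (∀ᶠ T : ℕ in atTop, (K T).n = n ∧ (K T).X = X ∧ (K T).y 0 = XA ∧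
      (K T).y 1 = T * X₁ ∧ (K T).h 0 = κ / T ∧ ∀ i, (K T).h (i + 1) = h (i + 1)) ∧
      (∀ j, HasLogExp (fun T => (K T).y j) (growthExp ρ j)) ∧
      Tendsto (fun T => ((K T).s 0 : ℝ)) atTop atTop := by
  have hρ1 : 1 < ρ := by simpa [growthExp] using hρ 1 hn
  have hρ0 : 0 < ρ := by linarith
  let B : ℕ → ℝ := fun j => X * XA * (X₁ * κ) * ∏ i ∈ Finset.range (j - 1), h (i + 1)
  have hXA0 : 0 < XA := hX.trans_le hXA
  have hB : ∀ j, 0 < B j := fun j =>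
    mul_pos (by positivity) (Finset.prod_pos fun i _ => hh _)
  let z : ℕ → ℝ → ℝ → ℝ := fun j a b => h j * (a ^ 2 * b / B j) ^ (1 / (j : ℝ))
  choose y s y0 y1 ys sF using fun T : ℕ => exists_two_step_recursion
    (fun j a b => if j = 0 then ⌈(T : ℝ) ^ ρ⌉₊ else ⌈z j a b⌉₊) XA (T * X₁)
  have s0 : ∀ T, s T 0 = ⌈(T : ℝ) ^ ρ⌉₊ := fun T => by rw [sF, if_pos rfl]
  have sj : ∀ T j, s T (j + 1) = ⌈z (j + 1) (y T (j + 1)) (y T (j + 2))⌉₊ := fun T j => by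
    rw [sF, if_neg (Nat.succ_ne_zero j)]
  have hTρ : HasLogExp (fun T : ℕ => (T : ℝ) ^ ρ) ρ := by
    simpa using HasLogExp.natCast.rpow ρ
  have hz : ∀ j a b, HasLogExp (fun T => y T (j + 1)) a → HasLogExp (fun T => y T (j + 2)) b →
      HasLogExp (fun T => z (j + 1) (y T (j + 1)) (y T (j + 2))) ((2 * a + b) / (j + 1)) := by
    intro j a b ha hb
    have h1 : HasLogExp (fun T => y T (j + 1) ^ 2) (2 * a) := by
      have := ha.mul ha
      rw [← two_mul] at this
      simpa only [← pow_two] using this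
    have := (HasLogExp.const (hh (j + 1))).mul
      (((h1.mul hb).div (HasLogExp.const (hB (j + 1)))).rpow (1 / ((j + 1 : ℕ) : ℝ)))
    convert this using 1
    push_cast
    ring
  have hy : ∀ j, HasLogExp (fun T => y T j) (growthExp ρ j) := by
    have : ∀ j, HasLogExp (fun T => y T j) (growthExp ρ j) ∧
        HasLogExp (fun T => y T (j + 1)) (growthExp ρ (j + 1)) ∧
        HasLogExp (fun T => y T (j + 2)) (growthExp ρ (j + 2)) := by
      intro j
      induction j with
      | zero =>
        refine ⟨?_, ?_, ?_⟩
        · simpa [y0, growthExp] using HasLogExp.const hXA0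
        · simpa [y1, growthExp] using HasLogExp.natCast.mul (HasLogExp.const hX₁)
        · simpa [ys, y0, s0, growthExp] using (HasLogExp.const hXA0).mul (hTρ.ceil hρ0)
      | succ j ih =>
        refine ⟨ih.2.1, ih.2.2, ?_⟩
        have hp1 := growthExp_pos hρ0 j
        have hp2 := growthExp_pos hρ0 (j + 1)
        have := ih.2.1.mul ((hz j _ _ ih.2.1 ih.2.2).ceil (by positivity))
        simp only [← sj] at this
        simp only [ys _ (j + 1)]
        exact this
    exact fun j => (this j).1
  have key : ∀ᶠ T : ℕ in atTop, ∃ K : Chain, K.n = n ∧ K.X = X ∧ K.y = y T ∧ K.s = s T ∧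
      K.h 0 = κ / T ∧ ∀ i, K.h (i + 1) = h (i + 1) := by
    have e1 : ∀ᶠ T : ℕ in atTop, ∀ i ∈ Finset.range (n + 1),
        16 * 2 ^ n * y T i ≤ y T (i + 1) := by
      rw [Filter.eventually_all_finset]
      intro i hi
      have := ((hy (i + 1)).div (hy i)).tendsto
        (sub_pos.2 (hρ i (by simpa [Nat.lt_succ_iff] using hi)))
      filter_upwards [this.eventually_ge_atTop (16 * 2 ^ n), (hy i).1] with T h1 h2
      rwa [le_div_iff₀ h2] at h1
    have e2 : ∀ᶠ T : ℕ in atTop, ∀ i ∈ Finset.range n,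
        1 ≤ z (i + 1) (y T (i + 1)) (y T (i + 2)) := by
      rw [Filter.eventually_all_finset]
      intro i hi
      have hp1 := growthExp_pos hρ0 i
      have hp2 := growthExp_pos hρ0 (i + 1)
      exact ((hz i _ _ (hy _) (hy _)).tendsto (by positivity)).eventually_ge_atTop 1
    have e3 : ∀ᶠ T : ℕ in atTop, ∀ i ∈ Finset.range n, 2 * (κ / T) ≤ h (i + 1) := by
      rw [Filter.eventually_all_finset]
      intro i hi
      have : Tendsto (fun T : ℕ => 2 * (κ / (T : ℝ))) atTop (𝓝 (2 * 0)) :=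
        (tendsto_const_div_atTop_nhds_zero_nat κ).const_mul 2
      rw [mul_zero] at this
      exact (this.eventually_lt_const (hh (i + 1))).mono fun T hT => hT.le
    have e4 : ∀ᶠ T : ℕ in atTop, 2 ≤ (T : ℝ) ^ ρ := (hTρ.tendsto hρ0).eventually_ge_atTop 2
    filter_upwards [e1, e2, e3, e4, eventually_gt_atTop 0] with T f1 f2 f3 f4 hT
    have hT0 : (0 : ℝ) < T := by exact_mod_cast hT
    have hs0 : 2 ≤ s T 0 := by
      rw [s0]
      exact_mod_cast f4.trans (Nat.le_ceil _)
    have hzpos : ∀ j, 0 < y T (j + 1) → 0 < y T (j + 2) →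
        0 < z (j + 1) (y T (j + 1)) (y T (j + 2)) := fun j h1 h2 =>
      mul_pos (hh _) (Real.rpow_pos_of_pos (div_pos (by positivity) (hB _)) _)
    have hpos : ∀ j, 0 < y T j ∧ 0 < y T (j + 1) ∧ 1 ≤ s T j := by
      intro j
      induction j with
      | zero =>
        rw [y0, y1]
        exact ⟨hXA0, by positivity, by omega⟩
      | succ j ih =>
        have h2 : 0 < y T (j + 2) := by
          rw [ys]
          exact mul_pos ih.1 (by exact_mod_cast ih.2.2)
        refine ⟨ih.2.1, h2, ?_⟩
        rw [sj]
        exact Nat.ceil_pos.2 (hzpos j ih.2.1 h2)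
    let H : ℕ → ℝ := fun i => if i = 0 then κ / T else h i
    have H0 : H 0 = κ / T := if_pos rfl
    have HS : ∀ i, H (i + 1) = h (i + 1) := fun i => if_neg (Nat.succ_ne_zero i)
    have hBP : ∀ j, X * (∏ i ∈ Finset.range (j + 1), H i / s T i) *
        (y T (j + 1) * y T (j + 2)) = B (j + 1) := by
      intro j
      rw [mul_assoc, prod_div_mul_eq (ys T) (fun j => (hpos j).2.2), Finset.prod_range_succ']
      simp only [H0, HS, y0, y1, B, Nat.add_sub_cancel]
      field_simp
    have hzpow : ∀ j, (z (j + 1) (y T (j + 1)) (y T (j + 2)) / h (j + 1)) ^ (j + 1) *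
        B (j + 1) = y T (j + 1) ^ 2 * y T (j + 2) := by
      intro j
      have h1 := (hpos (j + 1)).1
      have h2 := (hpos (j + 2)).1
      have hb := hB (j + 1)
      simp only [z]
      rw [mul_div_cancel_left₀ _ (hh _).ne', ← Real.rpow_natCast, ← Real.rpow_mul (by positivity),
        one_div_mul_cancel (by positivity), Real.rpow_one, div_mul_cancel₀ _ hb.ne']
    refine ⟨⟨n, hn, X, hX, y T, s T, H, fun i => (hpos i).2.2, ?_, ys T, by rwa [y0],
      by rwa [y0], fun i hi => f1 i (by simpa [Nat.lt_succ_iff] using hi), ?_, ?_, ?_⟩,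
      rfl, rfl, rfl, rfl, H0, HS⟩
    · rintro (_ | i)
      · rw [H0]; positivity
      · rw [HS]; exact hh _
    · rintro (_ | j) hj hjn
      · omega
      have h1 := (hpos (j + 1)).1
      have h2 := (hpos (j + 2)).1
      have hz0 := hzpos j h1 h2
      have hsj : z (j + 1) (y T (j + 1)) (y T (j + 2)) ≤ s T (j + 1) := by
        rw [sj]; exact Nat.le_ceil _
      have hh1 := hh (j + 1)
      rw [HS]
      refine le_of_mul_le_mul_right ?_ (mul_pos h1 h2)
      rw [hBP]
      calc (h (j + 1) / s T (j + 1)) ^ (j + 1) * y T (j + 1) * (y T (j + 1) * y T (j + 2))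
          ≤ (h (j + 1) / z (j + 1) (y T (j + 1)) (y T (j + 2))) ^ (j + 1) *
            y T (j + 1) * (y T (j + 1) * y T (j + 2)) := by gcongr
        _ = B (j + 1) := by
            have := hzpow j
            have hinv : (h (j + 1) / z (j + 1) (y T (j + 1)) (y T (j + 2))) ^ (j + 1) *
                (z (j + 1) (y T (j + 1)) (y T (j + 2)) / h (j + 1)) ^ (j + 1) = 1 := by
              rw [← mul_pow, div_mul_div_cancel₀ hz0.ne', div_self hh1.ne', one_pow]
            rw [mul_assoc, ← mul_assoc (y T (j + 1)), ← pow_two, ← this, ← mul_assoc, hinv, one_mul]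
    · rintro (_ | j) hj hjn
      · omega
      have h1 := (hpos (j + 1)).1
      have h2 := (hpos (j + 2)).1
      have hz0 := hzpos j h1 h2
      have hsj : (s T (j + 1) : ℝ) ≤ 2 * z (j + 1) (y T (j + 1)) (y T (j + 2)) := by
        have h1 := f2 j (by simp; omega)
        have := Nat.ceil_lt_add_one hz0.le
        rw [sj]
        linarith
      have hs1 : (0 : ℝ) < s T (j + 1) := by exact_mod_cast (hpos (j + 1)).2.2
      have hh1 := hh (j + 1)
      rw [HS]
      refine le_of_mul_le_mul_right ?_ (mul_pos h1 h2)
      rw [hBP]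
      calc B (j + 1) = (h (j + 1) / z (j + 1) (y T (j + 1)) (y T (j + 2))) ^ (j + 1) *
            y T (j + 1) * (y T (j + 1) * y T (j + 2)) := by
            have := hzpow j
            have hinv : (h (j + 1) / z (j + 1) (y T (j + 1)) (y T (j + 2))) ^ (j + 1) *
                (z (j + 1) (y T (j + 1)) (y T (j + 2)) / h (j + 1)) ^ (j + 1) = 1 := by
              rw [← mul_pow, div_mul_div_cancel₀ hz0.ne', div_self hh1.ne', one_pow]
            rw [mul_assoc, ← mul_assoc (y T (j + 1)), ← pow_two, ← this, ← mul_assoc, hinv, one_mul]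
        _ ≤ (2 * (h (j + 1) / s T (j + 1))) ^ (j + 1) * y T (j + 1) *
            (y T (j + 1) * y T (j + 2)) := by
            gcongr
            rw [← mul_div_assoc, div_le_div_iff₀ hz0 hs1]
            nlinarith
    · have hs0' : (2 : ℝ) ≤ s T 0 := by exact_mod_cast hs0
      have hle : 2 * (H 0 / s T 0) ≤ H 0 := by
        rw [← mul_div_assoc, div_le_iff₀ (by linarith), H0]
        have : 0 < κ / T := by positivity
        nlinarith
      rintro (_ | i) hi
      · exact hle
      · have := f3 i (by simp; omega)
        rw [HS]
        have : 0 < κ / T := by positivity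
        rw [H0] at hle ⊢
        linarith
  have : Nonempty Chain := by
    obtain ⟨T, K, -⟩ := key.exists
    exact ⟨K⟩
  obtain ⟨K, hK⟩ := Filter.skolem.1 key
  refine ⟨K, ?_, ?_, ?_⟩
  · filter_upwards [hK] with T ⟨k1, k2, k3, k4, k5, k6⟩
    exact ⟨k1, k2, by rw [k3, y0], by rw [k3, y1], k5, k6⟩
  · intro j
    refine ⟨?_, (hy j).2.congr' ?_⟩
    · filter_upwards [hK, (hy j).1] with T hK h
      rwa [hK.2.2.1]
    · filter_upwards [hK] with T hK
      rw [hK.2.2.1]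
  · refine ((hTρ.ceil hρ0).tendsto hρ0).congr' ?_
    filter_upwards [hK] with T hK
    rw [hK.2.2.2.1, s0]

/-- A family of chains with prescribed initial data and growth. -/
structure IsChainFamily (n : ℕ) (X XA X₁ κ ρ : ℝ) (h : ℕ → ℝ) (K : ℕ → Chain) : Prop where
  fields : ∀ᶠ T : ℕ in atTop, (K T).n = n ∧ (K T).X = X ∧ (K T).y 0 = XA ∧
    (K T).y 1 = T * X₁ ∧ (K T).h 0 = κ / T ∧ ∀ i, (K T).h (i + 1) = h (i + 1)
  logExp : ∀ j, HasLogExp (fun T => (K T).y j) (growthExp ρ j)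
  tendsto_s_zero : Tendsto (fun T => ((K T).s 0 : ℝ)) atTop atTop
  pos : 0 < X ∧ 0 < XA ∧ 0 < X₁ ∧ 0 < κ ∧ 0 < ρ ∧ 1 ≤ n ∧ ∀ i, 0 < h i
  growth : ∀ j ≤ n, growthExp ρ j < growthExp ρ (j + 1)

namespace IsChainFamily

variable {n : ℕ} {X XA X₁ κ ρ : ℝ} {h : ℕ → ℝ} {K : ℕ → Chain}
  (hK : IsChainFamily n X XA X₁ κ ρ h K)

include hK

theorem tendsto_y (i : ℕ) : Tendsto (fun T => (K T).y (i + 1)) atTop atTop :=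
  (hK.logExp (i + 1)).tendsto (growthExp_pos hK.pos.2.2.2.2.1 i)

theorem tendsto_y_div {i : ℕ} (hi : i ≤ n) :
    Tendsto (fun T => (K T).y (i + 1) / (K T).y i) atTop atTop :=
  ((hK.logExp (i + 1)).div (hK.logExp i)).tendsto (sub_pos.2 (hK.growth i hi))

theorem exists_log_P {k : ℕ} (hk : 1 ≤ k) : ∃ b : ℝ, ∀ᶠ T in atTop,
    Real.log ((K T).P k) = b - Real.log ((K T).y k) - Real.log ((K T).y (k + 1)) := by
  obtain ⟨hX, hXA, hX₁, hκ, hρ, hn, hh⟩ := hK.pos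
  obtain ⟨j, rfl⟩ : ∃ j, k = j + 1 := ⟨k - 1, by omega⟩
  refine ⟨Real.log (X * (XA * X₁ * κ) * ∏ i ∈ Finset.range j, h (i + 1)), ?_⟩
  filter_upwards [hK.fields, eventually_gt_atTop 0, (hK.logExp (j + 1)).1,
    (hK.logExp (j + 1 + 1)).1] with T ⟨_, h2, h3, h4, h5, h6⟩ hT hy hy'
  have hT0 : (0 : ℝ) < T := by exact_mod_cast hT
  have := (K T).P_mul_y (j + 1)
  rw [Finset.prod_range_succ', h2, h3, h4, h5] at this
  simp only [h6] at this
  have e : X * (XA * (↑T * X₁)) * ((∏ x ∈ Finset.range j, h (x + 1)) * (κ / ↑T)) =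
      X * (XA * X₁ * κ) * ∏ i ∈ Finset.range j, h (i + 1) := by field_simp
  rw [← e, ← this, Real.log_mul ((K T).P_pos _).ne' (by positivity), Real.log_mul hy.ne' hy'.ne']
  ring

omit hK in
theorem log_G (K : Chain) (t : ℕ) :
    K.k t * Real.log (K.G t) + Real.log (K.Q t) = Real.log (K.P (K.k t)) := by
  rw [← K.G_pow t, Real.log_mul (pow_pos (K.G_pos t) _).ne' (K.Q_pos t).ne', Real.log_pow]

theorem eventually_G_lt {w ε C : ℝ} (hε : 0 < ε) (hC : 0 < C)
    (hw : ∀ k, 1 ≤ k → k ≤ n →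
      k * w * growthExp ρ k ≤ 2 * growthExp ρ k + growthExp ρ (k + 1)) :
    ∀ᶠ T in atTop, ∀ t, 16 * (K T).Q t ≤ (K T).y n →
      C * (K T).G t * (C * (K T).Q t) ^ (w - ε) < 1 := by
  obtain ⟨hX, hXA, hX₁, hκ, hρ, hn, hh⟩ := hK.pos
  have hζ : ∀ k, 1 ≤ k → 0 < growthExp ρ k := fun k hk => by
    obtain ⟨j, rfl⟩ : ∃ j, k = j + 1 := ⟨k - 1, by omega⟩
    exact growthExp_pos hρ j
  set δ : ℝ := min (ε / 2) (1 / 2) with hδdef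
  have hδ : 0 < δ := by positivity
  have hδ1 : δ ≤ ε / 2 := min_le_left _ _
  have hδ2 : δ ≤ 1 / 2 := min_le_right _ _
  have key : ∀ᶠ T in atTop, ∀ k ∈ Finset.Icc 1 n, ∀ q : ℝ, Real.log (X / 2) ≤ q →
      q ≤ Real.log ((K T).y k) → ∀ g : ℝ, k * g + q = Real.log ((K T).P k) →
      Real.log C + g + (w - ε) * (Real.log C + q) < 0 := by
    rw [Filter.eventually_all_finset]
    intro k hk
    obtain ⟨hk1, hkn⟩ := Finset.mem_Icc.1 hk
    obtain ⟨b, hb⟩ := hK.exists_log_P hk1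
    set r := growthExp ρ (k + 1) / growthExp ρ k with hr
    have hζk := hζ k hk1
    have hr0 : 0 < r := div_pos (hζ _ (by omega)) hζk
    have hwk : k * w ≤ 2 + r := by
      have := hw k hk1 hkn
      have e : growthExp ρ (k + 1) = r * growthExp ρ k := by rw [hr]; field_simp
      rw [e, ← add_mul] at this
      exact le_of_mul_le_mul_right this hζk
    have hk1' : (1 : ℝ) ≤ k := by exact_mod_cast hk1
    set a : ℝ := k * (w - ε) - 1 with ha
    set M := k * (Real.log C + (w - ε) * Real.log C) + b + |a| * |Real.log (X / 2)| with hM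
    filter_upwards [hb, (hK.logExp k).eventually_log_near hζk (hK.logExp (k + 1)) hδ,
      ((hK.logExp k).tendsto_log hζk).eventually_gt_atTop (M / δ),
      ((hK.logExp k).tendsto_log hζk).eventually_ge_atTop 0] with T h1 h2 h3 h4 q hq0 hq1 g hg
    set L := Real.log ((K T).y k)
    set L' := Real.log ((K T).y (k + 1))
    rw [← hr] at h2
    have h2' := (abs_le.1 h2).1
    rw [div_lt_iff₀ hδ] at h3
    have hkey : a * q ≤ |a| * |Real.log (X / 2)| + (1 + r - 2 * δ) * L := by
      rcases le_total 0 a with h | h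
      · have e1 : a * q ≤ a * L := mul_le_mul_of_nonneg_left hq1 h
        have e2 : a ≤ 1 + r - 2 * δ := by rw [ha]; nlinarith
        have e3 : a * L ≤ (1 + r - 2 * δ) * L := mul_le_mul_of_nonneg_right e2 h4
        have e4 : 0 ≤ |a| * |Real.log (X / 2)| := by positivity
        linarith
      · have e1 : a * q ≤ a * Real.log (X / 2) := mul_le_mul_of_nonpos_left hq0 h
        have e2 : a * Real.log (X / 2) ≤ |a| * |Real.log (X / 2)| := by
          rw [← abs_mul]; exact le_abs_self _
        have e3 : 0 ≤ (1 + r - 2 * δ) * L := mul_nonneg (by linarith) h4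
        linarith
    have hneg : k * (Real.log C + g + (w - ε) * (Real.log C + q)) < 0 := by
      have : k * (Real.log C + g + (w - ε) * (Real.log C + q)) =
          k * (Real.log C + (w - ε) * Real.log C) + (k * g + q) + a * q := by rw [ha]; ring
      rw [this, hg, h1]
      nlinarith
    by_contra hcon
    push Not at hcon
    have := mul_nonneg (by linarith : (0 : ℝ) ≤ k) hcon
    linarith
  filter_upwards [key, hK.fields] with T hT ⟨f1, f2, _⟩ t ht
  have hQ := (K T).Q_pos t
  have hG := (K T).G_pos t
  have h0 : (K T).Q 0 ≤ (K T).Q t := (K T).Q_mono (Nat.zero_le t)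
  rw [(K T).Q_zero, f2] at h0
  have hkn : (K T).k t ≤ n := f1 ▸ (K T).k_le t
  have hQy : 16 * (K T).Q t ≤ (K T).y ((K T).k t) := by
    rcases ((K T).k_spec t).2 with h | h
    · rw [f1] at h
      rwa [le_antisymm hkn h]
    · exact h
  have := hT _ (Finset.mem_Icc.2 ⟨(K T).k_pos t, hkn⟩) (Real.log ((K T).Q t))
    (Real.log_le_log (by positivity) h0) (Real.log_le_log hQ (by linarith))
    (Real.log ((K T).G t)) (log_G (K T) t)
  rw [← Real.log_neg_iff (by positivity), Real.log_mul (by positivity) (by positivity),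
    Real.log_mul hC.ne' hG.ne', Real.log_rpow (by positivity), Real.log_mul hC.ne' hQ.ne']
  exact this

theorem eventually_lt_G {w ε C : ℝ} (hε : 0 < ε) (hC : 0 < C)
    (hw : 2 * growthExp ρ n + growthExp ρ (n + 1) ≤ n * w * growthExp ρ n) :
    ∀ᶠ T in atTop, ∀ t, (K T).y n ≤ C * (K T).Q t → 16 * (K T).Q t ≤ (K T).y n →
      C < (K T).G t * ((K T).Q t / C) ^ (w + ε) := by
  obtain ⟨hX, hXA, hX₁, hκ, hρ, hn, hh⟩ := hK.pos
  obtain ⟨m, rfl⟩ : ∃ m, n = m + 1 := ⟨n - 1, by omega⟩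
  have hζ := growthExp_pos hρ m
  obtain ⟨b, hb⟩ := hK.exists_log_P hn
  set r := growthExp ρ (m + 1 + 1) / growthExp ρ (m + 1) with hr
  have hr0 : 0 < r := div_pos (growthExp_pos hρ _) hζ
  have hwk : 2 + r ≤ (m + 1 : ℕ) * w := by
    have e : growthExp ρ (m + 1 + 1) = r * growthExp ρ (m + 1) := by rw [hr]; field_simp
    rw [e, ← add_mul] at hw
    exact le_of_mul_le_mul_right hw hζ
  set c := Real.log C with hc
  set N : ℝ := ((m + 1 : ℕ) : ℝ) with hN
  have hN1 : 1 ≤ N := by rw [hN]; exact_mod_cast hn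
  set M := N * c + N * (w + ε) * c - b + (1 + r + ε / 2) * c with hM
  filter_upwards [hb, (hK.logExp (m + 1)).eventually_log_near hζ (hK.logExp (m + 1 + 1))
      (half_pos hε), ((hK.logExp (m + 1)).tendsto_log hζ).eventually_gt_atTop (M / (ε / 2) + c),
      ((hK.logExp (m + 1)).tendsto_log hζ).eventually_ge_atTop c,
      (hK.tendsto_y_div (i := m) (by omega)).eventually_gt_atTop C, hK.fields,
      (hK.logExp m).1, (hK.logExp (m + 1)).1] with T h1 h2 h3 h4 h5 ⟨f1, _⟩ hy0 hy1 t ht ht'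
  have hQ := (K T).Q_pos t
  have hG := (K T).G_pos t
  have hk : (K T).k t = m + 1 := by
    refine le_antisymm (f1 ▸ (K T).k_le t) ?_
    by_contra hlt
    push Not at hlt
    have hy : 16 * (K T).Q t ≤ (K T).y ((K T).k t) := by
      rcases ((K T).k_spec t).2 with h | h
      · omega
      · exact h
    have h6 : (K T).y ((K T).k t) ≤ (K T).y m := (K T).y_mono (by omega) (by omega)
    rw [lt_div_iff₀ hy0] at h5
    nlinarith
  have hlog := log_G (K T) t
  rw [hk, ← hN, h1] at hlog
  have hL : Real.log ((K T).y (m + 1)) ≤ c + Real.log ((K T).Q t) := by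
    rw [hc, ← Real.log_mul hC.ne' hQ.ne']
    exact Real.log_le_log hy1 ht
  rw [← hr] at h2
  have h2' := (abs_le.1 h2).2
  rw [← Real.log_lt_log_iff hC (by positivity), Real.log_mul hG.ne' (by positivity),
    Real.log_rpow (by positivity), Real.log_div hQ.ne' hC.ne', ← hc]
  set L := Real.log ((K T).y (m + 1))
  set q := Real.log ((K T).Q t)
  set g := Real.log ((K T).G t)
  have h3' : M < ε / 2 * q := by
    have : M / (ε / 2) < q := by linarith
    rwa [div_lt_iff₀' (half_pos hε)] at this
  have hq : 0 ≤ q := by linarith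
  have e1 : (1 + r + ε / 2) * L ≤ (1 + r + ε / 2) * (c + q) := by gcongr
  have e2 : (2 + r) * q ≤ N * w * q := by gcongr
  have e3 : 1 * (ε * q) ≤ N * (ε * q) := by gcongr
  have : 0 < N * (g + (w + ε) * (q - c) - c) := by nlinarith
  have := (pos_iff_pos_of_mul_pos this).1 (by linarith)
  linarith

end IsChainFamily

end

section

open Matrix

/-- A submodule over `ℤ` with finitely many elements in each ball and full real span has a basis
which is well conditioned, with a constant depending on the dimension only. -/
theorem exists_reduced_basis (k : ℕ) : ∃ C : ℝ, 1 ≤ C ∧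
    ∀ (E : Type) [SeminormedAddCommGroup E] [NormedSpace ℝ E] [FiniteDimensional ℝ E]
      (Λ : Submodule ℤ E), (∀ R : ℝ, {v | v ∈ Λ ∧ ‖v‖ ≤ R}.Finite) →
      Submodule.span ℝ (Λ : Set E) = ⊤ → Module.finrank ℝ E = k →
      ∃ b : Fin k → E, (∀ i, b i ∈ Λ) ∧ (∀ i, 0 < ‖b i‖) ∧
        (∀ v ∈ Λ, ∃ z : Fin k → ℤ, v = ∑ i, z i • b i) ∧
        ∀ (t : Fin k → ℝ) (j : Fin k), |t j| * ‖b j‖ ≤ C * ‖∑ i, t i • b i‖ := by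
  induction k with
  | zero =>
    refine ⟨1, le_rfl, fun E _ _ _ Λ _ _ hE => ⟨Fin.elim0, fun i => i.elim0, fun i => i.elim0,
      fun v _ => ⟨Fin.elim0, ?_⟩, fun _ j => j.elim0⟩⟩
    have := Module.finrank_zero_iff.1 hE
    simpa using Subsingleton.elim v 0
  | succ k ih =>
    obtain ⟨C, hC1, hC⟩ := ih
    refine ⟨1 + (k + 1) * (4 * C), by nlinarith [Nat.cast_nonneg (α := ℝ) k],
      fun E _ _ _ Λ hfin hspan hE => ?_⟩
    have hnorm : ∀ v ∈ Λ, v ≠ 0 → 0 < ‖v‖ := by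
      intro v hv hv0
      by_contra h
      have h0 : ‖v‖ = 0 := le_antisymm (not_lt.1 h) (norm_nonneg v)
      refine Set.infinite_of_injective_forall_mem (f := fun z : ℤ => (z : ℝ) • v) ?_ ?_ (hfin 0)
      · intro z z' hz
        exact_mod_cast smul_left_injective ℝ hv0 hz
      · intro z
        refine ⟨?_, by simp [norm_smul, h0]⟩
        have := Λ.smul_mem z hv
        rwa [← Int.cast_smul_eq_zsmul ℝ] at this
    obtain ⟨v₀, hv₀, hv₀0⟩ : ∃ v ∈ Λ, v ≠ 0 := by
      by_contra! h
      have : (Λ : Set E) ⊆ {0} := fun v hv => h v hv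
      have : (⊤ : Submodule ℝ E) ≤ ⊥ := by
        rw [← hspan]
        exact (Submodule.span_mono this).trans (by simp)
      have h0 := finrank_top ℝ E
      rw [eq_bot_iff.2 this, finrank_bot] at h0
      omega
    obtain ⟨b, ⟨⟨hb, hb0⟩, hbv⟩, hmin⟩ : ∃ b, ((b ∈ Λ ∧ b ≠ 0) ∧ ‖b‖ ≤ ‖v₀‖) ∧
        ∀ v, v ∈ Λ → v ≠ 0 → ‖b‖ ≤ ‖v‖ := by
      have hf : {v | (v ∈ Λ ∧ v ≠ 0) ∧ ‖v‖ ≤ ‖v₀‖}.Finite :=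
        (hfin ‖v₀‖).subset fun v hv => ⟨hv.1.1, hv.2⟩
      obtain ⟨b, hb, hm⟩ := hf.exists_minimalFor (fun v => ‖v‖) _ ⟨v₀, ⟨hv₀, hv₀0⟩, le_rfl⟩
      refine ⟨b, hb, fun v hv hv0 => ?_⟩
      by_contra! h
      have := hm (j := v) ⟨⟨hv, hv0⟩, h.le.trans hb.2⟩ h.le
      linarith
    have hbpos := hnorm b hb hb0
    let S : Submodule ℝ E := ℝ ∙ b
    let π : E →ₗ[ℝ] E ⧸ S := S.mkQ
    have hπ : ∀ v, π v = 0 ↔ ∃ s : ℝ, v = s • b := by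
      intro v
      rw [Submodule.mkQ_apply, Submodule.Quotient.mk_eq_zero, Submodule.mem_span_singleton]
      simp only [eq_comm]
    have hπn : ∀ v, ‖π v‖ ≤ ‖v‖ := fun v => Submodule.Quotient.norm_mk_le S v
    have hlift : ∀ v ∈ Λ, ∀ ε : ℝ, 0 < ε →
        ∃ v' ∈ Λ, π v' = π v ∧ ‖v'‖ ≤ ‖π v‖ + ε + ‖b‖ / 2 := by
      intro v hv ε hε
      obtain ⟨m, hm, hmn⟩ := Submodule.Quotient.norm_mk_lt (S := S) (π v) hε
      have : π (v - m) = 0 := by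
        rw [map_sub, sub_eq_zero]
        exact hm.symm
      obtain ⟨s, hs⟩ := (hπ _).1 this
      refine ⟨v - round s • b, Λ.sub_mem hv (Λ.smul_mem _ hb), ?_, ?_⟩
      · rw [map_sub, sub_eq_self]
        exact (hπ _).2 ⟨round s, (Int.cast_smul_eq_zsmul ℝ _ _).symm⟩
      · have e : v - round s • b = m + (s - round s) • b := by
          rw [sub_smul, ← hs, Int.cast_smul_eq_zsmul]
          abel
        rw [e]
        refine (norm_add_le _ _).trans ?_
        rw [norm_smul, Real.norm_eq_abs]
        nlinarith [abs_sub_round s]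
    let Λ' : Submodule ℤ (E ⧸ S) := Λ.map (π.restrictScalars ℤ)
    have hbig : ∀ v ∈ Λ, π v ≠ 0 → ‖b‖ ≤ 2 * ‖π v‖ := by
      intro v hv h0
      refine le_of_forall_pos_le_add fun ε hε => ?_
      obtain ⟨v', hv', h1, h2⟩ := hlift v hv (ε / 2) (half_pos hε)
      have : v' ≠ 0 := by
        rintro rfl
        exact h0 (by rw [← h1, map_zero])
      linarith [hmin v' hv' this]
    obtain ⟨b', hb', hb'pos, hb'span, hb'C⟩ := hC (E ⧸ S) Λ' (by
        intro R
        refine ((hfin (R + 1 + ‖b‖ / 2)).image π).subset ?_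
        rintro _ ⟨⟨v, hv, rfl⟩, hR⟩
        obtain ⟨v', hv', h1, h2⟩ := hlift v hv 1 one_pos
        exact ⟨v', ⟨hv', h2.trans (by gcongr; exact hR)⟩, h1⟩) (by
        have : (Λ' : Set (E ⧸ S)) = π '' Λ := rfl
        rw [this, ← Submodule.map_span, hspan, Submodule.map_top, Submodule.range_mkQ]) (by
        have := Submodule.finrank_quotient_add_finrank S
        rw [finrank_span_singleton hb0, hE] at this
        omega)
    have hchoose : ∀ i, ∃ v ∈ Λ, π v = b' i ∧ ‖v‖ ≤ 4 * ‖b' i‖ := by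
      intro i
      obtain ⟨v, hv, hvi⟩ := hb' i
      change π v = b' i at hvi
      have hpos := hb'pos i
      obtain ⟨v', hv', h1, h2⟩ := hlift v hv _ hpos
      rw [hvi] at h1 h2
      have := hbig v hv (fun h => by simp [← hvi, h] at hpos)
      rw [hvi] at this
      exact ⟨v', hv', h1, by linarith⟩
    choose w hw hwπ hwn using hchoose
    refine ⟨Fin.cons b w, ?_, ?_, ?_, ?_⟩
    · exact Fin.cases hb hw
    · refine Fin.cases hbpos fun i => ?_
      simp only [Fin.cons_succ]
      exact (hb'pos i).trans_le (hwπ i ▸ hπn _)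
    · intro v hv
      obtain ⟨z, hz⟩ := hb'span (π v) ⟨v, hv, rfl⟩
      have h0 : π (v - ∑ i, z i • w i) = 0 := by
        rw [map_sub, map_sum, hz, sub_eq_zero]
        exact Finset.sum_congr rfl fun i _ => by rw [map_zsmul, hwπ]
      obtain ⟨s, hs⟩ := (hπ _).1 h0
      have hmem : s • b ∈ Λ := by
        rw [← hs]
        exact Λ.sub_mem hv (Λ.sum_mem fun i _ => Λ.smul_mem _ (hw i))
      have hs' : s = round s := by
        by_contra hne
        have h1 : (s - round s) • b ∈ Λ := by
          rw [sub_smul, Int.cast_smul_eq_zsmul]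
          exact Λ.sub_mem hmem (Λ.smul_mem _ hb)
        have h2 := hmin _ h1 (smul_ne_zero (sub_ne_zero.2 hne) hb0)
        rw [norm_smul, Real.norm_eq_abs] at h2
        nlinarith [abs_sub_round s]
      refine ⟨Fin.cons (round s) z, ?_⟩
      rw [Fin.sum_univ_succ]
      simp only [Fin.cons_zero, Fin.cons_succ]
      rw [← Int.cast_smul_eq_zsmul ℝ, ← hs', ← hs]
      abel
    · intro t
      set v := ∑ i, t i • (Fin.cons b w : Fin (k + 1) → E) i with hv
      have hv' : v = t 0 • b + ∑ i : Fin k, t i.succ • w i := by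
        rw [hv, Fin.sum_univ_succ]
        simp
      have h1 : ∀ i : Fin k, |t i.succ| * ‖w i‖ ≤ 4 * C * ‖v‖ := by
        intro i
        have h2 := hb'C (fun i => t i.succ) i
        have h3 : ∑ i : Fin k, t i.succ • b' i = π v := by
          rw [hv', map_add, (hπ _).2 ⟨_, rfl⟩, zero_add, map_sum]
          exact Finset.sum_congr rfl fun i _ => by rw [map_smul, hwπ]
        rw [h3] at h2
        calc |t i.succ| * ‖w i‖ ≤ |t i.succ| * (4 * ‖b' i‖) := by gcongr; exact hwn i
          _ = 4 * (|t i.succ| * ‖b' i‖) := by ring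
          _ ≤ 4 * (C * ‖v‖) := by
            have := h2.trans (mul_le_mul_of_nonneg_left (hπn v) (by linarith))
            linarith
          _ = 4 * C * ‖v‖ := by ring
      have hvn : 0 ≤ ‖v‖ := norm_nonneg v
      refine Fin.cases ?_ fun i => ?_
      · simp only [Fin.cons_zero]
        have h4 : ‖∑ i : Fin k, t i.succ • w i‖ ≤ k * (4 * C * ‖v‖) := by
          refine (norm_sum_le _ _).trans ?_
          refine (Finset.sum_le_card_nsmul _ _ (4 * C * ‖v‖) fun i _ => ?_).trans (by simp)
          rw [norm_smul, Real.norm_eq_abs]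
          exact h1 i
        have h5 : |t 0| * ‖b‖ = ‖v - ∑ i : Fin k, t i.succ • w i‖ := by
          rw [hv', add_sub_cancel_right, norm_smul, Real.norm_eq_abs]
        rw [h5]
        refine (norm_sub_le _ _).trans ?_
        nlinarith
      · simp only [Fin.cons_succ]
        refine (h1 i).trans ?_
        have : (0 : ℝ) ≤ k := Nat.cast_nonneg k
        have : 4 * C ≤ 1 + (k + 1) * (4 * C) := by nlinarith
        gcongr

/-- The sup norm of an integer vector. -/
noncomputable def inorm {m : ℕ} (x : Fin m → ℤ) : ℝ := ‖(fun j => (x j : ℝ))‖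

/-- The additive map `(x, y) ↦ ξ x - y` on integer vectors. -/
noncomputable def resHom {m n : ℕ} (ξ : Matrix (Fin n) (Fin m) ℝ) :
    (Fin m → ℤ) × (Fin n → ℤ) →+ (Fin n → ℝ) where
  toFun v := ξ *ᵥ (fun j => (v.1 j : ℝ)) - fun k => (v.2 k : ℝ)
  map_zero' := by ext; simp [mulVec, dotProduct]
  map_add' u v := by
    ext k
    simp only [mulVec, dotProduct, Pi.sub_apply, Pi.add_apply, Prod.fst_add, Prod.snd_add,
      Int.cast_add, mul_add, Finset.sum_add_distrib]
    ring

theorem inorm_nonneg {m : ℕ} (x : Fin m → ℤ) : 0 ≤ inorm x := norm_nonneg _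

theorem abs_le_inorm {m : ℕ} (x : Fin m → ℤ) (j : Fin m) : |(x j : ℝ)| ≤ inorm x :=
  norm_le_pi_norm (fun j => (x j : ℝ)) j

theorem inorm_le {m : ℕ} {x : Fin m → ℤ} {R : ℝ} (hR : 0 ≤ R) (h : ∀ j, |(x j : ℝ)| ≤ R) :
    inorm x ≤ R := (pi_norm_le_iff_of_nonneg hR).2 h

theorem inorm_add_le {m : ℕ} (x y : Fin m → ℤ) : inorm (x + y) ≤ inorm x + inorm y := by
  refine le_trans (le_of_eq ?_) (norm_add_le (fun j => (x j : ℝ)) (fun j => (y j : ℝ)))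
  unfold inorm
  congr 1
  ext j
  simp

theorem inorm_neg {m : ℕ} (x : Fin m → ℤ) : inorm (-x) = inorm x := by
  rw [inorm, ← norm_neg]
  unfold inorm
  congr 1
  ext j
  simp

theorem inorm_zsmul {m : ℕ} (z : ℤ) (x : Fin m → ℤ) : inorm (z • x) = |(z : ℝ)| * inorm x := by
  rw [inorm, inorm, ← Real.norm_eq_abs, ← norm_smul]
  congr 1
  ext j
  simp

theorem one_le_inorm {m : ℕ} {x : Fin m → ℤ} (hx : x ≠ 0) : 1 ≤ inorm x := by
  obtain ⟨j, hj⟩ := Function.ne_iff.1 hx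
  refine le_trans ?_ (abs_le_inorm x j)
  exact_mod_cast Int.one_le_abs hj

theorem finite_inorm_le {m : ℕ} (R : ℝ) : {x : Fin m → ℤ | inorm x ≤ R}.Finite := by
  refine (Set.Finite.pi' (fun _ : Fin m => Set.finite_Icc (-⌈R⌉) ⌈R⌉)).subset fun x hx j => ?_
  have h := abs_le.1 ((abs_le_inorm x j).trans (show inorm x ≤ R from hx))
  have h2 := Int.le_ceil R
  constructor
  · have : (-(⌈R⌉ : ℝ)) ≤ x j := by linarith
    exact_mod_cast this
  · have : (x j : ℝ) ≤ ⌈R⌉ := by linarith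
    exact_mod_cast this

/-- The kernel vectors: those `x` for which `ξ x` is integral. -/
def IsKer {m n : ℕ} (ξ : Matrix (Fin n) (Fin m) ℝ) (x : Fin m → ℤ) : Prop :=
  ∃ y : Fin n → ℤ, resHom ξ (x, y) = 0

/-- A matrix with three columns all of whose integer points form a lattice of full rank of minimum
`X`, with the second minimum comparable to the first one. -/
structure IsStage {n : ℕ} (C : ℝ) (ξ : Matrix (Fin n) (Fin 3) ℝ) (X : ℝ) : Prop where
  full : ∃ p : Matrix (Fin 3) (Fin 3) ℤ, p.det ≠ 0 ∧ ∀ i, IsKer ξ (p i)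
  attained : ∃ x, x ≠ 0 ∧ IsKer ξ x ∧ inorm x = X
  le : ∀ x, x ≠ 0 → IsKer ξ x → X ≤ inorm x
  two : ∃ x₁ x₂, IsKer ξ x₁ ∧ IsKer ξ x₂ ∧ inorm x₁ ≤ C * X ∧ inorm x₂ ≤ C * X ∧
    ∀ a b : ℤ, a • x₁ + b • x₂ = 0 → a = 0 ∧ b = 0

/-- Adapted coordinates `(γ, δ)` for the pairs `(x, y)`: the kernel vectors are those with `δ = 0`,
and both the kernel and the image have well conditioned bases. -/
structure Frame {n : ℕ} (C : ℝ) (ξ : Matrix (Fin n) (Fin 3) ℝ) where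
  e : (Fin 3 → ℤ) × (Fin n → ℤ) ≃+ (Fin 3 → ℤ) × (Fin n → ℤ)
  a : Fin n → Fin n → ℝ
  X₀ : ℝ
  X₁ : ℝ
  Z : ℝ
  X₁_pos : 0 < X₁
  X₁_le : X₁ ≤ X₀
  X₀_le : X₀ ≤ Z
  res_eq : ∀ γ δ, resHom ξ (e (γ, δ)) = ∑ i, (δ i : ℝ) • a i
  a_pos : ∀ i, 0 < ‖a i‖
  a_cond : ∀ (t : Fin n → ℝ) j, |t j| * ‖a j‖ ≤ C * ‖∑ i, t i • a i‖
  le_inorm : ∀ γ, |(γ 0 : ℝ)| * X₀ ≤ C * inorm (e (γ, 0)).1 ∧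
    |(γ 1 : ℝ)| * X₁ ≤ C * inorm (e (γ, 0)).1 ∧ |(γ 2 : ℝ)| * Z ≤ C * inorm (e (γ, 0)).1
  inorm_le : ∀ γ, inorm (e (γ, 0)).1 ≤
    |(γ 0 : ℝ)| * X₀ + |(γ 1 : ℝ)| * X₁ + |(γ 2 : ℝ)| * Z

theorem resHom_fst_zero {m n : ℕ} (ξ : Matrix (Fin n) (Fin m) ℝ) (y : Fin n → ℤ) :
    resHom ξ (0, y) = fun k => -(y k : ℝ) := by
  ext k
  simp [resHom, mulVec, dotProduct]

/-- The integer vectors as a real vector. -/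
def realVec (m : ℕ) : (Fin m → ℤ) →+ (Fin m → ℝ) where
  toFun x j := x j
  map_zero' := by ext; simp
  map_add' x y := by ext; simp

theorem norm_realVec {m : ℕ} (x : Fin m → ℤ) : ‖realVec m x‖ = inorm x := rfl

theorem realVec_injective (m : ℕ) : Function.Injective (realVec m) := by
  intro x y h
  ext j
  have := congrFun h j
  simpa [realVec] using this

theorem IsKer.zsmul_mem_of_det {n : ℕ} {ξ : Matrix (Fin n) (Fin 3) ℝ}
    {p : Matrix (Fin 3) (Fin 3) ℤ} (hp : ∀ i, IsKer ξ (p i)) (x : Fin 3 → ℤ) :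
    IsKer ξ (p.det • x) := by
  choose q hq using hp
  refine ⟨∑ i, (x ᵥ* p.adjugate) i • q i, ?_⟩
  have e1 : p.det • x = ∑ i, (x ᵥ* p.adjugate) i • p i := by
    have := vecMul_vecMul x p.adjugate p
    rw [adjugate_mul, vecMul_smul, vecMul_one] at this
    rw [← this, vecMul_eq_sum]
  have e2 : (p.det • x, ∑ i, (x ᵥ* p.adjugate) i • q i) =
      ∑ i, (x ᵥ* p.adjugate) i • ((p i, q i) : (Fin 3 → ℤ) × (Fin n → ℤ)) := by
    rw [e1]
    ext <;> simp [Prod.fst_sum, Prod.snd_sum]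
  rw [e2, map_sum]
  simp only [map_zsmul, hq, smul_zero, Finset.sum_const_zero]

theorem exists_perm_sorted (f : Fin 3 → ℝ) : ∃ σ : Equiv.Perm (Fin 3),
    f (σ 1) ≤ f (σ 0) ∧ f (σ 0) ≤ f (σ 2) := by
  have h := Tuple.monotone_sort f
  refine ⟨(Equiv.swap 0 1).trans (Tuple.sort f), ?_, ?_⟩
  · simpa using h (show (0 : Fin 3) ≤ 1 by decide)
  · have e : Equiv.swap (0 : Fin 3) 1 2 = 2 := by decide
    simpa [e] using h (show (1 : Fin 3) ≤ 2 by decide)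

theorem span_realVec_eq_top {p : Matrix (Fin 3) (Fin 3) ℤ} (hp : p.det ≠ 0)
    {S : Set (Fin 3 → ℝ)} (h : ∀ i, realVec 3 (p i) ∈ S) : Submodule.span ℝ S = ⊤ := by
  rw [eq_top_iff]
  intro v _
  let P : Matrix (Fin 3) (Fin 3) ℝ := p.map (Int.castRingHom ℝ)
  have hP : IsUnit P.det := by
    have : P.det = ((p.det : ℤ) : ℝ) := ((Int.castRingHom ℝ).map_det p).symm
    rw [this]
    exact (Int.cast_ne_zero.2 hp).isUnit
  have e : v = ∑ i, (v ᵥ* P⁻¹) i • P i := by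
    rw [← vecMul_eq_sum, vecMul_vecMul, nonsing_inv_mul _ hP, vecMul_one]
  rw [e]
  exact Submodule.sum_mem _ fun i _ => Submodule.smul_mem _ _ (Submodule.subset_span (h i))

theorem IsStage.exists_kernel_basis : ∃ C' : ℝ, 1 ≤ C' ∧ ∀ {n : ℕ} (C : ℝ)
    (ξ : Matrix (Fin n) (Fin 3) ℝ) (X : ℝ), IsStage C ξ X → ∃ f : Fin 3 → Fin 3 → ℤ,
      (∀ j, IsKer ξ (f j)) ∧ (∀ x, IsKer ξ x → ∃ γ : Fin 3 → ℤ, x = ∑ j, γ j • f j) ∧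
      (∀ (γ : Fin 3 → ℤ) j, |(γ j : ℝ)| * inorm (f j) ≤ C' * inorm (∑ i, γ i • f i)) ∧
      X ≤ inorm (f 1) ∧ inorm (f 1) ≤ inorm (f 0) ∧ inorm (f 0) ≤ inorm (f 2) ∧
      inorm (f 0) ≤ C' * (C * X) ∧ 0 < X := by
  obtain ⟨C₁, hC₁, hred⟩ := exists_reduced_basis 3
  refine ⟨C₁, hC₁, fun {n} C ξ X h => ?_⟩
  have hX : 0 < X := by
    obtain ⟨x, hx, -, rfl⟩ := h.attained
    exact one_pos.trans_le (one_le_inorm hx)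
  let Λ : Submodule ℤ (Fin 3 → ℝ) := AddSubgroup.toIntSubmodule
    (((resHom ξ).ker.map (AddMonoidHom.fst _ _)).map (realVec 3))
  have hΛ : ∀ v, v ∈ Λ ↔ ∃ x, IsKer ξ x ∧ realVec 3 x = v := by
    intro v
    constructor
    · rintro ⟨_, ⟨⟨x, y⟩, hxy, rfl⟩, rfl⟩
      exact ⟨x, ⟨y, hxy⟩, rfl⟩
    · rintro ⟨x, ⟨y, hxy⟩, rfl⟩
      exact ⟨x, ⟨(x, y), hxy, rfl⟩, rfl⟩
  obtain ⟨b, hb, hbpos, hbspan, hbC⟩ := hred (Fin 3 → ℝ) Λ (fun R => by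
      refine ((finite_inorm_le R).image (realVec 3)).subset ?_
      rintro v ⟨hv, hR⟩
      obtain ⟨x, -, rfl⟩ := (hΛ v).1 hv
      exact ⟨x, hR, rfl⟩) (by
      obtain ⟨p, hp, hker⟩ := h.full
      exact span_realVec_eq_top hp fun i => (hΛ _).2 ⟨p i, hker i, rfl⟩) (by simp)
  choose g hg hgb using fun i => (hΛ _).1 (hb i)
  have hcomb : ∀ γ : Fin 3 → ℤ, realVec 3 (∑ i, γ i • g i) = ∑ i, (γ i : ℝ) • b i := by
    intro γ
    rw [map_sum]
    exact Finset.sum_congr rfl fun i _ => by rw [map_zsmul, hgb, Int.cast_smul_eq_zsmul]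
  have hspan : ∀ x, IsKer ξ x → ∃ γ : Fin 3 → ℤ, x = ∑ j, γ j • g j := by
    intro x hx
    obtain ⟨z, hz⟩ := hbspan _ ((hΛ _).2 ⟨x, hx, rfl⟩)
    refine ⟨z, realVec_injective 3 ?_⟩
    rw [hz, hcomb]
    exact Finset.sum_congr rfl fun i _ => (Int.cast_smul_eq_zsmul ℝ _ _).symm
  have hcond : ∀ (γ : Fin 3 → ℤ) j, |(γ j : ℝ)| * inorm (g j) ≤ C₁ * inorm (∑ i, γ i • g i) := by
    intro γ j
    have := hbC (fun i => γ i) j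
    rwa [← hcomb, norm_realVec, ← hgb, norm_realVec] at this
  have hge : ∀ j, X ≤ inorm (g j) := by
    intro j
    refine h.le _ ?_ (hg j)
    intro h0
    have := hbpos j
    rw [← hgb, h0] at this
    simp at this
  obtain ⟨i, j, hij, hi, hj⟩ : ∃ i j, i ≠ j ∧ inorm (g i) ≤ C₁ * (C * X) ∧
      inorm (g j) ≤ C₁ * (C * X) := by
    obtain ⟨x₁, x₂, k₁, k₂, n₁, n₂, hind⟩ := h.two
    obtain ⟨z₁, hz₁⟩ := hspan x₁ k₁
    obtain ⟨z₂, hz₂⟩ := hspan x₂ k₂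
    have act : ∀ (z : Fin 3 → ℤ), inorm (∑ i, z i • g i) ≤ C * X → ∀ i, z i ≠ 0 →
        inorm (g i) ≤ C₁ * (C * X) := by
      intro z hz i hi
      have h1 : (1 : ℝ) ≤ |(z i : ℝ)| := by exact_mod_cast Int.one_le_abs hi
      calc inorm (g i) ≤ |(z i : ℝ)| * inorm (g i) :=
            le_mul_of_one_le_left (inorm_nonneg _) h1
        _ ≤ C₁ * inorm (∑ i, z i • g i) := hcond z i
        _ ≤ C₁ * (C * X) := by gcongr
    have act' : ∀ i, z₁ i ≠ 0 ∨ z₂ i ≠ 0 → inorm (g i) ≤ C₁ * (C * X) := fun i hi =>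
      hi.elim (act z₁ (hz₁ ▸ n₁) i) (act z₂ (hz₂ ▸ n₂) i)
    obtain ⟨i, hi⟩ : ∃ i, z₁ i ≠ 0 := by
      by_contra! h0
      have : x₁ = 0 := by rw [hz₁]; simp [h0]
      have := (hind 1 0 (by simp [this])).1
      omega
    by_contra! hcon
    have hoff : ∀ j, j ≠ i → z₁ j = 0 ∧ z₂ j = 0 := by
      intro j hj
      by_contra h0
      have h0 : z₁ j ≠ 0 ∨ z₂ j ≠ 0 := by tauto
      exact absurd (act' j h0) (not_le.2 (hcon i j hj.symm (act' i (Or.inl hi))))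
    have s₁ : x₁ = z₁ i • g i := by
      rw [hz₁, Finset.sum_eq_single i (fun j _ hj => by rw [(hoff j hj).1, zero_smul]) (by simp)]
    have s₂ : x₂ = z₂ i • g i := by
      rw [hz₂, Finset.sum_eq_single i (fun j _ hj => by rw [(hoff j hj).2, zero_smul]) (by simp)]
    have := (hind (z₂ i) (-z₁ i) (by rw [s₁, s₂, smul_smul, smul_smul, ← add_smul]; ring_nf)).2
    exact hi (neg_eq_zero.1 this)
  obtain ⟨σ, h10, h02⟩ := exists_perm_sorted fun j => inorm (g j)
  refine ⟨g ∘ σ, fun j => hg _, fun x hx => ?_, fun γ j => ?_, hge _, h10, h02, ?_, hX⟩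
  · obtain ⟨γ, hγ⟩ := hspan x hx
    refine ⟨γ ∘ σ, ?_⟩
    rw [hγ]
    exact (Equiv.sum_comp σ fun j => γ j • g j).symm
  · have := hcond (γ ∘ σ.symm) (σ j)
    rw [← Equiv.sum_comp σ] at this
    simpa only [Function.comp_apply, Equiv.symm_apply_apply] using this
  · have key : ∀ k, inorm (g k) ≤ C₁ * (C * X) → σ 1 ≠ k → inorm (g (σ 0)) ≤ C₁ * (C * X) := by
      intro k hk hk1
      obtain ⟨l, rfl⟩ := σ.surjective k
      fin_cases l
      · exact hk
      · exact absurd rfl hk1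
      · exact h02.trans hk
    by_cases hi1 : σ 1 = i
    · exact key j hj (hi1 ▸ hij)
    · exact key i hi hi1

theorem exists_image_basis (n : ℕ) : ∃ C : ℝ, 1 ≤ C ∧ ∀ (ξ : Matrix (Fin n) (Fin 3) ℝ)
    (p : Matrix (Fin 3) (Fin 3) ℤ), p.det ≠ 0 → (∀ i, IsKer ξ (p i)) →
      ∃ b : Fin n → (Fin 3 → ℤ) × (Fin n → ℤ), (∀ i, 0 < ‖resHom ξ (b i)‖) ∧
        (∀ v, ∃ δ : Fin n → ℤ, resHom ξ v = ∑ i, (δ i : ℝ) • resHom ξ (b i)) ∧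
        ∀ (t : Fin n → ℝ) j, |t j| * ‖resHom ξ (b j)‖ ≤ C * ‖∑ i, t i • resHom ξ (b i)‖ := by
  obtain ⟨C, hC, hred⟩ := exists_reduced_basis n
  refine ⟨C, hC, fun ξ p hp hker => ?_⟩
  let Λ : Submodule ℤ (Fin n → ℝ) := AddSubgroup.toIntSubmodule (resHom ξ).range
  have hΛ : ∀ v, v ∈ Λ ↔ ∃ u, resHom ξ u = v := fun v => Iff.rfl
  obtain ⟨b, hb, hbpos, hbspan, hbC⟩ := hred (Fin n → ℝ) Λ (fun R => by
      refine ((finite_inorm_le (m := n) (|(p.det : ℝ)| * R)).image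
        (fun u => (p.det : ℝ)⁻¹ • realVec n u)).subset ?_
      rintro v ⟨hv, hR⟩
      obtain ⟨⟨x, y⟩, rfl⟩ := (hΛ v).1 hv
      obtain ⟨q, hq⟩ := IsKer.zsmul_mem_of_det hker x
      have hp' : (p.det : ℝ) ≠ 0 := Int.cast_ne_zero.2 hp
      have e : (p.det : ℝ) • resHom ξ (x, y) = realVec n (q - p.det • y) := by
        have e1 : p.det • (x, y) = (p.det • x, q) + ((0, p.det • y - q) :
            (Fin 3 → ℤ) × (Fin n → ℤ)) := by ext <;> simp
        rw [Int.cast_smul_eq_zsmul, ← map_zsmul, e1, map_add, hq, zero_add, resHom_fst_zero]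
        ext k
        simp [realVec]
      refine ⟨q - p.det • y, ?_, ?_⟩
      · change inorm _ ≤ _
        rw [← norm_realVec, ← e, norm_smul, Real.norm_eq_abs]
        gcongr
      · change (p.det : ℝ)⁻¹ • realVec n _ = _
        rw [← e, inv_smul_smul₀ hp']) (by
      rw [eq_top_iff]
      intro v _
      rw [pi_eq_sum_univ v]
      refine Submodule.sum_mem _ fun i _ => Submodule.smul_mem _ _ (Submodule.subset_span ?_)
      refine (hΛ _).2 ⟨(0, fun j => if i = j then -1 else 0), ?_⟩
      rw [resHom_fst_zero]
      ext j
      by_cases h : i = j <;> simp [h]) (by simp)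
  choose u hu using fun i => (hΛ _).1 (hb i)
  refine ⟨u, fun i => by rw [hu]; exact hbpos i, fun v => ?_, fun t j => ?_⟩
  · obtain ⟨z, hz⟩ := hbspan _ ((hΛ _).2 ⟨v, rfl⟩)
    refine ⟨z, ?_⟩
    rw [hz]
    exact Finset.sum_congr rfl fun i _ => by rw [hu, Int.cast_smul_eq_zsmul]
  · simp only [hu]
    exact hbC t j

theorem IsStage.exists_frame (n : ℕ) : ∃ C' : ℝ, 1 ≤ C' ∧
    ∀ (C : ℝ) (ξ : Matrix (Fin n) (Fin 3) ℝ) (X : ℝ), IsStage C ξ X →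
      ∃ F : Frame C' ξ, 0 < X ∧ X ≤ F.X₁ ∧ F.X₀ ≤ C' * (C * X) := by
  obtain ⟨C₁, hC₁, hker⟩ := IsStage.exists_kernel_basis
  obtain ⟨C₂, hC₂, him⟩ := exists_image_basis n
  refine ⟨max C₁ C₂, hC₁.trans (le_max_left _ _), fun C ξ X h => ?_⟩
  obtain ⟨f, hf, hspan, hcond, hge, h10, h02, h0, hX⟩ := hker C ξ X h
  have hpos : 0 < inorm (f 1) := hX.trans_le hge
  have hfpos : ∀ j, 0 < inorm (f j) := by
    intro j
    fin_cases j
    · exact hpos.trans_le h10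
    · exact hpos
    · exact hpos.trans_le (h10.trans h02)
  obtain ⟨p, hp, hpk⟩ := h.full
  obtain ⟨b, hb, hbspan, hbc⟩ := him ξ p hp hpk
  choose φ hφ using hf
  let Φ : (Fin 3 → ℤ) × (Fin n → ℤ) →+ (Fin 3 → ℤ) × (Fin n → ℤ) :=
    { toFun := fun u => ∑ j, u.1 j • ((f j, φ j) : (Fin 3 → ℤ) × (Fin n → ℤ)) + ∑ i, u.2 i • b i
      map_zero' := by simp
      map_add' := fun u v => by
        simp only [Prod.fst_add, Prod.snd_add, Pi.add_apply, add_smul, Finset.sum_add_distrib]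
        abel }
  have hΦ : ∀ γ δ, Φ (γ, δ) = ∑ j, γ j • ((f j, φ j) : (Fin 3 → ℤ) × (Fin n → ℤ)) +
    ∑ i, δ i • b i := fun _ _ => rfl
  have hres : ∀ γ δ, resHom ξ (Φ (γ, δ)) = ∑ i, (δ i : ℝ) • resHom ξ (b i) := by
    intro γ δ
    rw [hΦ, map_add, map_sum, map_sum]
    simp only [map_zsmul, hφ, smul_zero, Finset.sum_const_zero, zero_add, Int.cast_smul_eq_zsmul]
  have hfst : ∀ γ, (Φ (γ, 0)).1 = ∑ j, γ j • f j := by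
    intro γ
    simp [hΦ, Prod.fst_sum]
  have hinj : Function.Injective Φ := by
    rw [injective_iff_map_eq_zero]
    rintro ⟨γ, δ⟩ hu
    have hδ : δ = 0 := by
      ext i
      have h2 := hbc (fun i => (δ i : ℝ)) i
      rw [← hres γ δ, hu, map_zero, norm_zero, mul_zero] at h2
      have h3 : |(δ i : ℝ)| = 0 := by
        have := abs_nonneg (δ i : ℝ)
        have := hb i
        nlinarith
      exact_mod_cast abs_eq_zero.1 h3
    subst hδ
    have hγ : γ = 0 := by
      ext j
      have h2 := hcond γ j
      rw [← hfst, hu] at h2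
      have h4 : inorm ((0 : (Fin 3 → ℤ) × (Fin n → ℤ)).1) = 0 := by simp [inorm]
      rw [h4, mul_zero] at h2
      have h3 : |(γ j : ℝ)| = 0 := by
        have := abs_nonneg (γ j : ℝ)
        have := hfpos j
        nlinarith
      exact_mod_cast abs_eq_zero.1 h3
    subst hγ
    rfl
  have hsurj : Function.Surjective Φ := by
    intro v
    obtain ⟨δ, hδ⟩ := hbspan v
    obtain ⟨γ, hγ⟩ := hspan (v - Φ (0, δ)).1 ⟨(v - Φ (0, δ)).2, by
      rw [Prod.mk.eta, map_sub, hres, hδ, sub_self]⟩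
    refine ⟨(γ, δ), ?_⟩
    have hw1 : (v - Φ (γ, δ)).1 = 0 := by
      have : Φ (γ, δ) = Φ (γ, 0) + Φ (0, δ) := by rw [← map_add]; simp
      rw [this, sub_add_eq_sub_sub_swap, Prod.fst_sub, hγ, hfst, sub_self]
    have hw2 : resHom ξ (v - Φ (γ, δ)) = 0 := by rw [map_sub, hres, hδ, sub_self]
    have hw3 : (v - Φ (γ, δ)).2 = 0 := by
      have e : v - Φ (γ, δ) = (0, (v - Φ (γ, δ)).2) := by rw [← hw1]
      rw [e, resHom_fst_zero] at hw2
      ext k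
      have := congrFun hw2 k
      simp only [Pi.zero_apply, neg_eq_zero, Int.cast_eq_zero] at this
      exact this
    exact (sub_eq_zero.1 (Prod.ext hw1 hw3)).symm
  have hc : ∀ γ j, |(γ j : ℝ)| * inorm (f j) ≤ max C₁ C₂ * inorm (Φ (γ, 0)).1 := by
    intro γ j
    rw [hfst]
    refine (hcond γ j).trans ?_
    gcongr
    · exact inorm_nonneg _
    · exact le_max_left _ _
  have hCX : 0 ≤ C * X := by
    have := hfpos 0
    by_contra! h2
    nlinarith
  refine ⟨⟨AddEquiv.ofBijective Φ ⟨hinj, hsurj⟩, fun i => resHom ξ (b i), inorm (f 0), inorm (f 1),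
    inorm (f 2), hpos, h10, h02, hres, hb, fun t j => ?_, fun γ => ⟨hc γ 0, hc γ 1, hc γ 2⟩,
    fun γ => ?_⟩, hX, hge, h0.trans ?_⟩
  · refine (hbc t j).trans ?_
    gcongr
    exact le_max_right _ _
  · change inorm (Φ (γ, 0)).1 ≤ _
    rw [hfst, Fin.sum_univ_three]
    have h2 := inorm_add_le (γ 0 • f 0 + γ 1 • f 1) (γ 2 • f 2)
    have h3 := inorm_add_le (γ 0 • f 0) (γ 1 • f 1)
    simp only [inorm_zsmul] at h2 h3
    linarith
  · gcongr
    exact le_max_left _ _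

namespace Chain

/-- A shift for which every scale carries a nearly minimal vector, no smaller vectors exist, and the
last scale carries a kernel vector. -/
structure Model (K : Chain) (θ : ℕ → ℝ) (T τ : ℕ) : Prop where
  one_le : 1 ≤ T
  k_eq : K.k T = K.n
  le_y : 16 * K.Q (T + τ) ≤ K.y K.n
  y_le : K.y K.n ≤ 64 * K.Q (T + τ)
  adm : ∀ t ≤ T, K.Adm t θ
  low : K.Low T θ
  ker : ∃ (c₀ : ℤ) (c d : ℕ → ℤ), c₀ ≠ 0 ∧ K.size c₀ c ≤ 600 * K.Q (T + τ) ∧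
    ∀ i < K.n, K.form θ c₀ c d i = 0

theorem exists_model (n : ℕ) (hn : 1 ≤ n) : ∃ (τ : ℕ) (R : ℝ), 0 < R ∧ ∀ K : Chain, K.n = n →
    R * K.y (n - 1) ≤ K.y n → ∃ θ T, K.Model θ T τ := by
  have hn0 : (0 : ℝ) < n := by exact_mod_cast hn
  obtain ⟨τ, hτ⟩ := exists_pow_lt_of_lt_one
    (show (0 : ℝ) < 1 / (8192 * (n + 1).factorial) / 32 by positivity)
    (show ((1 / 4 : ℝ) ^ (1 / (n : ℝ))) < 1 from
      Real.rpow_lt_one (by norm_num) (by norm_num) (by positivity))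
  refine ⟨τ, 64 * 64 * 4 ^ τ, by positivity, fun K hK hR => ?_⟩
  subst hK
  have hX := K.X_pos
  have hy0 : K.X ≤ K.y (K.n - 1) := K.le_y_zero.trans (K.y_mono (Nat.zero_le _) (by omega))
  have hbase : 16 * K.Q τ ≤ K.y K.n := by
    refine le_trans ?_ hR
    have : (0 : ℝ) < 4 ^ τ := by positivity
    unfold Q
    nlinarith
  obtain ⟨N, hN⟩ : ∃ N : ℕ, K.y K.n < 16 * K.Q N := by
    obtain ⟨N, hN⟩ := pow_unbounded_of_one_lt (K.y K.n / (8 * K.X)) (show (1 : ℝ) < 4 by norm_num)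
    refine ⟨N, ?_⟩
    rw [div_lt_iff₀ (by positivity)] at hN
    unfold Q
    linarith
  classical
  have hle : τ < N := by
    by_contra h
    linarith [K.Q_mono (not_lt.1 h)]
  let te := Nat.findGreatest (fun t => 16 * K.Q t ≤ K.y K.n) N
  have h1 : 16 * K.Q te ≤ K.y K.n := Nat.findGreatest_spec (P := fun t => 16 * K.Q t ≤ K.y K.n)
    hle.le hbase
  have h2 : K.y K.n < 16 * K.Q (te + 1) := by
    rcases lt_or_ge te N with h | h
    · exact not_le.1 (Nat.findGreatest_is_greatest (P := fun t => 16 * K.Q t ≤ K.y K.n)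
        (Nat.lt_succ_self te) h)
    · linarith [K.Q_mono (show N ≤ te + 1 by omega)]
  rw [K.Q_succ] at h2
  have h3 : τ < te := by
    by_contra h
    have := K.Q_mono (not_lt.1 h)
    have h4 : (0 : ℝ) < 4 ^ τ := by positivity
    unfold Q at this h2
    nlinarith
  clear_value te
  obtain ⟨T, rfl⟩ : ∃ T, te = T + τ := ⟨te - τ, by omega⟩
  have hQ : K.Q (T + τ) = 4 ^ τ * K.Q T := by unfold Q; rw [pow_add]; ring
  have h4 : 64 * K.y (K.n - 1) ≤ K.Q T := by
    have h4 : (0 : ℝ) < 4 ^ τ := by positivity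
    rw [hQ] at h2
    nlinarith
  have hk : K.k T = K.n := by
    refine le_antisymm (K.k_le T) ?_
    by_contra h
    have h5 := K.y_mono (show K.k T ≤ K.n - 1 by omega) (by omega)
    have h6 := (K.k_spec T).2.resolve_left h
    linarith [K.Q_pos T]
  obtain ⟨θ, hadm, hlow, hker⟩ := K.exists_shift_with_kernel (show 1 ≤ T by omega) h1 hk h4
    (by unfold eps; exact hτ.le)
  exact ⟨θ, T, by omega, hk, h1, by linarith, hadm, hlow, hker⟩

end Chain

theorem cassini (r : ℕ) :
    (Nat.fib (r + 2) : ℤ) * Nat.fib r - Nat.fib (r + 1) * Nat.fib (r + 1) = (-1) ^ (r + 1) := by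
  induction r with
  | zero => simp
  | succ r ih =>
    have h : (Nat.fib (r + 1 + 2) : ℤ) = Nat.fib (r + 1) + Nat.fib (r + 2) := by
      rw [Nat.fib_add_two (n := r + 1)]; push_cast; ring
    have h2 : (Nat.fib (r + 2) : ℤ) = Nat.fib r + Nat.fib (r + 1) := by
      rw [Nat.fib_add_two]; push_cast; ring
    rw [h, pow_succ, ← ih]
    simp only [show r + 1 + 1 = r + 2 from rfl]
    rw [h2]
    ring

/-- Extension of a finite integer vector by zero. -/
def extZero {n : ℕ} (δ : Fin n → ℤ) (i : ℕ) : ℤ := if h : i < n then δ ⟨i, h⟩ else 0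

theorem extZero_of_lt {n : ℕ} (δ : Fin n → ℤ) {i : ℕ} (h : i < n) : extZero δ i = δ ⟨i, h⟩ :=
  dif_pos h

theorem extZero_coe {n : ℕ} (δ : Fin n → ℤ) (i : Fin n) : extZero δ i = δ i :=
  dif_pos i.2

theorem extZero_zero {n : ℕ} (i : ℕ) : extZero (0 : Fin n → ℤ) i = 0 := by
  unfold extZero; split <;> rfl

theorem extZero_add {n : ℕ} (δ δ' : Fin n → ℤ) (i : ℕ) :
    extZero (δ + δ') i = extZero δ i + extZero δ' i := by
  unfold extZero; split <;> simp

/-- Coordinates twisted by Fibonacci numbers and a large parameter `T`. -/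
structure twist {n : ℕ} (r T : ℕ) (u : (Fin 3 → ℤ) × (Fin n → ℤ)) (c₀ : ℤ) (c d : ℕ → ℤ) : Prop where
  fst_zero : u.1 0 = c₀ * Nat.fib (r + 2) + d 0 * Nat.fib (r + 1)
  fst_one : u.1 1 = c₀ * Nat.fib (r + 1) + c 1 * T + d 0 * Nat.fib r
  fst_two : u.1 2 = c 0
  snd_zero : extZero u.2 0 = - c 1
  snd_succ : ∀ i, extZero u.2 (i + 1) = d (i + 1)

section twist

variable {n : ℕ} (r T : ℕ) (u : (Fin 3 → ℤ) × (Fin n → ℤ))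

/-- The coordinate along the long direction. -/
def twistLong : ℤ :=
  (-1) ^ (r + 1) * (Nat.fib r * u.1 0 - Nat.fib (r + 1) * (u.1 1 + T * extZero u.2 0))

/-- The coordinate across the long direction. -/
def twistShort : ℤ :=
  (-1) ^ (r + 1) * (Nat.fib (r + 2) * (u.1 1 + T * extZero u.2 0) - Nat.fib (r + 1) * u.1 0)

def twistCol (i : ℕ) : ℤ := if i = 0 then u.1 2 else - extZero u.2 0

def twistRow (i : ℕ) : ℤ := if i = 0 then twistShort r T u else extZero u.2 i

theorem twist_coords : twist r T u (twistLong r T u) (twistCol u) (twistRow r T u) := by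
  have h := cassini r
  have hs : ((-1 : ℤ) ^ (r + 1)) * (-1) ^ (r + 1) = 1 := by
    rw [← mul_pow]; simp
  constructor
  · simp only [twistLong, twistRow, twistShort, if_true]
    linear_combination (-u.1 0) * hs + (-u.1 0 * (-1) ^ (r + 1)) * h
  · simp only [twistLong, twistRow, twistShort, twistCol, if_true, one_ne_zero, if_false]
    linear_combination (-(u.1 1 + T * extZero u.2 0)) * hs +
      (-(u.1 1 + T * extZero u.2 0) * (-1) ^ (r + 1)) * h
  · simp [twistCol]
  · simp [twistCol]
  · intro i
    simp [twistRow]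

variable {r T u}

theorem twist.eq_coords {c₀ : ℤ} {c d : ℕ → ℤ} (h : twist r T u c₀ c d) :
    twistLong r T u = c₀ ∧ twistCol u 0 = c 0 ∧ twistCol u 1 = c 1 ∧
      ∀ i, twistRow r T u i = d i := by
  have hc := cassini r
  have hs : ((-1 : ℤ) ^ (r + 1)) * (-1) ^ (r + 1) = 1 := by
    rw [← mul_pow]; simp
  have e1 : u.1 1 + T * extZero u.2 0 = c₀ * Nat.fib (r + 1) + d 0 * Nat.fib r := by
    rw [h.fst_one, h.snd_zero]; ring
  refine ⟨?_, by simp [twistCol, h.fst_two], by simp [twistCol, h.snd_zero], fun i => ?_⟩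
  · rw [twistLong, e1, h.fst_zero]
    linear_combination c₀ * hs + (c₀ * (-1) ^ (r + 1)) * hc
  · rcases i with _ | i
    · rw [twistRow, if_pos rfl, twistShort, e1, h.fst_zero]
      linear_combination d 0 * hs + (d 0 * (-1) ^ (r + 1)) * hc
    · rw [twistRow, if_neg (by omega), h.snd_succ]

theorem exists_twist (hn : 1 ≤ n) (r T : ℕ) (c₀ : ℤ) (c d : ℕ → ℤ) (hd : ∀ i, n ≤ i → d i = 0) :
    ∃ u : (Fin 3 → ℤ) × (Fin n → ℤ), twist r T u c₀ c d := by
  refine ⟨(![c₀ * Nat.fib (r + 2) + d 0 * Nat.fib (r + 1),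
    c₀ * Nat.fib (r + 1) + c 1 * T + d 0 * Nat.fib r, c 0],
    fun i => if (i : ℕ) = 0 then - c 1 else d i), ⟨by simp, by simp, by simp, ?_, fun i => ?_⟩⟩
  · rw [extZero_of_lt _ hn]; simp
  · rcases lt_or_ge (i + 1) n with hi | hi
    · rw [extZero_of_lt _ hi]; simp
    · rw [extZero, dif_neg (by omega), hd _ hi]

theorem eq_zero_of_coords (hn : 1 ≤ n) (h0 : twistLong r T u = 0) (hc0 : twistCol u 0 = 0)
    (hc1 : twistCol u 1 = 0) (hd : ∀ i < n, twistRow r T u i = 0) : u = 0 := by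
  have h := twist_coords r T u
  have hd0 := hd 0 hn
  have h1 := h.fst_zero
  have h2 := h.fst_one
  have h3 := h.fst_two
  rw [h0, hd0, zero_mul, zero_mul, add_zero] at h1
  rw [h0, hd0, hc1, zero_mul, zero_mul, zero_mul, add_zero, add_zero] at h2
  rw [hc0] at h3
  refine Prod.ext (funext fun j => ?_) (funext fun i => ?_)
  · fin_cases j
    · exact h1
    · exact h2
    · exact h3
  · rw [← extZero_coe u.2 i]
    rcases hi : (i : ℕ) with _ | j
    · rw [h.snd_zero, hc1]; rfl
    · rw [h.snd_succ]; exact hd _ (hi ▸ i.2)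

end twist

namespace Chain

/-- The vectors paired with the linear forms of a chain. -/
noncomputable def row {n : ℕ} (a : Fin n → Fin n → ℝ) (r T : ℕ) (i : Fin n) : Fin n → ℝ :=
  (if (i : ℕ) = 0 then (-1) ^ (r + 1) / (T * Nat.fib (r + 2)) else 1 : ℝ) • a i

theorem form_add (K : Chain) (θ : ℕ → ℝ) (c₀ c₀' : ℤ) (c c' d d' : ℕ → ℤ) (i : ℕ) :
    K.form θ (c₀ + c₀') (c + c') (d + d') i = K.form θ c₀ c d i + K.form θ c₀' c' d' i := by
  simp only [form, Pi.add_apply, Int.cast_add]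
  ring

theorem form_congr (K : Chain) (θ : ℕ → ℝ) {c₀ : ℤ} {c c' d d' : ℕ → ℤ} {i : ℕ} (h0 : c 0 = c' 0)
    (h1 : c 1 = c' 1) (hd : d i = d' i) : K.form θ c₀ c d i = K.form θ c₀ c' d' i := by
  simp only [form, hd]
  rcases Nat.mod_two_eq_zero_or_one i with h | h <;> rw [h] <;> simp [h0, h1]

/-- The additive map attached to a chain and a shift in twisted coordinates. -/
noncomputable def twisted {n : ℕ} (K : Chain) (θ : ℕ → ℝ) (a : Fin n → Fin n → ℝ) (r T : ℕ) :
    (Fin 3 → ℤ) × (Fin n → ℤ) →+ (Fin n → ℝ) where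
  toFun u := ∑ i : Fin n, K.form θ (twistLong r T u) (twistCol u) (twistRow r T u) i • row a r T i
  map_zero' := by
    refine Finset.sum_eq_zero fun i _ => ?_
    have : K.form θ (twistLong r T (0 : (Fin 3 → ℤ) × (Fin n → ℤ)))
        (twistCol (0 : (Fin 3 → ℤ) × (Fin n → ℤ))) (twistRow r T (0 : (Fin 3 → ℤ) × (Fin n → ℤ))) i =
        0 := by
      have hc : ∀ j, twistCol (0 : (Fin 3 → ℤ) × (Fin n → ℤ)) j = 0 := fun j => by
        simp [twistCol, extZero_zero]
      simp [form, hc, twistLong, twistRow, twistShort, extZero_zero]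
    rw [this, zero_smul]
  map_add' u v := by
    rw [← Finset.sum_add_distrib]
    refine Finset.sum_congr rfl fun i _ => ?_
    rw [← add_smul, ← form_add]
    congr 2
    · simp only [twistLong, Prod.fst_add, Prod.snd_add, Pi.add_apply, extZero_add]
      ring
    · ext j
      simp only [twistCol, Prod.fst_add, Prod.snd_add, Pi.add_apply, extZero_add]
      split <;> ring
    · ext j
      simp only [twistRow, twistShort, Prod.fst_add, Prod.snd_add, Pi.add_apply, extZero_add]
      split <;> ring

theorem twisted_apply {n : ℕ} (K : Chain) (θ : ℕ → ℝ) (a : Fin n → Fin n → ℝ) (r T : ℕ)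
    (u : (Fin 3 → ℤ) × (Fin n → ℤ)) : K.twisted θ a r T u =
    ∑ i : Fin n, K.form θ (twistLong r T u) (twistCol u) (twistRow r T u) i • row a r T i := rfl

end Chain

theorem Frame.exists_inorm_snd_le {n : ℕ} {C : ℝ} {ξ : Matrix (Fin n) (Fin 3) ℝ} (Φ : Frame C ξ) :
    ∃ B : ℝ, 0 ≤ B ∧ ∀ δ : Fin n → ℤ, inorm (Φ.e (0, δ)).1 ≤ B * ∑ i, |(δ i : ℝ)| := by
  refine ⟨∑ i, inorm (Φ.e (0, Pi.single i 1)).1,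
    Finset.sum_nonneg fun i _ => inorm_nonneg _, fun δ => ?_⟩
  have e1 : (Φ.e (0, δ)).1 = ∑ i, δ i • (Φ.e (0, Pi.single i 1)).1 := by
    have : ((0, δ) : (Fin 3 → ℤ) × (Fin n → ℤ)) = ∑ i, δ i • (0, Pi.single i 1) := by
      refine Prod.ext (by simp [Prod.fst_sum]) ?_
      rw [Prod.snd_sum]
      ext j
      simp [Finset.sum_apply, Pi.single_apply]
    rw [this, map_sum, Prod.fst_sum]
    simp only [map_zsmul, Prod.smul_fst]
  have hsum : ∀ s : Finset (Fin n), inorm (∑ i ∈ s, δ i • (Φ.e (0, Pi.single i 1)).1) ≤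
      ∑ i ∈ s, |(δ i : ℝ)| * inorm (Φ.e (0, Pi.single i 1)).1 := by
    intro s
    induction s using Finset.cons_induction with
    | empty => simp [inorm]
    | cons i s hi ih =>
      rw [Finset.sum_cons, Finset.sum_cons]
      refine (inorm_add_le _ _).trans ?_
      rw [inorm_zsmul]
      linarith
  rw [e1, Finset.mul_sum]
  refine (hsum _).trans (Finset.sum_le_sum fun i _ => ?_)
  rw [mul_comm]
  gcongr
  exact Finset.single_le_sum (f := fun i => inorm (Φ.e (0, Pi.single i 1)).1)
    (fun i _ => inorm_nonneg _) (Finset.mem_univ i)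

/-- A chain whose parameters match those of a frame, with long lengths that are large compared with
all the data of the frame. -/
structure Fits {n : ℕ} {C : ℝ} {ξ : Matrix (Fin n) (Fin 3) ℝ} (Φ : Frame C ξ) (B : ℝ) (r T : ℕ)
    (K : Chain) : Prop where
  n_eq : K.n = n
  C_ge : 1 ≤ C
  B_nonneg : 0 ≤ B
  snd_le : ∀ δ : Fin n → ℤ, inorm (Φ.e (0, δ)).1 ≤ B * ∑ i, |(δ i : ℝ)|
  T_pos : 1 ≤ T
  X_eq : K.X = Nat.fib (r + 2) * Φ.X₀
  y_zero : K.y 0 = Φ.Z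
  y_one : K.y 1 = T * Φ.X₁
  h_eq : ∀ i : Fin n, K.h i = ‖Chain.row Φ.a r T i‖
  fib_le : 32 * C * (Nat.fib (r + 1) * Φ.X₀) ≤ K.y 1
  B_le : 32 * C * (n * B) ≤ K.y 1

theorem Chain.size_nonneg (K : Chain) {c₀ : ℤ} {c : ℕ → ℤ} : 0 ≤ K.size c₀ c :=
  le_max_of_le_left (mul_nonneg (abs_nonneg _) K.X_pos.le)

namespace Fits

variable {n : ℕ} {C : ℝ} {ξ : Matrix (Fin n) (Fin 3) ℝ} {Φ : Frame C ξ} {B : ℝ} {r T : ℕ}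
  {K : Chain} (hF : Fits Φ B r T K) {θ : ℕ → ℝ}

include hF

theorem abs_row_le (hθ : ∀ i < n, |θ i| ≤ K.X / K.y (i + 2)) {c₀ : ℤ} {c d : ℕ → ℤ} {i : ℕ}
    (hi : i < n) (hf : |K.form θ c₀ c d i| ≤ 1 / 2) :
    |(d i : ℝ)| ≤ 4 * K.size c₀ c / K.y 1 := by
  have hS := K.size_nonneg (c₀ := c₀) (c := c)
  have hy := K.y_add_two_pos (hF.n_eq ▸ hi)
  have hy1 : 0 < K.y 1 := K.y_pos 1 (by omega)
  obtain ⟨s0, s1, s2⟩ := Chain.size_le_iff.1 (le_refl (K.size c₀ c))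
  rcases eq_or_ne (d i) 0 with h0 | h0
  · rw [h0, Int.cast_zero, abs_zero]
    positivity
  have hd1 : (1 : ℝ) ≤ |(d i : ℝ)| := by exact_mod_cast Int.one_le_abs h0
  have h1 : |(c (i % 2) : ℝ) / parityProd K.s i| ≤ K.size c₀ c / K.y (i + 2) := by
    rw [K.abs_div_den]
    gcongr
    rcases Nat.mod_two_eq_zero_or_one i with h | h <;> rw [h] <;> assumption
  have h2 : |(c₀ : ℝ) * θ i| ≤ K.size c₀ c / K.y (i + 2) := by
    rw [abs_mul]
    refine (mul_le_mul_of_nonneg_left (hθ i hi) (abs_nonneg _)).trans ?_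
    rw [← mul_div_assoc]
    gcongr
  have h3 : |(d i : ℝ)| ≤ 1 / 2 + 2 * (K.size c₀ c / K.y (i + 2)) := by
    have e : (d i : ℝ) = K.form θ c₀ c d i - c (i % 2) / parityProd K.s i - c₀ * θ i := by
      unfold Chain.form; ring
    rw [e]
    refine (abs_sub _ _).trans ?_
    have := abs_sub (K.form θ c₀ c d i) (c (i % 2) / parityProd K.s i : ℝ)
    linarith
  have h4 : K.size c₀ c / K.y (i + 2) ≤ K.size c₀ c / K.y 1 := by
    gcongr
    exact K.y_mono (by omega) (by have := hF.n_eq; omega)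
  rw [mul_div_assoc]
  linarith

theorem compare (hn : 1 ≤ n) (hθ : ∀ i < n, |θ i| ≤ K.X / K.y (i + 2)) {u : (Fin 3 → ℤ) × (Fin n → ℤ)}
    {c₀ : ℤ} {c d : ℕ → ℤ} (hu : twist r T u c₀ c d)
    (hf : ∀ i < n, |K.form θ c₀ c d i| ≤ 1 / 2) :
    inorm (Φ.e u).1 ≤ 7 * K.size c₀ c ∧ K.size c₀ c ≤ 4 * C * inorm (Φ.e u).1 := by
  set S := K.size c₀ c with hSdef
  set N := inorm (Φ.e u).1 with hNdef
  have hS : 0 ≤ S := K.size_nonneg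
  have hN : 0 ≤ N := inorm_nonneg _
  have hC := hF.C_ge
  have hC0 : 0 < C := by linarith
  have hB := hF.B_nonneg
  have hy1 : 0 < K.y 1 := K.y_pos 1 (by omega)
  have hX1 := Φ.X₁_pos
  have hX0 : 0 < Φ.X₀ := hX1.trans_le Φ.X₁_le
  have hZ : 0 < Φ.Z := hX0.trans_le Φ.X₀_le
  obtain ⟨s0, s1, s2⟩ := Chain.size_le_iff.1 (le_refl (K.size c₀ c))
  rw [← hSdef] at s0 s1 s2
  rw [hF.X_eq] at s0
  rw [hF.y_zero] at s1
  rw [hF.y_one] at s2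
  have hd := fun i hi => hF.abs_row_le hθ (i := i) hi (hf i hi)
  rw [← hSdef] at hd
  set η := S / (8 * C) with hη
  have hη0 : 0 ≤ η := by positivity
  have hηS : C * η = S / 8 := by rw [hη]; field_simp
  have hηS' : η ≤ S / 8 := by nlinarith
  have hfr : (0 : ℝ) ≤ Nat.fib r := Nat.cast_nonneg _
  have hfr1 : (Nat.fib r : ℝ) ≤ Nat.fib (r + 1) := by exact_mod_cast Nat.fib_le_fib_succ
  have hfr2 : (Nat.fib (r + 1) : ℝ) ≤ Nat.fib (r + 2) := by exact_mod_cast Nat.fib_le_fib_succ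
  have hd0 : |(d 0 : ℝ)| * (Nat.fib (r + 1) * Φ.X₀) ≤ η := by
    refine (mul_le_mul_of_nonneg_right (hd 0 hn) (by positivity)).trans ?_
    rw [hη, div_mul_eq_mul_div, div_le_div_iff₀ hy1 (by positivity)]
    nlinarith [hF.fib_le]
  have hd1 : |(d 0 : ℝ)| * (Nat.fib r * Φ.X₁) ≤ η := by
    refine le_trans ?_ hd0
    have := Φ.X₁_le
    gcongr
  have hδ : inorm (Φ.e (0, u.2)).1 ≤ η := by
    refine (hF.snd_le _).trans ?_
    have hδi : ∀ i : Fin n, |(u.2 i : ℝ)| ≤ 4 * S / K.y 1 := by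
      intro i
      rw [← extZero_coe u.2 i]
      rcases hi : (i : ℕ) with _ | j
      · rw [hu.snd_zero, Int.cast_neg, abs_neg, le_div_iff₀ hy1, hF.y_one]
        linarith
      · rw [hu.snd_succ]
        exact hd _ (hi ▸ i.2)
    have h1 : ∑ i, |(u.2 i : ℝ)| ≤ n * (4 * S / K.y 1) := by
      refine (Finset.sum_le_sum fun i _ => hδi i).trans ?_
      simp
    refine (mul_le_mul_of_nonneg_left h1 hB).trans ?_
    rw [hη, ← mul_assoc, ← mul_div_assoc, div_le_div_iff₀ hy1 (by positivity)]
    nlinarith [hF.B_le]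
  have hsplit : Φ.e u = Φ.e (u.1, 0) + Φ.e (0, u.2) := by rw [← map_add]; simp
  have hγ0 : |(u.1 0 : ℝ)| * Φ.X₀ ≤ S + η := by
    have h1 : |(u.1 0 : ℝ)| ≤ |(c₀ : ℝ)| * Nat.fib (r + 2) + |(d 0 : ℝ)| * Nat.fib (r + 1) := by
      rw [hu.fst_zero]
      push_cast
      refine (abs_add_le _ _).trans ?_
      rw [abs_mul, abs_mul, Nat.abs_cast, Nat.abs_cast]
    have := mul_le_mul_of_nonneg_right h1 hX0.le
    linarith
  have hc0B : |(c₀ : ℝ)| * Nat.fib (r + 1) * Φ.X₁ ≤ |(c₀ : ℝ)| * (Nat.fib (r + 2) * Φ.X₀) := by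
    rw [mul_assoc]
    have := Φ.X₁_le
    gcongr
  constructor
  · have h1 := inorm_add_le (Φ.e (u.1, 0)).1 (Φ.e (0, u.2)).1
    rw [← Prod.fst_add, ← hsplit] at h1
    have h2 := Φ.inorm_le u.1
    have h3 : |(u.1 1 : ℝ)| * Φ.X₁ ≤ 2 * S + η := by
      have h3 : |(u.1 1 : ℝ)| ≤ |(c₀ : ℝ)| * Nat.fib (r + 1) + |(c 1 : ℝ)| * T +
          |(d 0 : ℝ)| * Nat.fib r := by
        rw [hu.fst_one]
        push_cast
        refine (abs_add_three _ _ _).trans ?_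
        rw [abs_mul, abs_mul, abs_mul, Nat.abs_cast, Nat.abs_cast, Nat.abs_cast]
      have := mul_le_mul_of_nonneg_right h3 hX1.le
      linarith
    have h4 : |(u.1 2 : ℝ)| * Φ.Z ≤ S := by rw [hu.fst_two]; exact s1
    linarith
  · have h1 := inorm_add_le (Φ.e u).1 (-(Φ.e (0, u.2)).1)
    have e1 : (Φ.e u).1 + -(Φ.e (0, u.2)).1 = (Φ.e (u.1, 0)).1 := by
      rw [hsplit, Prod.fst_add]; simp
    rw [e1, inorm_neg] at h1
    have hM : C * inorm (Φ.e (u.1, 0)).1 ≤ C * N + S / 8 := by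
      rw [← hηS]
      nlinarith
    obtain ⟨l0, l1, l2⟩ := Φ.le_inorm u.1
    have hc0 : |(c₀ : ℝ)| * (Nat.fib (r + 2) * Φ.X₀) ≤ C * N + S / 8 + η := by
      have h2 : |(c₀ : ℝ)| * Nat.fib (r + 2) ≤ |(u.1 0 : ℝ)| + |(d 0 : ℝ)| * Nat.fib (r + 1) := by
        have e2 : ((c₀ : ℝ) * Nat.fib (r + 2)) = u.1 0 - d 0 * Nat.fib (r + 1) := by
          rw [hu.fst_zero]; push_cast; ring
        have := abs_sub (u.1 0 : ℝ) (d 0 * Nat.fib (r + 1))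
        rwa [← e2, abs_mul, abs_mul, Nat.abs_cast, Nat.abs_cast] at this
      have := mul_le_mul_of_nonneg_right h2 hX0.le
      linarith
    have hc1 : |(c 1 : ℝ)| * (T * Φ.X₁) ≤ 2 * (C * N + S / 8) + 2 * η := by
      have h2 : |(c 1 : ℝ)| * T ≤ |(u.1 1 : ℝ)| + |(c₀ : ℝ)| * Nat.fib (r + 1) +
          |(d 0 : ℝ)| * Nat.fib r := by
        have e2 : ((c 1 : ℝ) * T) = u.1 1 - c₀ * Nat.fib (r + 1) - d 0 * Nat.fib r := by
          rw [hu.fst_one]; push_cast; ring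
        have h5 := abs_sub (u.1 1 - c₀ * Nat.fib (r + 1) : ℝ) (d 0 * Nat.fib r)
        have h6 := abs_sub (u.1 1 : ℝ) (c₀ * Nat.fib (r + 1))
        rw [← e2, abs_mul, abs_mul, Nat.abs_cast, Nat.abs_cast] at h5
        rw [abs_mul (c₀ : ℝ), Nat.abs_cast] at h6
        linarith
      have := mul_le_mul_of_nonneg_right h2 hX1.le
      linarith
    have hc2 : |(c 0 : ℝ)| * Φ.Z ≤ C * N + S / 8 := by
      rw [← hu.fst_two]
      linarith
    have hCN : 0 ≤ C * N := by positivity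
    have : S ≤ 2 * (C * N + S / 8) + 2 * η := by
      rw [hSdef, Chain.size_le_iff, hF.X_eq, hF.y_zero, hF.y_one, ← hSdef]
      exact ⟨by linarith, by linarith, hc1⟩
    linarith

end Fits

/-- An additive map with a small value at every scale up to `Q T`, no much smaller values, and a
kernel of full rank with two short vectors. -/
structure ScaleModel {n : ℕ} (B : ℝ) (τ : ℕ) (F : (Fin 3 → ℤ) × (Fin n → ℤ) →+ (Fin n → ℝ))
    (Q G : ℕ → ℝ) (T : ℕ) : Prop where
  one_le : 1 ≤ T
  low : ∀ t < T, ∀ v ≠ 0, B * inorm v.1 ≤ Q t → G t ≤ B * ‖F v‖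
  up : ∀ t ≤ T, ∃ v, v.1 ≠ 0 ∧ inorm v.1 ≤ B * Q t ∧ ‖F v‖ ≤ B * G t
  G_pos : ∀ t, 0 < G t
  decay : ∀ t, t + τ ≤ T → 8 * B ^ 2 * G (t + τ) < G t
  ker : ∃ v₁ v₂ v₃, F v₁ = 0 ∧ F v₂ = 0 ∧ F v₃ = 0 ∧ inorm v₁.1 ≤ B * Q T ∧
    inorm v₂.1 ≤ B * Q T ∧ ∀ a b c : ℤ, a • v₁ + b • v₂ + c • v₃ = 0 → a = 0 ∧ b = 0 ∧ c = 0

theorem parityProd_dvd (s : ℕ → ℕ) (i k : ℕ) : parityProd s i ∣ parityProd s (i + 2 * k) := by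
  induction k with
  | zero => simp
  | succ k ih =>
    exact ih.trans (by rw [show i + 2 * (k + 1) = i + 2 * k + 2 by ring]; exact Dvd.intro _ rfl)

theorem Chain.exists_common_multiple (K : Chain) {m : ℕ} (hm : 1 ≤ m) : ∃ N : ℕ, 0 < N ∧
    (N : ℝ) * K.y (m % 2) = K.y m ∧ ∀ i < m, i % 2 = m % 2 → parityProd K.s i ∣ N := by
  rcases m with _ | _ | m
  · omega
  · exact ⟨1, one_pos, by simp, fun i hi h => by omega⟩
  · refine ⟨parityProd K.s m, parityProd_pos K.s_pos m, ?_, fun i hi h => ?_⟩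
    · rw [show (m + 1 + 1) % 2 = m % 2 by omega, mul_comm]
      exact K.y_mod_mul_den m
    · obtain ⟨k, hk⟩ : ∃ k, m = i + 2 * k := ⟨(m - i) / 2, by omega⟩
      rw [hk]
      exact parityProd_dvd _ _ _

theorem Chain.exists_column_kernel (K : Chain) (θ : ℕ → ℝ) {m : ℕ} (hm : 1 ≤ m) (hmn : K.n ≤ m) :
    ∃ c d : ℕ → ℤ, c (m % 2) ≠ 0 ∧ c ((m + 1) % 2) = 0 ∧ (∀ i, K.n ≤ i → d i = 0) ∧
      (∀ i < K.n, K.form θ 0 c d i = 0) ∧ K.size 0 c ≤ |K.y m| := by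
  obtain ⟨N, hN, hy, hdvd⟩ := K.exists_common_multiple hm
  refine ⟨fun j => if j = m % 2 then N else 0,
    fun i => if i < K.n ∧ i % 2 = m % 2 then -((N / parityProd K.s i : ℕ) : ℤ) else 0, ?_, ?_,
    fun i hi => ?_, fun i hi => ?_, ?_⟩
  · simp only [if_true]
    exact_mod_cast hN.ne'
  · simp only [show ¬ (m + 1) % 2 = m % 2 by omega, if_false]
  · simp only [show ¬ (i < K.n ∧ i % 2 = m % 2) by omega, if_false]
  · unfold form
    by_cases h : i % 2 = m % 2
    · have hd := K.den_pos i
      simp only [h, hi, and_self, if_true]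
      rw [Int.cast_neg, Int.cast_natCast, Nat.cast_div (hdvd i (by omega) h) hd.ne']
      simp
    · simp [h]
  · have hy0 : |(N : ℝ)| * |K.y (m % 2)| ≤ |K.y m| := by rw [← hy, abs_mul]
    have hle : ∀ j, |(((if j = m % 2 then (N : ℤ) else 0 : ℤ)) : ℝ)| * K.y j ≤ |K.y m| := by
      intro j
      by_cases h : j = m % 2
      · subst h
        simp only [if_true, Int.cast_natCast]
        refine le_trans ?_ hy0
        gcongr
        exact le_abs_self _
      · simp [h]
    rw [Chain.size_le_iff]
    exact ⟨by simp, hle 0, hle 1⟩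

section twist

variable {n r T : ℕ} {u u' : (Fin 3 → ℤ) × (Fin n → ℤ)} {c₀ c₀' : ℤ} {c c' d d' : ℕ → ℤ}

theorem twist.add (h : twist r T u c₀ c d) (h' : twist r T u' c₀' c' d') :
    twist r T (u + u') (c₀ + c₀') (c + c') (d + d') := by
  constructor <;> simp only [Prod.fst_add, Prod.snd_add, Pi.add_apply, extZero_add, h.fst_zero,
    h'.fst_zero, h.fst_one, h'.fst_one, h.fst_two, h'.fst_two, h.snd_zero, h'.snd_zero, h.snd_succ,
    h'.snd_succ, implies_true] <;> ring

theorem twist.zsmul (h : twist r T u c₀ c d) (a : ℤ) :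
    twist r T (a • u) (a * c₀) (a • c) (a • d) := by
  have e : ∀ i, extZero (a • u.2) i = a * extZero u.2 i := fun i => by
    unfold extZero; split <;> simp
  constructor <;> simp only [Prod.smul_fst, Prod.smul_snd, Pi.smul_apply, e, h.fst_zero, h.fst_one,
    h.fst_two, h.snd_zero, h.snd_succ, smul_eq_mul, implies_true] <;> ring

theorem twist.eq_of_zero (h : twist r T (0 : (Fin 3 → ℤ) × (Fin n → ℤ)) c₀ c d) :
    c₀ = 0 ∧ c 0 = 0 ∧ c 1 = 0 := by
  obtain ⟨h1, h2, h3, -⟩ := h.eq_coords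
  exact ⟨by rw [← h1]; simp [twistLong, extZero_zero], by rw [← h2]; simp [twistCol],
    by rw [← h3]; simp [twistCol, extZero_zero]⟩

end twist

namespace Fits

variable {n : ℕ} {C : ℝ} {ξ : Matrix (Fin n) (Fin 3) ℝ} {Φ : Frame C ξ} {B : ℝ} {r T : ℕ}
  {K : Chain} (hF : Fits Φ B r T K) {θ : ℕ → ℝ}

include hF

theorem abs_form_mul_le (u : (Fin 3 → ℤ) × (Fin n → ℤ)) {i : ℕ} (hi : i < n) :
    |K.form θ (twistLong r T u) (twistCol u) (twistRow r T u) i| * K.h i ≤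
      C * ‖K.twisted θ Φ.a r T u‖ := by
  have h := Φ.a_cond (fun i => K.form θ (twistLong r T u) (twistCol u) (twistRow r T u) i *
    (if (i : ℕ) = 0 then (-1) ^ (r + 1) / (T * Nat.fib (r + 2)) else 1 : ℝ)) ⟨i, hi⟩
  have h2 := hF.h_eq ⟨i, hi⟩
  simp only at h2
  rw [h2, K.twisted_apply]
  simp only [Chain.row, smul_smul]
  refine le_trans (le_of_eq ?_) h
  rw [norm_smul, abs_mul, Real.norm_eq_abs, mul_assoc]

theorem norm_twisted_le {u : (Fin 3 → ℤ) × (Fin n → ℤ)} {b : ℝ}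
    (h : ∀ i < n, |K.form θ (twistLong r T u) (twistCol u) (twistRow r T u) i| * K.h i ≤ b) :
    ‖K.twisted θ Φ.a r T u‖ ≤ n * b := by
  rw [K.twisted_apply]
  refine (norm_sum_le _ _).trans ?_
  have : ∀ i : Fin n, ‖K.form θ (twistLong r T u) (twistCol u) (twistRow r T u) i •
      Chain.row Φ.a r T i‖ ≤ b := by
    intro i
    rw [norm_smul, ← hF.h_eq i, Real.norm_eq_abs]
    exact h i i.2
  refine (Finset.sum_le_sum fun i _ => this i).trans ?_
  simp

end Fits

namespace Fits

variable {n : ℕ} {C : ℝ} {ξ : Matrix (Fin n) (Fin 3) ℝ} {Φ : Frame C ξ} {B : ℝ} {r T : ℕ}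
  {K : Chain} (hF : Fits Φ B r T K) {θ : ℕ → ℝ}

include hF

theorem exists_vector (hn : 1 ≤ n) (hθ : ∀ i < n, |θ i| ≤ K.X / K.y (i + 2)) (c₀ : ℤ)
    (c d : ℕ → ℤ) {b : ℝ} (hf : ∀ i < n, |K.form θ c₀ c d i| * K.h i ≤ b)
    (hb : ∀ i < n, b ≤ K.h i / 2) :
    ∃ u : (Fin 3 → ℤ) × (Fin n → ℤ), twist r T u c₀ c (fun i => if i < n then d i else 0) ∧
      ‖K.twisted θ Φ.a r T u‖ ≤ n * b ∧ inorm (Φ.e u).1 ≤ 7 * K.size c₀ c := by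
  obtain ⟨u, hu⟩ := exists_twist hn r T c₀ c (fun i => if i < n then d i else 0)
    (fun i hi => if_neg (not_lt.2 hi))
  have hf' : ∀ i < n, K.form θ c₀ c (fun i => if i < n then d i else 0) i = K.form θ c₀ c d i :=
    fun i hi => K.form_congr θ rfl rfl (if_pos hi)
  refine ⟨u, hu, hF.norm_twisted_le fun i hi => ?_, (hF.compare hn hθ hu fun i hi => ?_).1⟩
  · obtain ⟨e1, e2, e3, e4⟩ := hu.eq_coords
    rw [e1, K.form_congr θ (d' := fun i => if i < n then d i else 0) e2 e3 (e4 i), hf' i hi]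
    exact hf i hi
  · rw [hf' i hi]
    have h := (hf i hi).trans (hb i hi)
    have := K.h_pos i
    by_contra! h2
    nlinarith

theorem scaleModel (hn : 1 ≤ n) {T₃ τ₀ : ℕ} (hM : K.Model θ T₃ τ₀) {M : ℝ} {τ : ℕ}
    (hMC : 16 * C / K.eps ≤ M) (hMC' : C ≤ M) (hM1 : 4200 * 4 ^ τ₀ ≤ M) (hM2 : 50 * n ≤ M)
    (hτ : 8 * M ^ 2 * ((1 / 4 : ℝ) ^ (1 / (n : ℝ))) ^ τ < 1)
    (hsmall : ∀ i < n, 100 * K.G 0 ≤ K.h i) (hG0 : n * (50 * K.G 0) < 1 / 4)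
    (hy : ∀ y : Fin n → ℤ, y ≠ 0 → 1 / 4 ≤ ‖K.twisted θ Φ.a r T (Φ.e.symm (0, y))‖) :
    ScaleModel M τ ((K.twisted θ Φ.a r T).comp Φ.e.symm.toAddMonoidHom) K.Q K.G T₃ := by
  have hKn := hF.n_eq
  have hX := K.X_pos
  have he := K.eps_pos
  have hC := hF.C_ge
  have hM0 : 0 < M := by linarith
  have hQ : ∀ t ≤ T₃, 16 * K.Q t ≤ K.y n := fun t ht => by
    have := hM.le_y
    rw [hKn] at this
    linarith [K.Q_mono (show t ≤ T₃ + τ₀ by omega)]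
  have hQK : ∀ t ≤ T₃, 16 * K.Q t ≤ K.y K.n := fun t ht => hKn.symm ▸ hQ t ht
  have hθ : ∀ i < n, |θ i| ≤ K.X / K.y (i + 2) := by
    intro i hi
    refine ((hM.adm T₃ le_rfl).1 i (by rw [hM.k_eq, hKn]; exact hi)).trans ?_
    have := K.y_add_two_pos (hKn.symm ▸ hi)
    have := K.eps_le
    gcongr
    nlinarith
  have hQ4 : K.Q (T₃ + τ₀) = 4 ^ τ₀ * K.Q T₃ := by unfold Chain.Q; rw [pow_add]; ring
  refine ⟨hM.one_le, fun t ht v hv hs => ?_, fun t ht => ?_, K.G_pos, fun t ht => ?_, ?_⟩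
  · by_contra! hlt
    obtain ⟨u, rfl⟩ := Φ.e.surjective v
    have hu0 : u ≠ 0 := by rintro rfl; simp at hv
    change M * ‖K.twisted θ Φ.a r T (Φ.e.symm (Φ.e u))‖ < _ at hlt
    rw [AddEquiv.symm_apply_apply] at hlt
    have hform : ∀ i < n,
        |K.form θ (twistLong r T u) (twistCol u) (twistRow r T u) i| * K.h i <
          K.eps / 16 * K.G t := by
      intro i hi
      refine (hF.abs_form_mul_le u hi).trans_lt ?_
      rw [div_le_iff₀ he] at hMC
      have h0 : 0 ≤ ‖K.twisted θ Φ.a r T u‖ := norm_nonneg _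
      have h1 := mul_le_mul_of_nonneg_right hMC h0
      have h2 := mul_lt_mul_of_pos_right hlt he
      linarith
    have hGh := fun i (hi : i < n) => K.G_le_h (hQK t ht.le) (hKn.symm ▸ hi)
    have hcmp := (hF.compare hn hθ (twist_coords r T u) fun i hi => by
      have h1 := hform i hi
      have h2 := K.h_pos i
      have h3 := hGh i hi
      have h4 := K.eps_le
      have h5 := K.G_pos t
      by_contra! h6
      nlinarith).2
    have hsize : K.size (twistLong r T u) (twistCol u) ≤ 4 * K.Q t := by
      refine hcmp.trans ?_
      have := mul_le_mul_of_nonneg_right hMC' (inorm_nonneg (Φ.e u).1)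
      linarith
    obtain ⟨z0, z1, z2, z3⟩ := hM.low t ht _ _ _ hsize (fun i hi => hform i (hKn ▸ hi))
    exact hu0 (eq_zero_of_coords hn z0 z1 z2 (fun i hi => z3 i (hKn.symm ▸ hi)))
  · obtain ⟨c₀, c, d, hne, hs, hf⟩ := Chain.exists_small (hQK t ht) (hM.adm t ht)
    rw [hKn] at hf hne
    have hG := K.G_anti (Nat.zero_le t) (hQK t ht)
    obtain ⟨u, hu, hFu, hsu⟩ := hF.exists_vector hn hθ c₀ c d hf (fun i hi => by
      linarith [hsmall i hi])
    have hval : ‖K.twisted θ Φ.a r T (Φ.e.symm (Φ.e u))‖ ≤ n * (50 * K.G t) := by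
      rwa [AddEquiv.symm_apply_apply]
    refine ⟨Φ.e u, fun h0 => ?_, ?_, hval.trans ?_⟩
    · have hu0 : Φ.e u ≠ 0 := by
        rw [Ne, AddEquiv.map_eq_zero_iff]
        rintro rfl
        obtain ⟨z0, z1, z2⟩ := hu.eq_of_zero
        rcases hne with h | h | h | ⟨i, hi, h⟩
        · exact h z0
        · exact h z1
        · exact h z2
        · have := hu.eq_coords.2.2.2 i
          rw [if_pos hi] at this
          refine h ?_
          rw [← this]
          simp [twistRow, twistShort, extZero_zero]
      have e1 : Φ.e u = (0, (Φ.e u).2) := Prod.ext h0 rfl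
      have := hy (Φ.e u).2 (fun h => hu0 (by rw [e1, h]; rfl))
      rw [← e1] at this
      have : (n : ℝ) * (50 * K.G t) ≤ n * (50 * K.G 0) := by gcongr
      linarith
    · refine hsu.trans ?_
      have h4 : (1 : ℝ) ≤ 4 ^ τ₀ := one_le_pow₀ (by norm_num)
      have h5 : 4200 ≤ M := by linarith
      have := mul_le_mul_of_nonneg_right h5 (K.Q_pos t).le
      linarith
    · have := mul_le_mul_of_nonneg_right hM2 (K.G_pos t).le
      linarith
  · have h1 := K.G_add_le (t := t) (τ := τ) (hQK _ ht)
    rw [hKn] at h1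
    have h2 : (0 : ℝ) < 8 * M ^ 2 := by positivity
    have h3 := mul_le_mul_of_nonneg_left h1 h2.le
    have h4 := mul_lt_mul_of_pos_right hτ (K.G_pos t)
    linarith
  · have kerv : ∀ (c₀ : ℤ) (c d : ℕ → ℤ), (∀ i < n, K.form θ c₀ c d i = 0) →
        ∃ u : (Fin 3 → ℤ) × (Fin n → ℤ), (∃ d', twist r T u c₀ c d') ∧
          K.twisted θ Φ.a r T u = 0 ∧ inorm (Φ.e u).1 ≤ 7 * K.size c₀ c := by
      intro c₀ c d hf
      obtain ⟨u, hu, h1, h2⟩ := hF.exists_vector hn hθ c₀ c d (b := 0)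
        (fun i hi => by rw [hf i hi]; simp) (fun i _ => by have := K.h_pos i; positivity)
      rw [mul_zero] at h1
      exact ⟨u, ⟨_, hu⟩, norm_le_zero_iff.1 h1, h2⟩
    obtain ⟨c₀, c, d, hc0, hs, hf⟩ := hM.ker
    obtain ⟨c', d', hc1, hc1', -, hf', hs'⟩ := K.exists_column_kernel θ hn hKn.le
    obtain ⟨c'', d'', hc2, hc2', -, hf'', -⟩ := K.exists_column_kernel θ
      (show 1 ≤ n + 1 by omega) (show K.n ≤ n + 1 by omega)
    rw [hKn] at hf hf' hf''
    obtain ⟨u₁, ⟨d₁, t₁⟩, k₁, s₁⟩ := kerv c₀ c d hf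
    obtain ⟨u₂, ⟨d₂, t₂⟩, k₂, s₂⟩ := kerv 0 c' d' hf'
    obtain ⟨u₃, ⟨d₃, t₃⟩, k₃, -⟩ := kerv 0 c'' d'' hf''
    have hQM : 4200 * (4 ^ τ₀ * K.Q T₃) ≤ M * K.Q T₃ := by
      rw [← mul_assoc]
      exact mul_le_mul_of_nonneg_right hM1 (K.Q_pos _).le
    refine ⟨Φ.e u₁, Φ.e u₂, Φ.e u₃, ?_, ?_, ?_, s₁.trans ?_, s₂.trans ?_, fun a b e h => ?_⟩
    · change K.twisted θ Φ.a r T (Φ.e.symm (Φ.e u₁)) = 0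
      rwa [AddEquiv.symm_apply_apply]
    · change K.twisted θ Φ.a r T (Φ.e.symm (Φ.e u₂)) = 0
      rwa [AddEquiv.symm_apply_apply]
    · change K.twisted θ Φ.a r T (Φ.e.symm (Φ.e u₃)) = 0
      rwa [AddEquiv.symm_apply_apply]
    · rw [hQ4] at hs
      linarith
    · have h1 := hM.y_le
      rw [hKn, hQ4] at h1
      rw [abs_of_pos (K.y_pos n (by omega))] at hs'
      have := mul_pos (show (0 : ℝ) < 4 ^ τ₀ by positivity) (K.Q_pos T₃)
      linarith
    · rw [← map_zsmul, ← map_zsmul, ← map_zsmul, ← map_add, ← map_add,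
        AddEquiv.map_eq_zero_iff] at h
      have ht := ((t₁.zsmul a).add (t₂.zsmul b)).add (t₃.zsmul e)
      rw [h] at ht
      obtain ⟨z0, z1, z2⟩ := ht.eq_of_zero
      simp only [mul_zero, add_zero, mul_eq_zero, hc0, or_false] at z0
      subst z0
      simp only [Pi.add_apply, Pi.smul_apply, zero_smul, zero_add, smul_eq_mul] at z1 z2
      have hz : ∀ j < 2, b * c' j + e * c'' j = 0 := by
        intro j hj
        interval_cases j
        · exact z1
        · exact z2
      have hb := hz (n % 2) (Nat.mod_lt _ two_pos)
      rw [show n % 2 = (n + 1 + 1) % 2 by omega, hc2', mul_zero, add_zero,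
        show (n + 1 + 1) % 2 = n % 2 by omega, mul_eq_zero, or_iff_left hc1] at hb
      subst hb
      have he := hz ((n + 1) % 2) (Nat.mod_lt _ two_pos)
      rw [zero_mul, zero_add, mul_eq_zero, or_iff_left hc2] at he
      exact ⟨rfl, rfl, he⟩

end Fits

end

section

open Topology Matrix

namespace IsChainFamily

variable {n : ℕ} {X XA X₁ κ ρ : ℝ} {h : ℕ → ℝ} {K : ℕ → Chain}
  (hK : IsChainFamily n X XA X₁ κ ρ h K)

include hK

theorem tendsto_y_one_div_two : Tendsto (fun T => (K T).y 1 / (K T).y 2) atTop (𝓝 0) := by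
  refine (hK.tendsto_y_div hK.pos.2.2.2.2.2.1).inv_tendsto_atTop.congr fun T => ?_
  simp [inv_div]

theorem tendsto_natCast_mul_shift {θ : ℕ → ℕ → ℝ}
    (hθ : ∀ᶠ T in atTop, ∀ i < n, |θ T i| ≤ X / (K T).y (i + 2)) {i : ℕ} (hi : i < n) :
    Tendsto (fun T : ℕ => (T : ℝ) * θ T i) atTop (𝓝 0) := by
  obtain ⟨hX, hXA, hX₁, -⟩ := hK.pos
  have h0 := hK.tendsto_y_one_div_two.const_mul (X / X₁)
  rw [mul_zero] at h0
  refine squeeze_zero_norm' ?_ h0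
  filter_upwards [hθ, hK.fields, eventually_gt_atTop 0] with T hT ⟨h1, h2, h3, h4, h5, h6⟩ hT0
  have hT0' : (0 : ℝ) < T := by exact_mod_cast hT0
  have hy2 := (K T).y_pos 2 (by omega)
  rw [Real.norm_eq_abs, abs_mul, abs_of_pos hT0', h4]
  calc (T : ℝ) * |θ T i| ≤ T * (X / (K T).y (i + 2)) := by gcongr; exact hT i hi
    _ ≤ T * (X / (K T).y 2) := by
      gcongr
      exact (K T).y_mono (by omega) (by omega)
    _ = _ := by field_simp

theorem tendsto_inv_parityProd {i : ℕ} (hi : i < n) :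
    Tendsto (fun T => ((parityProd (K T).s i : ℕ) : ℝ)⁻¹) atTop (𝓝 0) := by
  refine squeeze_zero_norm' ?_ hK.tendsto_y_one_div_two
  filter_upwards [hK.fields] with T ⟨h1, _⟩
  have h := (K T).y_mod_mul_den i
  have hd := (K T).den_pos i
  have h2 := (K T).y_pos 2 (by omega)
  have h3 := (K T).y_pos 1 (by omega)
  have hm : (K T).y (i % 2) ≤ (K T).y 1 :=
    (K T).y_mono (by omega) (by omega)
  have hm' : (K T).y 2 ≤ (K T).y (i + 2) := (K T).y_mono (by omega) (by omega)
  rw [Real.norm_eq_abs, abs_of_pos (inv_pos.2 hd), le_div_iff₀ h2, inv_mul_le_iff₀ hd]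
  rw [← h] at hm'
  nlinarith

theorem tendsto_form {θ : ℕ → ℕ → ℝ}
    (hθ : ∀ᶠ T in atTop, ∀ i < n, |θ T i| ≤ X / (K T).y (i + 2)) (r : ℕ)
    (u : (Fin 3 → ℤ) × (Fin n → ℤ)) {i : ℕ} (hi : i < n) :
    Tendsto (fun T => (K T).form (θ T) (twistLong r T u) (twistCol u) (twistRow r T u) i -
      twistRow r T u i) atTop (𝓝 0) := by
  have h1 := (hK.tendsto_inv_parityProd hi).const_mul (twistCol u (i % 2) : ℝ)
  have h2 := hK.tendsto_natCast_mul_shift hθ hi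
  have h3 : Tendsto (fun T : ℕ => (T : ℝ)⁻¹) atTop (𝓝 0) := tendsto_inv_atTop_nhds_zero_nat
  have h4 : Tendsto (fun T : ℕ => (-1 : ℝ) ^ (r + 1) * ((Nat.fib r * u.1 0 -
      Nat.fib (r + 1) * u.1 1) * (T : ℝ)⁻¹ - Nat.fib (r + 1) * extZero u.2 0)) atTop
      (𝓝 ((-1 : ℝ) ^ (r + 1) * ((Nat.fib r * u.1 0 -
      Nat.fib (r + 1) * u.1 1) * 0 - Nat.fib (r + 1) * extZero u.2 0))) :=
    ((h3.const_mul _).sub_const _).const_mul _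
  have h5 := h1.add (h4.mul h2)
  rw [mul_zero, mul_zero, add_zero] at h5
  refine h5.congr' ?_
  filter_upwards [eventually_gt_atTop 0] with T hT
  have hT0 : (T : ℝ) ≠ 0 := by exact_mod_cast hT.ne'
  simp only [Chain.form, twistLong]
  push_cast
  field_simp
  ring

theorem tendsto_twisted {θ : ℕ → ℕ → ℝ}
    (hθ : ∀ᶠ T in atTop, ∀ i < n, |θ T i| ≤ X / (K T).y (i + 2)) (r : ℕ)
    (a : Fin n → Fin n → ℝ) (u : (Fin 3 → ℤ) × (Fin n → ℤ)) :
    Tendsto (fun T => (K T).twisted (θ T) a r T u) atTop (𝓝 (∑ i, (u.2 i : ℝ) • a i)) := by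
  simp only [Chain.twisted_apply]
  refine tendsto_finsetSum _ fun i _ => ?_
  have hf := hK.tendsto_form hθ r u i.2
  have h3 : Tendsto (fun T : ℕ => (T : ℝ)⁻¹) atTop (𝓝 0) := tendsto_inv_atTop_nhds_zero_nat
  simp only [Chain.row, smul_smul]
  refine Tendsto.smul_const ?_ _
  by_cases h0 : (i : ℕ) = 0
  · simp only [h0, if_true] at hf ⊢
    have hF : (Nat.fib (r + 2) : ℝ) ≠ 0 := by exact_mod_cast (Nat.fib_pos.2 (by omega)).ne'
    have hs : ((-1 : ℝ) ^ (r + 1)) * (-1) ^ (r + 1) = 1 := by rw [← mul_pow]; simp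
    have h4 := ((hf.mul h3).const_mul ((-1 : ℝ) ^ (r + 1) / Nat.fib (r + 2))).add
      ((h3.const_mul ((Nat.fib (r + 2) * u.1 1 - Nat.fib (r + 1) * u.1 0 : ℝ) /
        Nat.fib (r + 2))).add_const (u.2 i : ℝ))
    rw [mul_zero, mul_zero, mul_zero, zero_add, zero_add] at h4
    refine h4.congr' ?_
    filter_upwards [eventually_gt_atTop 0] with T hT
    have hT0 : (T : ℝ) ≠ 0 := by exact_mod_cast hT.ne'
    have e1 : (twistRow r T u 0 : ℝ) = (-1) ^ (r + 1) * (Nat.fib (r + 2) * (u.1 1 + T * u.2 i) -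
        Nat.fib (r + 1) * u.1 0) := by
      have : extZero u.2 0 = u.2 i := by rw [← h0, extZero_coe]
      simp only [twistRow, if_true, twistShort, this]
      push_cast
      ring
    rw [e1]
    field_simp
    linear_combination (Nat.fib (r + 1) * u.1 0 - Nat.fib (r + 2) * u.1 1
      - (T : ℝ) * Nat.fib (r + 2) * u.2 i) * hs
  · simp only [h0, if_false, mul_one]
    have h4 := hf.add_const (u.2 i : ℝ)
    rw [zero_add] at h4
    refine h4.congr fun T => ?_
    simp [twistRow, h0, extZero_coe]

theorem tendsto_natCast_smul_twisted (hn : 1 ≤ n) {θ : ℕ → ℕ → ℝ}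
    (hθ : ∀ᶠ T in atTop, ∀ i < n, |θ T i| ≤ X / (K T).y (i + 2)) (r : ℕ)
    (a : Fin n → Fin n → ℝ) {γ : Fin 3 → ℤ} (hγ : γ 2 = 0) :
    Tendsto (fun T : ℕ => (T : ℝ) • (K T).twisted (θ T) a r T (γ, 0)) atTop
      (𝓝 (((Nat.fib (r + 2) * γ 1 - Nat.fib (r + 1) * γ 0 : ℝ) / Nat.fib (r + 2)) •
        a ⟨0, hn⟩)) := by
  have hs : ((-1 : ℝ) ^ (r + 1)) * (-1) ^ (r + 1) = 1 := by rw [← mul_pow]; simp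
  have hF : (Nat.fib (r + 2) : ℝ) ≠ 0 := by exact_mod_cast (Nat.fib_pos.2 (by omega)).ne'
  have hcol : ∀ j, twistCol ((γ, 0) : (Fin 3 → ℤ) × (Fin n → ℤ)) j = 0 := fun j => by
    simp [twistCol, extZero_zero, hγ]
  have e : ∑ i : Fin n, (if (i : ℕ) = 0 then
      ((Nat.fib (r + 2) * γ 1 - Nat.fib (r + 1) * γ 0 : ℝ) / Nat.fib (r + 2)) else 0) • a i =
      ((Nat.fib (r + 2) * γ 1 - Nat.fib (r + 1) * γ 0 : ℝ) / Nat.fib (r + 2)) • a ⟨0, hn⟩ := by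
    rw [Finset.sum_eq_single ⟨0, hn⟩]
    · simp
    · intro i _ hi
      rw [if_neg (fun h => hi (Fin.ext h)), zero_smul]
    · simp
  rw [← e]
  simp only [Chain.twisted_apply, Finset.smul_sum, Chain.row, smul_smul]
  refine tendsto_finsetSum _ fun i _ => Tendsto.smul_const ?_ _
  have h2 := hK.tendsto_natCast_mul_shift hθ i.2
  have h3 : Tendsto (fun T : ℕ => (T : ℝ)⁻¹) atTop (𝓝 0) := tendsto_inv_atTop_nhds_zero_nat
  set c₀ : ℝ := (-1) ^ (r + 1) * (Nat.fib r * γ 0 - Nat.fib (r + 1) * γ 1) with hc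
  have hl : ∀ T, (twistLong r T ((γ, 0) : (Fin 3 → ℤ) × (Fin n → ℤ)) : ℝ) = c₀ := fun T => by
    simp [twistLong, extZero_zero, hc]
  simp only [Chain.form, hcol, hl]
  by_cases h0 : (i : ℕ) = 0
  · simp only [h0, if_true] at h2 ⊢
    have h4 := ((h2.mul h3).const_mul (c₀ * (-1) ^ (r + 1) / Nat.fib (r + 2))).add_const
      ((Nat.fib (r + 2) * γ 1 - Nat.fib (r + 1) * γ 0 : ℝ) / Nat.fib (r + 2))
    rw [mul_zero, mul_zero, zero_add] at h4
    refine h4.congr' ?_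
    filter_upwards [eventually_gt_atTop 0] with T hT
    have hT0 : (T : ℝ) ≠ 0 := by exact_mod_cast hT.ne'
    have e1 : (twistRow r T ((γ, 0) : (Fin 3 → ℤ) × (Fin n → ℤ)) 0 : ℝ) = (-1) ^ (r + 1) *
        (Nat.fib (r + 2) * γ 1 - Nat.fib (r + 1) * γ 0) := by
      simp [twistRow, twistShort, extZero_zero]
    rw [e1]
    simp only [Int.cast_zero, zero_div, add_zero]
    field_simp
    linear_combination (Nat.fib (r + 1) * γ 0 - Nat.fib (r + 2) * γ 1 : ℝ) * hs
  · simp only [h0, if_false]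
    have h4 := h2.const_mul c₀
    rw [mul_zero] at h4
    refine h4.congr fun T => ?_
    have e1 : (twistRow r T ((γ, 0) : (Fin 3 → ℤ) × (Fin n → ℤ)) i : ℝ) = 0 := by
      simp [twistRow, h0, extZero_zero]
    rw [e1]
    simp only [Int.cast_zero, zero_div, add_zero]
    ring

end IsChainFamily

theorem eventually_norm_mulVec_sub_le {n : ℕ} {A : ℕ → Matrix (Fin n) (Fin n) ℝ}
    (hA : Tendsto A atTop (𝓝 1)) {η : ℝ} (hη : 0 < η) :
    ∀ᶠ T in atTop, ∀ v : Fin n → ℝ, ‖A T *ᵥ v - v‖ ≤ η * ‖v‖ := by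
  have hη' : 0 < η / (n + 1) := by positivity
  have h : ∀ i j, ∀ᶠ T in atTop, |A T i j - (1 : Matrix (Fin n) (Fin n) ℝ) i j| ≤ η / (n + 1) := by
    intro i j
    have h1 := (tendsto_pi_nhds.1 (tendsto_pi_nhds.1 hA i) j).sub_const
      ((1 : Matrix (Fin n) (Fin n) ℝ) i j)
    rw [sub_self] at h1
    have h2 := h1.abs
    rw [abs_zero] at h2
    exact h2.eventually_le_const hη'
  filter_upwards [eventually_all.2 fun i => eventually_all.2 fun j => h i j] with T hT v
  have e : A T *ᵥ v - v = (A T - 1) *ᵥ v := by rw [sub_mulVec, one_mulVec]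
  rw [e, pi_norm_le_iff_of_nonneg (by positivity)]
  intro i
  rw [mulVec, dotProduct, Real.norm_eq_abs]
  refine (Finset.abs_sum_le_sum_abs _ _).trans ?_
  calc ∑ j, |(A T - 1) i j * v j| ≤ ∑ j : Fin n, η / (n + 1) * ‖v‖ := by
        refine Finset.sum_le_sum fun j _ => ?_
        rw [abs_mul]
        exact mul_le_mul (hT i j) (norm_le_pi_norm v j) (abs_nonneg _) hη'.le
    _ = n / (n + 1) * (η * ‖v‖) := by
        rw [Finset.sum_const, Finset.card_univ, Fintype.card_fin, nsmul_eq_mul]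
        ring
    _ ≤ 1 * (η * ‖v‖) := by
        gcongr
        rw [div_le_one (by positivity)]
        linarith
    _ = _ := one_mul _

/-- Additive maps converging pointwise to a residue map are close to residue maps of nearby
matrices. -/
theorem exists_realization {m n : ℕ} {ξ : Matrix (Fin n) (Fin m) ℝ}
    {F : ℕ → (Fin m → ℤ) × (Fin n → ℤ) →+ (Fin n → ℝ)}
    (hF : ∀ v, Tendsto (fun T => F T v) atTop (𝓝 (resHom ξ v))) :
    ∃ (A : ℕ → Matrix (Fin n) (Fin n) ℝ) (Ξ : ℕ → Matrix (Fin n) (Fin m) ℝ),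
      Tendsto A atTop (𝓝 1) ∧ Tendsto Ξ atTop (𝓝 ξ) ∧
      ∀ᶠ T in atTop, ∀ v, resHom (Ξ T) v = A T *ᵥ F T v := by
  set P : ℕ → Matrix (Fin n) (Fin n) ℝ := fun T => Matrix.of fun i k => -F T (0, Pi.single k 1) i
    with hP
  set N : ℕ → Matrix (Fin n) (Fin m) ℝ := fun T => Matrix.of fun i j => F T (Pi.single j 1, 0) i
    with hN
  have hP1 : Tendsto P atTop (𝓝 1) := by
    refine tendsto_pi_nhds.2 fun i => tendsto_pi_nhds.2 fun k => ?_
    have h := (tendsto_pi_nhds.1 (hF (0, Pi.single k 1)) i).neg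
    have e : (1 : Matrix (Fin n) (Fin n) ℝ) i k = -resHom ξ (0, Pi.single k 1) i := by
      simp [resHom, mulVec, dotProduct, Matrix.one_apply, Pi.single_apply]
    rw [e]
    exact h
  have hN1 : Tendsto N atTop (𝓝 ξ) := by
    refine tendsto_pi_nhds.2 fun i => tendsto_pi_nhds.2 fun j => ?_
    have h := tendsto_pi_nhds.1 (hF (Pi.single j 1, 0)) i
    have e : ξ i j = resHom ξ (Pi.single j 1, 0) i := by
      simp [resHom, mulVec, dotProduct, Pi.single_apply]
    rw [e]
    exact h
  have hdet : Tendsto (fun T => (P T).det) atTop (𝓝 1) := by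
    have := ((continuous_id (X := Matrix (Fin n) (Fin n) ℝ)).matrix_det.tendsto 1).comp hP1
    simpa [Function.comp_def] using this
  have hinv : Tendsto (fun T => (P T)⁻¹) atTop (𝓝 1) := by
    have h1 : Tendsto (fun T => (P T).adjugate) atTop (𝓝 1) := by
      have := ((continuous_id (X := Matrix (Fin n) (Fin n) ℝ)).matrix_adjugate.tendsto 1).comp hP1
      simpa [Function.comp_def] using this
    have h2 := (hdet.inv₀ one_ne_zero).smul h1
    rw [inv_one, one_smul] at h2
    refine h2.congr fun T => ?_
    rw [Matrix.inv_def, Ring.inverse_eq_inv']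
  refine ⟨fun T => (P T)⁻¹, fun T => (P T)⁻¹ * N T, hinv, ?_, ?_⟩
  · have := ((continuous_fst (X := Matrix (Fin n) (Fin n) ℝ)
      (Y := Matrix (Fin n) (Fin m) ℝ)).matrix_mul continuous_snd).tendsto (1, ξ)
    have := this.comp (hinv.prodMk_nhds hN1)
    simpa [Function.comp_def] using this
  · filter_upwards [hdet.eventually_ne one_ne_zero] with T hT v
    have key : F T v = N T *ᵥ (fun j => (v.1 j : ℝ)) - P T *ᵥ (fun k => (v.2 k : ℝ)) := by
      have e : v = ∑ j, v.1 j • ((Pi.single j 1, 0) : (Fin m → ℤ) × (Fin n → ℤ)) +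
          ∑ k, v.2 k • ((0, Pi.single k 1) : (Fin m → ℤ) × (Fin n → ℤ)) := by
        refine Prod.ext ?_ ?_
        · ext l
          simp [Prod.fst_sum, Finset.sum_apply, Pi.single_apply]
        · ext l
          simp [Prod.snd_sum, Finset.sum_apply, Pi.single_apply]
      conv_lhs => rw [e, map_add, map_sum, map_sum]
      simp only [map_zsmul]
      ext i
      simp [hP, hN, mulVec, dotProduct, Finset.sum_apply, mul_comm]
    have hu : IsUnit (P T).det := isUnit_iff_ne_zero.2 hT
    rw [key, mulVec_sub, mulVec_mulVec, mulVec_mulVec, Matrix.nonsing_inv_mul _ hu, one_mulVec]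
    rfl

theorem Chain.G_zero (K : Chain) : K.G 0 = 2 * (K.h 0 / K.s 0) := by
  have h := K.G_pow 0
  have hX := K.X_pos
  rw [K.k_zero, pow_one] at h
  simp only [Chain.Q, Chain.P, Chain.lam, pow_zero, one_mul, Finset.prod_range_one] at h
  have h2 : K.G 0 * (K.X / 2) = 2 * (K.h 0 / K.s 0) * (K.X / 2) := by rw [h]; ring
  exact mul_right_cancel₀ (by positivity) h2

theorem Chain.Model.abs_le {K : Chain} {θ : ℕ → ℝ} {T τ : ℕ} (hM : K.Model θ T τ) {i : ℕ}
    (hi : i < K.n) : |θ i| ≤ K.X / K.y (i + 2) := by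
  refine ((hM.adm T le_rfl).1 i (hM.k_eq ▸ hi)).trans ?_
  have := K.y_add_two_pos hi
  have := K.eps_le
  have := K.X_pos
  gcongr
  nlinarith

theorem exists_fib_between {x z : ℝ} (hx : 0 < x) (hxz : x ≤ z) :
    ∃ r : ℕ, Nat.fib (r + 2) * x ≤ z ∧ z < Nat.fib (r + 3) * x := by
  have hex : ∃ r : ℕ, z < Nat.fib (r + 3) * x := by
    obtain ⟨N, hN⟩ := exists_nat_gt (z / x)
    refine ⟨N + 2, ?_⟩
    rw [div_lt_iff₀ hx] at hN
    have h1 : N + 5 ≤ Nat.fib (N + 5) := Nat.le_fib_self (by omega)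
    have h2 : (N : ℝ) ≤ Nat.fib (N + 2 + 3) := by exact_mod_cast (by omega : N ≤ N + 5).trans h1
    exact hN.trans_le (by gcongr)
  classical
  refine ⟨Nat.find hex, ?_, Nat.find_spec hex⟩
  rcases h : Nat.find hex with _ | k
  · simpa using hxz
  · have := Nat.find_min hex (show k < Nat.find hex by omega)
    rwa [not_lt] at this

/-- A family of additive maps converging to the residue map of `ξ`, all of which are scale models,
with prescribed exponents and with prescribed first order behaviour along the plane spanned by the
first two kernel vectors. -/
structure IsScaleFamily {n : ℕ} (hn : 1 ≤ n) {C : ℝ} {ξ : Matrix (Fin n) (Fin 3) ℝ}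
    (Φ : Frame C ξ) (r : ℕ) (M : ℝ) (τ : ℕ) (w : ℝ)
    (F : ℕ → (Fin 3 → ℤ) × (Fin n → ℤ) →+ (Fin n → ℝ)) (Q : ℕ → ℝ) (G : ℕ → ℕ → ℝ)
    (S : ℕ → ℕ) : Prop where
  fib_le : Nat.fib (r + 2) * Φ.X₀ ≤ Φ.Z
  lt_fib : Φ.Z < Nat.fib (r + 3) * Φ.X₀
  Q_eq : ∀ t, Q t = 4 ^ t * (Nat.fib (r + 2) * Φ.X₀ / 2)
  model : ∀ᶠ T in atTop, ScaleModel M τ (F T) Q (G T) (S T)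
  tendsto : ∀ v, Tendsto (fun T => F T v) atTop (𝓝 (resHom ξ v))
  plane : ∀ γ : Fin 3 → ℤ, γ 2 = 0 →
    Tendsto (fun T : ℕ => (T : ℝ) • F T (Φ.e (γ, 0))) atTop
      (𝓝 (((Nat.fib (r + 2) * γ 1 - Nat.fib (r + 1) * γ 0 : ℝ) / Nat.fib (r + 2)) • Φ.a ⟨0, hn⟩))
  upper : ∀ ε > 0, ∀ D > 0, ∀ᶠ T in atTop, ∀ t ≤ S T, D * G T t * (D * Q t) ^ (w - ε) < 1
  lower : ∀ ε > 0, ∀ D > 0, ∀ᶠ T in atTop, D < G T (S T - 1) * (Q (S T - 1) / D) ^ (w + ε)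
  tendsto_S : Tendsto S atTop atTop

theorem eventually_quarter_le_norm {n m : ℕ} {ξ : Matrix (Fin n) (Fin m) ℝ}
    {F : ℕ → (Fin m → ℤ) × (Fin n → ℤ) →+ (Fin n → ℝ)}
    (hF : ∀ v, Tendsto (fun T => F T v) atTop (𝓝 (resHom ξ v))) :
    ∀ᶠ T in atTop, ∀ y : Fin n → ℤ, y ≠ 0 → 1 / 4 ≤ ‖F T (0, y)‖ := by
  obtain ⟨A, Ξ, hA, -, hres⟩ := exists_realization hF
  filter_upwards [hres, eventually_norm_mulVec_sub_le hA one_pos] with T h1 h2 y hy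
  have h3 : ‖resHom (Ξ T) (0, y)‖ = inorm y := by
    rw [resHom_fst_zero, ← norm_neg]
    unfold inorm
    congr 1
    ext k
    simp
  have h4 := one_le_inorm hy
  have h5 := h2 (F T (0, y))
  rw [← h1] at h5
  have h6 := norm_le_norm_add_norm_sub' (resHom (Ξ T) (0, y)) (F T (0, y))
  linarith

theorem exists_scale_family {n : ℕ} (hn : 1 ≤ n) {C : ℝ} (hC : 1 ≤ C) : ∃ (M : ℝ) (τ : ℕ), 1 ≤ M ∧
    ∀ (ξ : Matrix (Fin n) (Fin 3) ℝ) (Φ : Frame C ξ) (w : ℝ), 3 < n * w → (n - 1) * w < 3 →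
      ∃ r F Q G S, IsScaleFamily hn Φ r M τ w F Q G S := by
  obtain ⟨τ₀, R, hR, hmodel⟩ := Chain.exists_model n hn
  set eps : ℝ := 1 / (8192 * (n + 1).factorial) with heps
  obtain ⟨M, hM⟩ : ∃ M, M = max (max (16 * C / eps) C) (max (4200 * 4 ^ τ₀) (50 * n : ℝ)) :=
    ⟨_, rfl⟩
  have hM1 : 16 * C / eps ≤ M := hM ▸ (le_max_left _ _).trans (le_max_left _ _)
  have hM2 : C ≤ M := hM ▸ (le_max_right _ _).trans (le_max_left _ _)
  have hM3 : 4200 * 4 ^ τ₀ ≤ M := hM ▸ (le_max_left _ _).trans (le_max_right _ _)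
  have hM4 : 50 * n ≤ M := hM ▸ (le_max_right _ _).trans (le_max_right _ _)
  have hM0 : 0 < M := by linarith
  have hn0 : (0 : ℝ) < n := by exact_mod_cast hn
  obtain ⟨τ, hτ⟩ := exists_pow_lt_of_lt_one
    (show (0 : ℝ) < 1 / (8 * M ^ 2) by positivity)
    (show ((1 / 4 : ℝ) ^ (1 / (n : ℝ))) < 1 from
      Real.rpow_lt_one (by norm_num) (by norm_num) (by positivity))
  rw [lt_div_iff₀ (by positivity), mul_comm] at hτ
  refine ⟨M, τ, hC.trans hM2, fun ξ Φ w hw1 hw2 => ?_⟩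
  obtain ⟨p, rfl⟩ : ∃ p, n = p + 1 := ⟨n - 1, by omega⟩
  obtain ⟨ρ, hρ1, hρ2, hρ3⟩ := exists_growthExp p ((p + 1 : ℕ) * w - 2) (by linarith) (by
    push_cast at hw2 ⊢
    have : (0 : ℝ) ≤ p := Nat.cast_nonneg p
    nlinarith)
  have hwr : (2 + (((p + 1 : ℕ) : ℝ) * w - 2)) / (p + 1) = w := by
    push_cast
    field_simp
    ring
  rw [hwr] at hρ3
  have hX₀ : 0 < Φ.X₀ := Φ.X₁_pos.trans_le Φ.X₁_le
  obtain ⟨r, hr1, hr2⟩ := exists_fib_between hX₀ Φ.X₀_le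
  have hfib : (0 : ℝ) < Nat.fib (r + 2) := by exact_mod_cast Nat.fib_pos.2 (by omega)
  set X : ℝ := Nat.fib (r + 2) * Φ.X₀ with hXdef
  have hX : 0 < X := by positivity
  have hZ2 : Φ.Z ≤ 2 * X := by
    have : (Nat.fib (r + 3) : ℝ) ≤ 2 * Nat.fib (r + 2) := by
      have h1 : Nat.fib (r + 3) = Nat.fib (r + 1) + Nat.fib (r + 2) := Nat.fib_add_two
      have h2 : Nat.fib (r + 1) ≤ Nat.fib (r + 2) := Nat.fib_mono (by omega)
      exact_mod_cast (by omega : Nat.fib (r + 3) ≤ 2 * Nat.fib (r + 2))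
    nlinarith
  set κ : ℝ := ‖Φ.a ⟨0, hn⟩‖ / Nat.fib (r + 2) with hκdef
  have hκ : 0 < κ := div_pos (Φ.a_pos _) hfib
  set h : ℕ → ℝ := fun i => if hi : i < p + 1 then ‖Φ.a ⟨i, hi⟩‖ else 1 with hhdef
  have hh : ∀ i, 0 < h i := fun i => by
    simp only [hhdef]
    split
    · exact Φ.a_pos _
    · exact one_pos
  obtain ⟨K, hK1, hK2, hK3⟩ := exists_chain_family hn hX hr1 hZ2 Φ.X₁_pos hκ hh
    (ρ := ρ) (fun j hj => hρ1 j hj)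
  have hK : IsChainFamily (p + 1) X Φ.Z Φ.X₁ κ ρ h K :=
    ⟨hK1, hK2, hK3, ⟨hX, hX.trans_le hr1, Φ.X₁_pos, hκ, by
      have := hρ1 1 (by omega)
      simp only [growthExp] at this
      linarith, hn, hh⟩, fun j hj => hρ1 j hj⟩
  obtain ⟨B, hB, hsnd⟩ := Φ.exists_inorm_snd_le
  have hfits : ∀ᶠ T in atTop, Fits Φ B r T (K T) := by
    filter_upwards [hK1, eventually_gt_atTop 0,
      (hK.tendsto_y 0).eventually_ge_atTop (32 * C * (Nat.fib (r + 1) * Φ.X₀)),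
      (hK.tendsto_y 0).eventually_ge_atTop (32 * C * ((p + 1 : ℕ) * B))] with
      T ⟨h1, h2, h3, h4, h5, h6⟩ hT h7 h8
    refine ⟨h1, hC, hB, hsnd, hT, h2, h3, h4, fun i => ?_, h7, h8⟩
    rw [Chain.row, norm_smul]
    rcases i with ⟨_ | i, hi⟩
    · have : (0 : ℝ) < T := by exact_mod_cast hT
      rw [h5, if_pos rfl, Real.norm_eq_abs, abs_div, abs_pow, abs_neg, abs_one, one_pow,
        abs_of_pos (by positivity), hκdef]
      field_simp
    · rw [h6, if_neg (by simp), norm_one, one_mul]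
      exact dif_pos hi
  have hex : ∀ᶠ T in atTop, ∃ θ S, (K T).Model θ S τ₀ := by
    filter_upwards [hK1, (hK.tendsto_y_div (show p ≤ p + 1 by omega)).eventually_ge_atTop R] with
      T ⟨h1, _⟩ h2
    refine hmodel (K T) h1 ?_
    rwa [le_div_iff₀ ((K T).y_pos p (by omega))] at h2
  have hex' : ∀ T, ∃ θ S, (∃ θ S, (K T).Model θ S τ₀) → (K T).Model θ S τ₀ := fun T => by
    by_cases h : ∃ θ S, (K T).Model θ S τ₀
    · obtain ⟨θ, S, h'⟩ := h
      exact ⟨θ, S, fun _ => h'⟩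
    · exact ⟨0, 0, fun h' => absurd h' h⟩
  choose θ S hθS using hex'
  have hmod : ∀ᶠ T in atTop, (K T).Model (θ T) (S T) τ₀ := hex.mono fun T hT => hθS T hT
  have hθ : ∀ᶠ T in atTop, ∀ i < p + 1, |θ T i| ≤ X / (K T).y (i + 2) := by
    filter_upwards [hK1, hmod] with T ⟨h1, h2, _⟩ hm i hi
    rw [← h2]
    exact hm.abs_le (h1.symm ▸ hi)
  set F : ℕ → (Fin 3 → ℤ) × (Fin (p + 1) → ℤ) →+ (Fin (p + 1) → ℝ) :=
    fun T => ((K T).twisted (θ T) Φ.a r T).comp Φ.e.symm.toAddMonoidHom with hF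
  have hFe : ∀ T u, F T (Φ.e u) = (K T).twisted (θ T) Φ.a r T u := fun T u => by
    change (K T).twisted (θ T) Φ.a r T (Φ.e.symm (Φ.e u)) = _
    rw [AddEquiv.symm_apply_apply]
  have htend : ∀ v, Tendsto (fun T => F T v) atTop (𝓝 (resHom ξ v)) := by
    intro v
    obtain ⟨⟨γ, δ⟩, rfl⟩ := Φ.e.surjective v
    rw [Φ.res_eq]
    simp only [hFe]
    exact hK.tendsto_twisted hθ r Φ.a (γ, δ)
  have hQ : ∀ᶠ T in atTop, (K T).Q = fun t => 4 ^ t * (X / 2) := by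
    filter_upwards [hK1] with T ⟨_, h2, _⟩
    ext t
    rw [Chain.Q, h2]
  have hG0 : Tendsto (fun T => (K T).G 0) atTop (𝓝 0) := by
    have h1 := (((tendsto_inv_atTop_nhds_zero_nat (𝕜 := ℝ)).mul
      hK3.inv_tendsto_atTop).const_mul (2 * κ))
    rw [mul_zero, mul_zero] at h1
    refine h1.congr' ?_
    filter_upwards [hK1] with T ⟨_, _, _, _, h5, _⟩
    rw [Chain.G_zero, h5, Pi.inv_apply]
    simp only [div_eq_mul_inv]
    ring
  have hyn : Tendsto (fun T => (K T).y (p + 1)) atTop atTop := hK.tendsto_y p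
  have hle : ∀ᶠ T in atTop, ∀ t ≤ S T, 16 * (K T).Q t ≤ (K T).y (p + 1) := by
    filter_upwards [hK1, hmod] with T ⟨h1, _⟩ hm t ht
    have := hm.le_y
    rw [h1] at this
    linarith [(K T).Q_mono (show t ≤ S T + τ₀ by omega)]
  refine ⟨r, F, fun t => 4 ^ t * (X / 2), fun T => (K T).G, S, hr1, hr2, fun t => rfl, ?_, htend,
    fun γ hγ => ?_, fun ε hε D hD => ?_, fun ε hε D hD => ?_, ?_⟩
  · filter_upwards [hK1, hfits, hmod, eventually_quarter_le_norm htend, hQ,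
      hG0.eventually_lt_const (show (0 : ℝ) < 1 / (4 * ((p + 1 : ℕ) * 50)) by positivity),
      eventually_all.2 fun i : Fin (p + 1) => hG0.eventually_lt_const
        (show 0 < h i / 100 from div_pos (hh i) (by norm_num)),
      hK3.eventually_ge_atTop 200] with T ⟨h1, h2, h3, h4, h5, h6⟩ hf hm hy hq hg hg' hs
    rw [← hq]
    have he : (K T).eps = eps := by rw [Chain.eps, h1]
    refine hf.scaleModel hn hm (by rwa [he]) hM2 hM3 hM4 (by linarith) (fun i hi => ?_) ?_
      fun y hy0 => hy y hy0
    · rcases i with _ | i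
      · have h7 := (K T).h_pos 0
        rw [Chain.G_zero]
        have h8 : (K T).h 0 / (K T).s 0 ≤ (K T).h 0 / 200 := by gcongr
        linarith
      · have := hg' ⟨i + 1, hi⟩
        rw [h6]
        simp only at this
        linarith
    · rw [lt_div_iff₀ (by positivity)] at hg
      linarith
  · simp only [hFe]
    exact hK.tendsto_natCast_smul_twisted hn hθ r Φ.a hγ
  · filter_upwards [hK.eventually_G_lt hε hD (fun k h1 h2 => hρ3 k h1 h2), hle, hQ] with T h1 h2 h3
    intro t ht
    have := h1 t (h2 t ht)
    rwa [h3] at this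
  · have hD' : 0 < max D (64 * 4 ^ (τ₀ + 1)) := lt_max_of_lt_left hD
    filter_upwards [hK.eventually_lt_G hε hD' (w := w) (by
      rw [show p + 1 + 1 = p + 2 by rfl, hρ2]
      linarith), hle, hQ, hmod, hK1] with T h1 h2 h3 hm ⟨h4, _⟩
    have hS := hm.one_le
    have h5 := h1 (S T - 1) (by
      have h6 := hm.y_le
      rw [h4] at h6
      refine h6.trans ?_
      have e : (K T).Q (S T + τ₀) = 4 ^ (τ₀ + 1) * (K T).Q (S T - 1) := by
        unfold Chain.Q
        rw [← mul_assoc, ← pow_add]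
        congr 2
        omega
      rw [e, ← mul_assoc]
      have := (K T).Q_pos (S T - 1)
      gcongr
      exact le_max_right _ _) (h2 _ (by omega))
    rw [h3] at h5
    refine (le_max_left _ _).trans_lt (h5.trans_le ?_)
    have := (K T).G_pos (S T - 1)
    have hwε : 0 ≤ w + ε := by
      have : 0 < w := by
        by_contra! hneg
        nlinarith
      linarith
    gcongr
    exact le_max_left _ _
  · rw [tendsto_atTop]
    intro b
    filter_upwards [hyn.eventually_gt_atTop (64 * (4 ^ (b + τ₀) * (X / 2))), hmod, hQ, hK1] with
      T h1 hm hq ⟨h4, _⟩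
    by_contra! hlt
    have h5 := hm.y_le
    rw [h4, hq] at h5
    have h6 : (4 : ℝ) ^ (S T + τ₀) ≤ 4 ^ (b + τ₀) := pow_le_pow_right₀ (by norm_num) (by omega)
    have h7 := mul_le_mul_of_nonneg_right h6 (show 0 ≤ X / 2 by positivity)
    simp only at h5
    linarith

/-- The distance from `ξ x` to the nearest integer point. -/
noncomputable def idist {m n : ℕ} (ξ : Matrix (Fin n) (Fin m) ℝ) (x : Fin m → ℤ) : ℝ :=
  ‖resHom ξ (x, fun i => round ((ξ *ᵥ fun j => (x j : ℝ)) i))‖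

section idist

variable {m n : ℕ} (ξ : Matrix (Fin n) (Fin m) ℝ)

theorem idist_nonneg (x : Fin m → ℤ) : 0 ≤ idist ξ x := norm_nonneg _

theorem exists_idist_eq (x : Fin m → ℤ) : ∃ y, idist ξ x = ‖resHom ξ (x, y)‖ := ⟨_, rfl⟩

theorem idist_le (v : (Fin m → ℤ) × (Fin n → ℤ)) : idist ξ v.1 ≤ ‖resHom ξ v‖ := by
  refine (pi_norm_le_iff_of_nonneg (norm_nonneg _)).2 fun i => ?_
  refine le_trans ?_ (norm_le_pi_norm _ i)
  exact round_le _ _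

theorem idist_eq_of_lt {v : (Fin m → ℤ) × (Fin n → ℤ)} (h : ‖resHom ξ v‖ < 1 / 2) :
    idist ξ v.1 = ‖resHom ξ v‖ := by
  refine le_antisymm (idist_le ξ v) ?_
  obtain ⟨y, hy⟩ := exists_idist_eq ξ v.1
  by_cases hvy : v.2 = y
  · rw [hy, ← hvy]
  · have h1 : resHom ξ v - resHom ξ (v.1, y) = fun k => -((v.2 - y) k : ℝ) := by
      rw [← map_sub, ← Prod.mk.eta (p := v), Prod.mk_sub_mk, sub_self, resHom_fst_zero]
    have h2 : 1 ≤ ‖resHom ξ v - resHom ξ (v.1, y)‖ := by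
      rw [h1]
      refine (one_le_inorm (sub_ne_zero.2 hvy)).trans (le_of_eq ?_)
      rw [inorm, ← norm_neg]
      congr 1
    have := norm_sub_le (resHom ξ v) (resHom ξ (v.1, y))
    have := idist_le ξ v
    rw [hy]
    linarith

theorem isKer_iff_idist {x : Fin m → ℤ} : IsKer ξ x ↔ idist ξ x = 0 := by
  constructor
  · rintro ⟨y, hy⟩
    refine le_antisymm ?_ (idist_nonneg ξ x)
    simpa [hy] using idist_le ξ (x, y)
  · intro h
    exact ⟨_, norm_eq_zero.1 h⟩

theorem continuous_resHom (v : (Fin m → ℤ) × (Fin n → ℤ)) :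
    Continuous fun ξ : Matrix (Fin n) (Fin m) ℝ => resHom ξ v := by
  refine continuous_pi fun i => ?_
  simp only [resHom, AddMonoidHom.coe_mk, ZeroHom.coe_mk, Pi.sub_apply, mulVec, dotProduct]
  refine Continuous.sub (continuous_finsetSum _ fun j _ => ?_) continuous_const
  exact (continuous_id.matrix_elem i j).mul continuous_const

theorem abs_idist_sub_le (ξ ξ' : Matrix (Fin n) (Fin m) ℝ) (x : Fin m → ℤ) :
    |idist ξ' x - idist ξ x| ≤ ‖resHom ξ' (x, 0) - resHom ξ (x, 0)‖ := by
  have key : ∀ ξ ξ' : Matrix (Fin n) (Fin m) ℝ,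
      idist ξ' x ≤ idist ξ x + ‖resHom ξ' (x, 0) - resHom ξ (x, 0)‖ := fun ξ ξ' => by
    obtain ⟨y, hy⟩ := exists_idist_eq ξ x
    have e : resHom ξ' (x, y) = resHom ξ (x, y) + (resHom ξ' (x, 0) - resHom ξ (x, 0)) := by
      have h : ((x, y) : (Fin m → ℤ) × (Fin n → ℤ)) = (x, 0) + (0, y) := by simp
      rw [h, map_add, map_add, resHom_fst_zero, resHom_fst_zero]
      abel
    rw [hy]
    refine (idist_le ξ' (x, y)).trans ?_
    rw [e]
    exact norm_add_le _ _
  have h1 := key ξ ξ'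
  have h2 := key ξ' ξ
  rw [norm_sub_rev] at h2
  rw [abs_le]
  constructor <;> linarith

theorem continuous_idist (x : Fin m → ℤ) :
    Continuous fun ξ : Matrix (Fin n) (Fin m) ℝ => idist ξ x := by
  rw [continuous_iff_continuousAt]
  intro ξ
  have h : Tendsto (fun ξ' => resHom ξ' (x, 0) - resHom ξ (x, 0)) (𝓝 ξ) (𝓝 0) := by
    have := ((continuous_resHom (x, (0 : Fin n → ℤ))).tendsto ξ).sub_const (resHom ξ (x, 0))
    rwa [sub_self] at this
  have h2 := h.norm
  rw [norm_zero] at h2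
  rw [ContinuousAt, tendsto_iff_norm_sub_tendsto_zero]
  exact squeeze_zero (fun _ => norm_nonneg _) (fun ξ' => abs_idist_sub_le ξ ξ' x) h2

end idist

theorem fib_mul_sub (s j : ℕ) :
    (Nat.fib (s + j + 1) : ℤ) * Nat.fib s - Nat.fib (s + j) * Nat.fib (s + 1) =
      (-1) ^ (s + 1) * Nat.fib j := by
  induction s with
  | zero => simp
  | succ s ih =>
    have h1 : (Nat.fib (s + 1 + j + 1) : ℤ) = Nat.fib (s + j) + Nat.fib (s + j + 1) := by
      rw [show s + 1 + j + 1 = s + j + 2 by ring, Nat.fib_add_two]; push_cast; ring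
    have h2 : (Nat.fib (s + 1 + 1) : ℤ) = Nat.fib s + Nat.fib (s + 1) := by
      rw [Nat.fib_add_two]; push_cast; ring
    rw [h1, h2, show s + 1 + j = s + j + 1 by ring, pow_succ]
    linear_combination -ih

theorem three_mul_fib_le {s : ℕ} (hs : 1 ≤ s) (j : ℕ) :
    3 * (Nat.fib (s + 1) * Nat.fib j) ≤ 2 * Nat.fib (s + j + 1) := by
  have h1 : Nat.fib (s + j + 1) = Nat.fib s * Nat.fib j + Nat.fib (s + 1) * Nat.fib (j + 1) :=
    Nat.fib_add s j
  have h2 : Nat.fib j ≤ Nat.fib (j + 1) := Nat.fib_le_fib_succ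
  have h3 : Nat.fib (s + 1) ≤ 2 * Nat.fib s := by
    obtain ⟨t, rfl⟩ : ∃ t, s = t + 1 := ⟨s - 1, by omega⟩
    have h4 : Nat.fib (t + 1 + 1) = Nat.fib t + Nat.fib (t + 1) := Nat.fib_add_two
    have : Nat.fib t ≤ Nat.fib (t + 1) := Nat.fib_le_fib_succ
    omega
  have h5 := Nat.mul_le_mul_left (Nat.fib (s + 1)) h2
  have h6 := Nat.mul_le_mul_right (Nat.fib j) h3
  nlinarith

/-- Every nonzero integer point of moderate size is beaten, with respect to the linear form
`F_{r+2} q - F_{r+1} p`, by a Fibonacci point of comparable size. -/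
theorem exists_fib_point {r : ℕ} {p q : ℤ} (hpq : p ≠ 0 ∨ q ≠ 0) (h : 2 * |p| < Nat.fib (r + 2)) :
    ∃ p' q' : ℤ, p' ≠ 0 ∧ |p'| ≤ 4 * |p| + 1 ∧ |q'| ≤ 4 * |p| + 1 ∧
      |Nat.fib (r + 2) * q' - Nat.fib (r + 1) * p'| < |Nat.fib (r + 2) * q - Nat.fib (r + 1) * p| := by
  have hex : ∃ s : ℕ, 2 * |p| < Nat.fib (s + 2) := ⟨r, h⟩
  classical
  obtain ⟨s, hs, hsr, hsz⟩ : ∃ s : ℕ, 2 * |p| < Nat.fib (s + 2) ∧ s ≤ r ∧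
      (Nat.fib (s + 2) : ℤ) ≤ 4 * |p| + 1 := by
    refine ⟨Nat.find hex, Nat.find_spec hex, Nat.find_min' hex h, ?_⟩
    rcases hk : Nat.find hex with _ | k
    · simp
    · have h1 := Nat.find_min hex (show k < Nat.find hex by omega)
      have h2 : Nat.fib (k + 1 + 2) = Nat.fib (k + 1) + Nat.fib (k + 2) := Nat.fib_add_two
      have h3 : Nat.fib (k + 1) ≤ Nat.fib (k + 2) := Nat.fib_le_fib_succ
      rw [not_lt] at h1
      rw [h2]
      push_cast
      zify at h3
      linarith
  obtain ⟨j, rfl⟩ : ∃ j, r = s + j := ⟨r - s, by omega⟩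
  have hd := fib_mul_sub (s + 1) j
  rw [show s + 1 + j + 1 = s + j + 2 by ring, show s + 1 + j = s + j + 1 by ring,
    show s + 1 + 1 = s + 2 by ring] at hd
  have h3 := three_mul_fib_le (show 1 ≤ s + 1 by omega) j
  rw [show s + 1 + j + 1 = s + j + 2 by ring, show s + 1 + 1 = s + 2 by ring] at h3
  have hF2 : 0 < Nat.fib (s + 2) := Nat.fib_pos.2 (by omega)
  have hj : |(Nat.fib (s + j + 2) : ℤ) * Nat.fib (s + 1) - Nat.fib (s + j + 1) * Nat.fib (s + 2)| =
      Nat.fib j := by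
    rw [hd, abs_mul, abs_pow, abs_neg, abs_one, one_pow, one_mul, Nat.abs_cast]
  have hmono : Nat.fib (s + 1) ≤ Nat.fib (s + 2) := Nat.fib_le_fib_succ
  refine ⟨Nat.fib (s + 2), Nat.fib (s + 1), by exact_mod_cast hF2.ne', by rwa [Nat.abs_cast], ?_, ?_⟩
  · rw [Nat.abs_cast]
    zify at hmono
    linarith
  · rw [hj]
    have hne : q * Nat.fib (s + 2) - p * Nat.fib (s + 1) ≠ 0 := by
      intro h0
      have hcop : IsCoprime (Nat.fib (s + 2) : ℤ) (Nat.fib (s + 1)) := by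
        rw [Nat.isCoprime_iff_coprime]
        exact (Nat.fib_coprime_fib_succ (s + 1)).symm
      have hdvd : (Nat.fib (s + 2) : ℤ) ∣ p := by
        refine hcop.dvd_of_dvd_mul_right ?_
        exact ⟨q, by linarith⟩
      have hp : p = 0 := by
        refine Int.eq_zero_of_abs_lt_dvd hdvd ?_
        have := abs_nonneg p
        linarith
      subst hp
      rw [zero_mul, sub_zero, mul_eq_zero] at h0
      rcases h0 with h0 | h0
      · simp [h0] at hpq
      · exact hF2.ne' (by exact_mod_cast h0)
    have h1 : 1 ≤ |q * Nat.fib (s + 2) - p * Nat.fib (s + 1)| := Int.one_le_abs hne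
    have e : (Nat.fib (s + j + 2) : ℤ) * (q * Nat.fib (s + 2) - p * Nat.fib (s + 1)) =
        Nat.fib (s + 2) * (Nat.fib (s + j + 2) * q - Nat.fib (s + j + 1) * p) -
        p * ((Nat.fib (s + j + 2) : ℤ) * Nat.fib (s + 1) - Nat.fib (s + j + 1) * Nat.fib (s + 2)) := by
      ring
    have h4 := abs_sub (Nat.fib (s + 2) * (Nat.fib (s + j + 2) * q - Nat.fib (s + j + 1) * p) : ℤ)
      (p * ((Nat.fib (s + j + 2) : ℤ) * Nat.fib (s + 1) - Nat.fib (s + j + 1) * Nat.fib (s + 2)))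
    rw [← e, abs_mul, abs_mul, abs_mul, hj, Nat.abs_cast, Nat.abs_cast] at h4
    have h5 : (Nat.fib (s + j + 2) : ℤ) ≤ Nat.fib (s + j + 2) *
        |q * Nat.fib (s + 2) - p * Nat.fib (s + 1)| := by
      have := mul_le_mul_of_nonneg_left h1 (Nat.cast_nonneg (α := ℤ) (Nat.fib (s + j + 2)))
      linarith
    zify at h3
    by_contra! hcon
    have h6 : (Nat.fib (s + 2) : ℤ) * |Nat.fib (s + j + 2) * q - Nat.fib (s + j + 1) * p| ≤
        Nat.fib (s + 2) * Nat.fib j := mul_le_mul_of_nonneg_left hcon (by positivity)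
    have h7 : 2 * (|p| * Nat.fib j) ≤ (Nat.fib (s + 2) - 1) * Nat.fib j := by
      rw [← mul_assoc]
      refine mul_le_mul_of_nonneg_right ?_ (by positivity)
      linarith
    rcases Nat.eq_zero_or_pos (Nat.fib j) with hz | hz
    · rw [hz] at h4 h3
      have h8 : 0 < Nat.fib (s + j + 2) := Nat.fib_pos.2 (by omega)
      rw [hz] at hcon
      have h9 : |(Nat.fib (s + j + 2) * q - Nat.fib (s + j + 1) * p : ℤ)| = 0 :=
        le_antisymm (by simpa using hcon) (abs_nonneg _)
      rw [h9] at h4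
      zify at h8
      simp at h4
      linarith
    · zify at hz
      linarith

/-- A scale model of the distance function `idist ξ`, together with the minimum `X` of the kernel
of `ξ`. -/
structure StageModel {n : ℕ} (B : ℝ) (τ : ℕ) (ξ : Matrix (Fin n) (Fin 3) ℝ) (Q G : ℕ → ℝ) (S : ℕ)
    (X : ℝ) : Prop where
  one_le : 1 ≤ S
  low : ∀ t < S, ∀ x ≠ 0, B * inorm x ≤ Q t → G t ≤ B * idist ξ x
  up : ∀ t ≤ S, ∃ x, x ≠ 0 ∧ inorm x ≤ B * Q t ∧ idist ξ x ≤ B * G t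
  G_pos : ∀ t, 0 < G t
  decay : ∀ t, t + τ ≤ S → 2 * B ^ 2 * G (t + τ) < G t
  small : ∃ x, x ≠ 0 ∧ IsKer ξ x ∧ inorm x ≤ B * Q S
  stage : IsStage (B ^ 2) ξ X
  gap : Q (S - 1) < B * X

theorem inorm_pos {m : ℕ} {x : Fin m → ℤ} (hx : x ≠ 0) : 0 < inorm x :=
  one_pos.trans_le (one_le_inorm hx)

theorem idist_pos {n : ℕ} {C X : ℝ} {ξ : Matrix (Fin n) (Fin 3) ℝ} (h : IsStage C ξ X)
    {x : Fin 3 → ℤ} (hx : x ≠ 0) (hX : inorm x < X) : 0 < idist ξ x := by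
  refine lt_of_le_of_ne (idist_nonneg ξ x) fun h0 => ?_
  exact absurd (h.le x hx ((isKer_iff_idist ξ).2 h0.symm)) (not_le.2 hX)

theorem ScaleModel.exists_stageModel {n : ℕ} {M : ℝ} (hM : 1 ≤ M) {τ : ℕ}
    {F : (Fin 3 → ℤ) × (Fin n → ℤ) →+ (Fin n → ℝ)} {Q G : ℕ → ℝ} {S : ℕ}
    (h : ScaleModel M τ F Q G S) (hQ : ∀ t, Q (t + 1) = 4 * Q t)
    {A : Matrix (Fin n) (Fin n) ℝ} {ξ : Matrix (Fin n) (Fin 3) ℝ}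
    (hres : ∀ v, resHom ξ v = A *ᵥ F v) (hA : ∀ v, ‖A *ᵥ v - v‖ ≤ 1 / 2 * ‖v‖) :
    ∃ X, StageModel (2 * M) τ ξ Q G S X := by
  have hup : ∀ v, ‖resHom ξ v‖ ≤ 2 * ‖F v‖ := fun v => by
    rw [hres]
    have := norm_le_norm_add_norm_sub (F v) (A *ᵥ F v)
    rw [norm_sub_rev] at this
    have := hA (F v)
    have := norm_nonneg (F v)
    linarith
  have hlow : ∀ v, ‖F v‖ ≤ 2 * ‖resHom ξ v‖ := fun v => by
    rw [hres]
    have := norm_le_norm_add_norm_sub (A *ᵥ F v) (F v)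
    have := hA (F v)
    have := norm_nonneg (F v)
    linarith
  have hker : ∀ v, F v = 0 → resHom ξ v = 0 := fun v hv => by
    have := hup v
    rw [hv, norm_zero, mul_zero] at this
    exact norm_le_zero_iff.1 this
  have hfst : ∀ v, F v = 0 → v.1 = 0 → v = 0 := fun v hv h1 => by
    have h2 := hker v hv
    obtain ⟨x, y⟩ := v
    obtain rfl : x = 0 := h1
    rw [resHom_fst_zero] at h2
    have : y = 0 := by
      ext k
      have := congrFun h2 k
      simpa using this
    rw [this]
    rfl
  have hlow' : ∀ t < S, ∀ x ≠ 0, M * inorm x ≤ Q t → G t ≤ 2 * M * idist ξ x :=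
      fun t ht x hx hxt => by
    obtain ⟨y, hy⟩ := exists_idist_eq ξ x
    have h1 := h.low t ht (x, y) (fun h0 => hx (congrArg Prod.fst h0)) hxt
    have h2 := mul_le_mul_of_nonneg_left (hlow (x, y)) (zero_le_one.trans hM)
    rw [← hy] at h2
    linarith
  obtain ⟨v₁, v₂, v₃, k₁, k₂, k₃, n₁, n₂, hind⟩ := h.ker
  have hx₁ : v₁.1 ≠ 0 := fun h0 => by
    have := hind 1 0 0 (by rw [hfst v₁ k₁ h0]; simp)
    simp at this
  have hker₁ : IsKer ξ v₁.1 := ⟨_, hker _ k₁⟩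
  obtain ⟨x, ⟨hx0, hxk, -⟩, hxmin⟩ := Set.exists_min_image
    {x : Fin 3 → ℤ | x ≠ 0 ∧ IsKer ξ x ∧ inorm x ≤ M * Q S} inorm
    ((finite_inorm_le (M * Q S)).subset fun x hx => hx.2.2) ⟨v₁.1, hx₁, hker₁, n₁⟩
  have hmin : ∀ x', x' ≠ 0 → IsKer ξ x' → inorm x ≤ inorm x' := fun x' h1 h2 => by
    by_cases h3 : inorm x' ≤ M * Q S
    · exact hxmin _ ⟨h1, h2, h3⟩
    · exact (hxmin _ ⟨hx₁, hker₁, n₁⟩).trans (n₁.trans (not_le.1 h3).le)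
  have hgap : Q (S - 1) < M * inorm x := by
    by_contra! hcon
    have := hlow' (S - 1) (by have := h.one_le; omega) x hx0 hcon
    rw [(isKer_iff_idist ξ).1 hxk, mul_zero] at this
    exact absurd (h.G_pos (S - 1)) (not_lt.2 this)
  have hQS : M * Q S ≤ (2 * M) ^ 2 * inorm x := by
    have e : Q S = 4 * Q (S - 1) := by
      rw [← hQ, Nat.sub_add_cancel h.one_le]
    rw [e]
    have := mul_le_mul_of_nonneg_left hgap.le (by linarith : (0 : ℝ) ≤ 4 * M)
    linarith
  have hQpos : 0 ≤ Q S := by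
    have := (inorm_nonneg _).trans n₁
    exact nonneg_of_mul_nonneg_right this (by linarith)
  refine ⟨inorm x, h.one_le, fun t ht x hx hxt => ?_, fun t ht => ?_, h.G_pos, fun t ht => ?_,
    ⟨v₁.1, hx₁, hker₁, n₁.trans ?_⟩, ⟨?_, ⟨x, hx0, hxk, rfl⟩, hmin, ?_⟩, ?_⟩
  · refine hlow' t ht x hx ?_
    have := mul_nonneg (zero_le_one.trans hM) (inorm_nonneg x)
    linarith
  · obtain ⟨v, hv1, hv2, hv3⟩ := h.up t ht
    have hQ0 : 0 ≤ Q t := by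
      have := (inorm_nonneg _).trans hv2
      exact nonneg_of_mul_nonneg_right this (by linarith)
    refine ⟨v.1, hv1, hv2.trans ?_, (idist_le ξ v).trans ((hup v).trans ?_)⟩
    · exact mul_le_mul_of_nonneg_right (by linarith) hQ0
    · linarith
  · have := h.decay t ht
    linarith
  · exact mul_le_mul_of_nonneg_right (by linarith) hQpos
  · refine ⟨![v₁.1, v₂.1, v₃.1], fun hdet => ?_, fun i => ?_⟩
    · obtain ⟨c, hc0, hc⟩ := Matrix.exists_vecMul_eq_zero_iff.2 hdet
      refine hc0 ?_
      have h0 : c 0 • v₁ + c 1 • v₂ + c 2 • v₃ = 0 := by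
        refine hfst _ (by simp only [map_add, map_zsmul, k₁, k₂, k₃, smul_zero, add_zero]) ?_
        ext j
        have := congrFun hc j
        simpa [Matrix.vecMul, dotProduct, Fin.sum_univ_three] using this
      obtain ⟨h1, h2, h3⟩ := hind _ _ _ h0
      ext i
      fin_cases i <;> assumption
    · fin_cases i
      · exact hker₁
      · exact ⟨_, hker _ k₂⟩
      · exact ⟨_, hker _ k₃⟩
  · refine ⟨v₁.1, v₂.1, hker₁, ⟨_, hker _ k₂⟩, n₁.trans hQS, n₂.trans hQS, fun a b hab => ?_⟩
    have h0 := hfst (a • v₁ + b • v₂) (by simp only [map_add, map_zsmul, k₁, k₂, smul_zero, add_zero]) hab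
    have := hind a b 0 (by simpa using h0)
    exact ⟨this.1, this.2.1⟩
  · have := mul_nonneg (zero_le_one.trans hM) (inorm_nonneg x)
    linarith

section

variable {n : ℕ} {B : ℝ} {τ : ℕ} {ξ : Matrix (Fin n) (Fin 3) ℝ} {Q G : ℕ → ℝ} {S : ℕ} {X : ℝ}

theorem pow_mul_eq {Q : ℕ → ℝ} (hQ : ∀ t, Q (t + 1) = 4 * Q t) (t k : ℕ) :
    Q (t + k) = 4 ^ k * Q t := by
  induction k with
  | zero => simp
  | succ k ih => rw [← add_assoc, hQ, ih]; ring

theorem exists_le_scale {Q : ℕ → ℝ} (hQ : ∀ t, Q (t + 1) = 4 * Q t) (h0 : 0 < Q 0) (R : ℝ) :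
    ∃ t, R ≤ Q t := by
  obtain ⟨t, ht⟩ := pow_unbounded_of_one_lt (R / Q 0) (by norm_num : (1 : ℝ) < 4)
  refine ⟨0 + t, ?_⟩
  rw [pow_mul_eq hQ]
  exact ((div_lt_iff₀ h0).1 ht).le

theorem scale_pos {Q : ℕ → ℝ} (hQ : ∀ t, Q (t + 1) = 4 * Q t) (h0 : 0 < Q 0) (t : ℕ) :
    0 < Q t := by
  have := pow_mul_eq hQ 0 t
  rw [zero_add] at this
  rw [this]
  positivity

theorem scale_monotone {Q : ℕ → ℝ} (hQ : ∀ t, Q (t + 1) = 4 * Q t) (h0 : 0 < Q 0) :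
    Monotone Q :=
  monotone_nat_of_le_succ fun t => by
    have := scale_pos hQ h0 t
    rw [hQ]
    linarith

theorem StageModel.exists_idist_lt (h : StageModel B τ ξ Q G S X) (hB : 1 ≤ B)
    (hQ : ∀ t, Q (t + 1) = 4 * Q t) (h0 : 0 < Q 0) {K : ℝ} (hK : 0 ≤ K) {x : Fin 3 → ℤ}
    (hx : x ≠ 0) (hxK : Q 0 ≤ K * inorm x) (hxX : inorm x < X) :
    0 < idist ξ x ∧ ∃ x', x' ≠ 0 ∧ inorm x' ≤ B * 4 ^ τ * (4 * B + K) * inorm x ∧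
      idist ξ x' < idist ξ x := by
  have hpos := idist_pos h.stage hx hxX
  refine ⟨hpos, ?_⟩
  have hex := exists_le_scale hQ h0 (B * inorm x)
  classical
  obtain ⟨t, ht, htmin⟩ : ∃ t, B * inorm x ≤ Q t ∧ ∀ s < t, Q s < B * inorm x :=
    ⟨Nat.find hex, Nat.find_spec hex, fun s hs => not_le.1 (Nat.find_min hex hs)⟩
  have hQt : Q t ≤ (4 * B + K) * inorm x := by
    have h1 : 0 ≤ B * inorm x := mul_nonneg (by linarith) (inorm_nonneg x)
    have h2 : 0 ≤ K * inorm x := mul_nonneg hK (inorm_nonneg x)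
    rcases t with _ | t
    · linarith
    · have := htmin t (by omega)
      rw [hQ]
      linarith
  have hbound : B * Q (t + τ) ≤ B * 4 ^ τ * (4 * B + K) * inorm x := by
    rw [pow_mul_eq hQ]
    have := mul_le_mul_of_nonneg_left hQt (by positivity : 0 ≤ B * 4 ^ τ)
    linarith
  by_cases htS : t + τ ≤ S
  · obtain ⟨x', hx', hx'n, hx'd⟩ := h.up (t + τ) htS
    have hd := h.decay t htS
    have htS' : t < S := by
      refine lt_of_le_of_ne (by omega) fun he => ?_
      have hτ : τ = 0 := by omega
      subst hτ
      rw [add_zero] at hd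
      have h1 := h.G_pos t
      have h2 : 1 ≤ B ^ 2 := one_le_pow₀ hB
      have h3 := mul_le_mul_of_nonneg_right h2 h1.le
      linarith
    have hl := h.low t htS' x hx ht
    refine ⟨x', hx', hx'n.trans hbound, ?_⟩
    have h1 := mul_le_mul_of_nonneg_left hx'd (by linarith : 0 ≤ 2 * B)
    have h2 : 2 * B * idist ξ x' < B * idist ξ x := by linarith
    have := idist_nonneg ξ x'
    have := lt_of_mul_lt_mul_left (by linarith : B * (2 * idist ξ x') < B * idist ξ x)
      (by linarith)
    linarith
  · obtain ⟨x', hx', hk, hn⟩ := h.small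
    refine ⟨x', hx', hn.trans (le_trans ?_ hbound), ?_⟩
    · exact mul_le_mul_of_nonneg_left (scale_monotone hQ h0 (by omega)) (by linarith)
    · rwa [(isKer_iff_idist ξ).1 hk]

theorem StageModel.exists_idist_lt_rpow (h : StageModel B τ ξ Q G S X) (hB : 1 ≤ B)
    (hQ : ∀ t, Q (t + 1) = 4 * Q t) (h0 : 0 < Q 0) {u : ℝ} (hu : 0 ≤ u)
    (hupper : ∀ t ≤ S, 4 * B * G t * (4 * B * Q t) ^ u < 1) {R : ℝ} (hR : B * Q 0 ≤ R) :
    ∃ x, x ≠ 0 ∧ inorm x ≤ R ∧ idist ξ x < R ^ (-u) := by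
  have hRpos : 0 < R := lt_of_lt_of_le (by positivity) hR
  by_cases hRS : B * Q S ≤ R
  · obtain ⟨x, hx, hk, hn⟩ := h.small
    refine ⟨x, hx, hn.trans hRS, ?_⟩
    rw [(isKer_iff_idist ξ).1 hk]
    positivity
  have hex : ∃ t, R < B * Q t := ⟨S, not_le.1 hRS⟩
  classical
  obtain ⟨t, ht, htS, htmin⟩ : ∃ t, R < B * Q t ∧ t ≤ S ∧ ∀ s < t, B * Q s ≤ R :=
    ⟨Nat.find hex, Nat.find_spec hex, Nat.find_min' hex (not_le.1 hRS),
      fun s hs => not_lt.1 (Nat.find_min hex hs)⟩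
  rcases t with _ | t
  · exact absurd ht (not_lt.2 hR)
  obtain ⟨x, hx, hxn, hxd⟩ := h.up t (by omega)
  refine ⟨x, hx, hxn.trans (htmin t (by omega)), hxd.trans_lt ?_⟩
  have hu' := hupper t (by omega)
  have hG := h.G_pos t
  rw [hQ] at ht
  have h1 : R ^ u ≤ (4 * B * Q t) ^ u :=
    Real.rpow_le_rpow hRpos.le (by linarith) hu
  rw [Real.rpow_neg hRpos.le, lt_inv_comm₀ (by positivity) (by positivity)]
  have h2 : 4 * B * G t * R ^ u < 1 :=
    (mul_le_mul_of_nonneg_left h1 (by positivity)).trans_lt hu'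
  rw [← one_div, lt_div_iff₀ (by positivity)]
  have h3 : 0 < B * G t * R ^ u := by positivity
  linarith

theorem StageModel.rpow_lt_idist (h : StageModel B τ ξ Q G S X) (hB : 1 ≤ B)
    (hQ : ∀ t, Q (t + 1) = 4 * Q t) (h0 : 0 < Q 0) {u : ℝ}
    (hlower : B < G (S - 1) * (Q (S - 1) / B) ^ u) {x : Fin 3 → ℤ} (hx : x ≠ 0)
    (hxn : inorm x ≤ Q (S - 1) / B) : (Q (S - 1) / B) ^ (-u) < idist ξ x := by
  have hRpos : 0 < Q (S - 1) / B := div_pos (scale_pos hQ h0 _) (by linarith)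
  have h1 := h.low (S - 1) (by have := h.one_le; omega) x hx
    (by rw [le_div_iff₀ (by linarith)] at hxn; linarith)
  rw [Real.rpow_neg hRpos.le, inv_lt_iff_one_lt_mul₀ (by positivity)]
  have hp : 0 < (Q (S - 1) / B) ^ u := by positivity
  have h2 := mul_le_mul_of_nonneg_right h1 hp.le
  have h3 : B * 1 < B * (idist ξ x * (Q (S - 1) / B) ^ u) := by linarith
  have h4 := lt_of_mul_lt_mul_left h3 (by linarith)
  linarith

end

theorem eq_zero_of_resHom_eq_zero {m n : ℕ} {ξ : Matrix (Fin n) (Fin m) ℝ}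
    {v : (Fin m → ℤ) × (Fin n → ℤ)} (hv : resHom ξ v = 0) (h1 : v.1 = 0) : v = 0 := by
  obtain ⟨x, y⟩ := v
  obtain rfl : x = 0 := h1
  rw [resHom_fst_zero] at hv
  have : y = 0 := by
    ext k
    have := congrFun hv k
    simpa using this
  rw [this]
  rfl

namespace Frame

variable {n : ℕ} {C : ℝ} {ξ : Matrix (Fin n) (Fin 3) ℝ} (Φ : Frame C ξ)

theorem resHom_eq_zero (γ : Fin 3 → ℤ) : resHom ξ (Φ.e (γ, 0)) = 0 := by
  rw [Φ.res_eq]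
  simp

theorem fst_ne_zero {γ : Fin 3 → ℤ} (hγ : γ ≠ 0) : (Φ.e (γ, 0)).1 ≠ 0 := fun h => by
  have := eq_zero_of_resHom_eq_zero (Φ.resHom_eq_zero γ) h
  rw [EmbeddingLike.map_eq_zero_iff] at this
  exact hγ (congrArg Prod.fst this)

theorem exists_eq_of_resHom_eq_zero {v : (Fin 3 → ℤ) × (Fin n → ℤ)} (hv : resHom ξ v = 0) :
    ∃ γ, v = Φ.e (γ, 0) := by
  obtain ⟨⟨γ, δ⟩, rfl⟩ := Φ.e.surjective v
  refine ⟨γ, ?_⟩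
  rw [Φ.res_eq] at hv
  have : δ = 0 := by
    ext j
    have h1 := Φ.a_cond (fun i => (δ i : ℝ)) j
    rw [hv, norm_zero, mul_zero] at h1
    have h2 : |(δ j : ℝ)| ≤ 0 := by
      by_contra! h3
      exact absurd h1 (not_le.2 (mul_pos h3 (Φ.a_pos j)))
    simpa using h2
  rw [this]

end Frame

theorem eventually_idist_lt {n : ℕ} {ι : Type*} {l : Filter ι}
    {ξ : Matrix (Fin n) (Fin 3) ℝ} {Ξ : ι → Matrix (Fin n) (Fin 3) ℝ}
    (hΞ : Tendsto Ξ l (𝓝 ξ)) {x x' : Fin 3 → ℤ} (h : idist ξ x' < idist ξ x) :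
    ∀ᶠ T in l, idist (Ξ T) x' < idist (Ξ T) x :=
  (((continuous_idist x').tendsto ξ).comp hΞ).eventually_lt
    (((continuous_idist x).tendsto ξ).comp hΞ) h

namespace IsScaleFamily

variable {n : ℕ} {hn : 1 ≤ n} {C : ℝ} {ξ : Matrix (Fin n) (Fin 3) ℝ} {Φ : Frame C ξ} {r : ℕ}
  {M : ℝ} {τ : ℕ} {w : ℝ} {F : ℕ → (Fin 3 → ℤ) × (Fin n → ℤ) →+ (Fin n → ℝ)} {Q : ℕ → ℝ}
  {G : ℕ → ℕ → ℝ} {S : ℕ → ℕ}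

theorem eventually_norm_plane_lt (h : IsScaleFamily hn Φ r M τ w F Q G S)
    {A : ℕ → Matrix (Fin n) (Fin n) ℝ} {Ξ : ℕ → Matrix (Fin n) (Fin 3) ℝ}
    (hA : Tendsto A atTop (𝓝 1)) (hres : ∀ᶠ T in atTop, ∀ v, resHom (Ξ T) v = A T *ᵥ F T v)
    {γ γ' : Fin 3 → ℤ} (h2 : γ 2 = 0) (h2' : γ' 2 = 0)
    (hlt : |Nat.fib (r + 2) * γ' 1 - Nat.fib (r + 1) * γ' 0| <
      |Nat.fib (r + 2) * γ 1 - Nat.fib (r + 1) * γ 0|) :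
    ∀ᶠ T in atTop, ‖resHom (Ξ T) (Φ.e (γ', 0))‖ < ‖resHom (Ξ T) (Φ.e (γ, 0))‖ := by
  have key : ∀ γ : Fin 3 → ℤ, γ 2 = 0 →
      Tendsto (fun T : ℕ => (T : ℝ) * ‖resHom (Ξ T) (Φ.e (γ, 0))‖) atTop
        (𝓝 (|(Nat.fib (r + 2) * γ 1 - Nat.fib (r + 1) * γ 0 : ℝ)| / Nat.fib (r + 2) *
          ‖Φ.a ⟨0, hn⟩‖)) := fun γ hγ => by
    have h1 := h.plane γ hγ
    have h3 : Tendsto (fun T => A T *ᵥ ((T : ℝ) • F T (Φ.e (γ, 0)))) atTop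
        (𝓝 ((1 : Matrix (Fin n) (Fin n) ℝ) *ᵥ
          (((Nat.fib (r + 2) * γ 1 - Nat.fib (r + 1) * γ 0 : ℝ) / Nat.fib (r + 2)) •
            Φ.a ⟨0, hn⟩))) :=
      ((continuous_fst.matrix_mulVec continuous_snd).tendsto
        ((1 : Matrix (Fin n) (Fin n) ℝ), _)).comp (hA.prodMk_nhds h1)
    rw [Matrix.one_mulVec] at h3
    have h4 := h3.norm
    rw [norm_smul, Real.norm_eq_abs, abs_div, Nat.abs_cast] at h4
    refine h4.congr' ?_
    filter_upwards [hres] with T hT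
    rw [hT, Matrix.mulVec_smul, norm_smul, Real.norm_eq_abs, Nat.abs_cast]
  have hfib : (0 : ℝ) < Nat.fib (r + 2) := by exact_mod_cast Nat.fib_pos.2 (by omega)
  have hlt' : |(Nat.fib (r + 2) * γ' 1 - Nat.fib (r + 1) * γ' 0 : ℝ)| / Nat.fib (r + 2) *
        ‖Φ.a ⟨0, hn⟩‖ <
      |(Nat.fib (r + 2) * γ 1 - Nat.fib (r + 1) * γ 0 : ℝ)| / Nat.fib (r + 2) *
        ‖Φ.a ⟨0, hn⟩‖ := by
    refine mul_lt_mul_of_pos_right ?_ (Φ.a_pos _)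
    refine div_lt_div_of_pos_right ?_ hfib
    exact_mod_cast hlt
  filter_upwards [(key γ' h2').eventually_lt (key γ h2) hlt'] with T hT
  exact lt_of_mul_lt_mul_left hT (Nat.cast_nonneg T)

theorem eventually_exists_idist_lt (h : IsScaleFamily hn Φ r M τ w F Q G S) (hC : 1 ≤ C)
    {A : ℕ → Matrix (Fin n) (Fin n) ℝ} {Ξ : ℕ → Matrix (Fin n) (Fin 3) ℝ}
    (hA : Tendsto A atTop (𝓝 1)) (hΞ : Tendsto Ξ atTop (𝓝 ξ))
    (hres : ∀ᶠ T in atTop, ∀ v, resHom (Ξ T) v = A T *ᵥ F T v) {K : ℝ} {x : Fin 3 → ℤ}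
    (hx : x ≠ 0) (hxK : Φ.X₀ ≤ K * inorm x) (hxQ : 2 * C * inorm x < Q 0) :
    ∀ᶠ T in atTop, 0 < idist (Ξ T) x ∧
      ∃ x', x' ≠ 0 ∧ inorm x' ≤ (8 * C + 2 * K) * inorm x ∧ idist (Ξ T) x' < idist (Ξ T) x := by
  have hxn := inorm_pos hx
  have hX₀ : 0 < Φ.X₀ := Φ.X₁_pos.trans_le Φ.X₁_le
  rcases (idist_nonneg ξ x).lt_or_eq with hpos | hzero
  · have hx' : (Φ.e (![0, 1, 0], 0)).1 ≠ 0 := Φ.fst_ne_zero fun h0 => by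
      simpa using congrFun h0 1
    have hk : idist ξ (Φ.e (![0, 1, 0], 0)).1 = 0 :=
      (isKer_iff_idist ξ).1 ⟨_, Φ.resHom_eq_zero _⟩
    filter_upwards [eventually_idist_lt hΞ (hk.trans_lt hpos)] with T hT
    refine ⟨(idist_nonneg _ _).trans_lt hT, _, hx', ?_, hT⟩
    have h1 := Φ.inorm_le ![0, 1, 0]
    simp at h1
    have h2 := Φ.X₁_le
    have h3 : 0 < C * inorm x := by positivity
    linarith
  · obtain ⟨y, hy⟩ := (isKer_iff_idist ξ).2 hzero.symm
    obtain ⟨γ, hγ⟩ := Φ.exists_eq_of_resHom_eq_zero hy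
    have hγx : (Φ.e (γ, 0)).1 = x := by rw [← hγ]
    obtain ⟨b0, b1, b2⟩ := Φ.le_inorm γ
    rw [hγx] at b0 b1 b2
    have hQ0 : Q 0 = Nat.fib (r + 2) * Φ.X₀ / 2 := by rw [h.Q_eq]; simp
    have hfib := h.fib_le
    have hγ2 : γ 2 = 0 := by
      by_contra hne
      have h1 : (1 : ℝ) ≤ |(γ 2 : ℝ)| := by exact_mod_cast Int.one_le_abs hne
      have h2 := mul_le_mul_of_nonneg_right h1 (hX₀.le.trans Φ.X₀_le)
      have h3 : 0 < C * inorm x := by positivity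
      linarith
    have hγ0 : 2 * |γ 0| < Nat.fib (r + 2) := by
      have h1 : (2 * |(γ 0 : ℝ)|) * Φ.X₀ < Nat.fib (r + 2) * Φ.X₀ := by
        have := mul_pos (show (0 : ℝ) < Nat.fib (r + 2) by
          exact_mod_cast Nat.fib_pos.2 (by omega)) hX₀
        linarith
      exact_mod_cast lt_of_mul_lt_mul_right h1 hX₀.le
    have hγne : γ 0 ≠ 0 ∨ γ 1 ≠ 0 := by
      by_contra! h0
      have : γ = 0 := by
        ext i
        fin_cases i
        · exact h0.1
        · exact h0.2
        · exact hγ2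
      rw [this, show ((0 : Fin 3 → ℤ), (0 : Fin n → ℤ)) = 0 from rfl, map_zero] at hγ
      exact hx (congrArg Prod.fst hγ)
    obtain ⟨p, q, hp, hpb, hqb, hlt⟩ := exists_fib_point hγne hγ0
    have hx' : (Φ.e (![p, q, 0], 0)).1 ≠ 0 := Φ.fst_ne_zero fun h0 => hp (by
      simpa using congrFun h0 0)
    have hsmall : ∀ᶠ T in atTop, ‖resHom (Ξ T) (Φ.e (γ, 0))‖ < 1 / 2 := by
      have h1 := (((continuous_resHom (Φ.e (γ, 0))).tendsto ξ).comp hΞ).norm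
      rw [Φ.resHom_eq_zero, norm_zero] at h1
      exact h1.eventually_lt_const (by norm_num)
    filter_upwards [h.eventually_norm_plane_lt hA hres (γ' := ![p, q, 0]) hγ2 rfl hlt, hsmall]
      with T hT1 hT2
    have hT3 : idist (Ξ T) (Φ.e (![p, q, 0], 0)).1 < idist (Ξ T) x := by
      have h1 := idist_eq_of_lt (Ξ T) hT2
      rw [hγx] at h1
      rw [h1]
      exact (idist_le _ _).trans_lt hT1
    refine ⟨(idist_nonneg _ _).trans_lt hT3, _, hx', ?_, hT3⟩
    have h1 := Φ.inorm_le ![p, q, 0]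
    simp only [Matrix.cons_val_zero, Matrix.cons_val_one, Matrix.cons_val, Int.cast_zero, abs_zero,
      zero_mul, add_zero] at h1
    have hpb' : |(p : ℝ)| ≤ 4 * |(γ 0 : ℝ)| + 1 := by exact_mod_cast hpb
    have hqb' : |(q : ℝ)| ≤ 4 * |(γ 0 : ℝ)| + 1 := by exact_mod_cast hqb
    have h2 := mul_le_mul_of_nonneg_right hpb' hX₀.le
    have h3 := mul_le_mul_of_nonneg_right hqb' hX₀.le
    have h4 := mul_le_mul_of_nonneg_left Φ.X₁_le (abs_nonneg (q : ℝ))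
    linarith

end IsScaleFamily

/-- Every `x` with `X ≤ ‖x‖ < X'` is beaten by a vector of comparable size. -/
def Wins {m n : ℕ} (M : ℝ) (ξ : Matrix (Fin n) (Fin m) ℝ) (X X' : ℝ) : Prop :=
  ∀ x, x ≠ 0 → X ≤ inorm x → inorm x < X' →
    0 < idist ξ x ∧ ∃ x', x' ≠ 0 ∧ inorm x' ≤ M * inorm x ∧ idist ξ x' < idist ξ x

/-- The uniform exponent of `ξ` on the range `[X, X')` is greater than `u`. -/
def StaysBelow {m n : ℕ} (u : ℝ) (ξ : Matrix (Fin n) (Fin m) ℝ) (X X' : ℝ) : Prop :=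
  ∀ Q : ℕ, X ≤ Q → Q < X' → ∃ x, x ≠ 0 ∧ inorm x ≤ Q ∧ idist ξ x < (Q : ℝ) ^ (-u)

/-- At some point of the range `[X, X')`, the exponent of `ξ` is less than `u`. -/
def RisesAbove {m n : ℕ} (u : ℝ) (ξ : Matrix (Fin n) (Fin m) ℝ) (X X' : ℝ) : Prop :=
  ∃ Q : ℝ, X ≤ Q ∧ Q < X' ∧ ∀ x, x ≠ 0 → inorm x ≤ Q → Q ^ (-u) < idist ξ x

theorem exists_next_stage {n : ℕ} (hn : 1 ≤ n) : ∃ C M : ℝ, 1 ≤ C ∧ 1 ≤ M ∧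
    ∀ (ξ : Matrix (Fin n) (Fin 3) ℝ) (X : ℝ), IsStage C ξ X → ∀ w : ℝ, 3 < n * w →
      (n - 1) * w < 3 → ∀ ε > 0, ε < w → ∀ U ∈ 𝓝 ξ, ∀ N : ℝ, ∃ ξ' ∈ U, ∃ X',
        IsStage C ξ' X' ∧ X < X' ∧ N ≤ X' ∧ Wins M ξ' X X' ∧ StaysBelow (w - ε) ξ' X X' ∧
          RisesAbove (w + ε) ξ' X X' := by
  obtain ⟨C', hC', hframe⟩ := IsStage.exists_frame n
  obtain ⟨B, τ, hB, hfam⟩ := exists_scale_family hn hC'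
  set C : ℝ := (2 * B) ^ 2 with hCdef
  have hC : 1 ≤ C := one_le_pow₀ (by linarith)
  refine ⟨C, 2 * B * 4 ^ τ * (4 * (2 * B) + 2 * C') + (8 * C' + 2 * (C' * C)), hC, ?_, ?_⟩
  · have : 0 ≤ 2 * B * 4 ^ τ * (4 * (2 * B) + 2 * C') := by positivity
    have : 0 ≤ 2 * (C' * C) := by positivity
    linarith
  intro ξ X hst w hw hw' ε hε hεw U hU N
  obtain ⟨Φ, hX, -, hΦ⟩ := hframe C ξ X hst
  obtain ⟨r, F, Q, G, S, h⟩ := hfam ξ Φ w hw hw'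
  obtain ⟨A, Ξ, hA, hΞ, hres⟩ := exists_realization h.tendsto
  have hX₀ : 0 < Φ.X₀ := Φ.X₁_pos.trans_le Φ.X₁_le
  have hQ : ∀ t, Q (t + 1) = 4 * Q t := fun t => by
    rw [h.Q_eq, h.Q_eq]
    ring
  have hQ0 : 0 < Q 0 := by
    rw [h.Q_eq]
    have : (0 : ℝ) < Nat.fib (r + 2) := by exact_mod_cast Nat.fib_pos.2 (by omega)
    positivity
  have hB' : 1 ≤ 2 * B := by linarith
  have hlarge : ∀ R : ℝ, ∀ᶠ T in atTop, R ≤ Q (S T - 1) / (2 * B) := fun R => by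
    obtain ⟨t, ht⟩ := exists_le_scale hQ hQ0 (R * (2 * B))
    filter_upwards [h.tendsto_S.eventually_ge_atTop (t + 1)] with T hT
    rw [le_div_iff₀ (by linarith)]
    exact ht.trans (scale_monotone hQ hQ0 (by omega))
  have hsmall : ∀ᶠ T in atTop, ∀ x ∈ (finite_inorm_le (m := 3) (Q 0 / (2 * C'))).toFinset,
      x ≠ 0 → X ≤ inorm x → 2 * C' * inorm x < Q 0 → 0 < idist (Ξ T) x ∧
        ∃ x', x' ≠ 0 ∧ inorm x' ≤ (8 * C' + 2 * (C' * C)) * inorm x ∧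
          idist (Ξ T) x' < idist (Ξ T) x := by
    rw [eventually_all_finset]
    intro x _
    by_cases hx : x ≠ 0 ∧ X ≤ inorm x ∧ 2 * C' * inorm x < Q 0
    · have hxK : Φ.X₀ ≤ C' * C * inorm x := by
        have := mul_le_mul_of_nonneg_left hx.2.1 (by positivity : 0 ≤ C' * C)
        linarith
      filter_upwards [h.eventually_exists_idist_lt hC' hA hΞ hres hx.1 hxK hx.2.2] with T hT
      exact fun _ _ _ => hT
    · exact Eventually.of_forall fun T h1 h2 h3 => absurd ⟨h1, h2, h3⟩ hx
  obtain ⟨x₀, hx₀, hk₀, hn₀⟩ := hst.attained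
  have hstart : ∀ᶠ T in atTop, ∀ q ∈ Finset.range (⌈2 * B * Q 0⌉₊), X ≤ (q : ℝ) →
      idist (Ξ T) x₀ < (q : ℝ) ^ (-(w - ε)) := by
    rw [eventually_all_finset]
    intro q _
    by_cases hq : X ≤ (q : ℝ)
    · have h1 := ((continuous_idist x₀).tendsto ξ).comp hΞ
      rw [(isKer_iff_idist ξ).1 hk₀] at h1
      filter_upwards [h1.eventually_lt_const (Real.rpow_pos_of_pos (hX.trans_le hq) _)] with T hT
      exact fun _ => hT
    · exact Eventually.of_forall fun T h1 => absurd h1 hq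
  obtain ⟨T, hT⟩ := (((((((((hΞ.eventually hU).and h.model).and hres).and
    (eventually_norm_mulVec_sub_le hA (by norm_num : (0 : ℝ) < 1 / 2))).and (hlarge X)).and
    (hlarge N)).and hsmall).and hstart).and
    ((h.upper ε hε (4 * (2 * B)) (by linarith)).and (h.lower ε hε (2 * B) (by linarith)))).exists
  obtain ⟨⟨⟨⟨⟨⟨⟨⟨hTU, hTm⟩, hTr⟩, hTA⟩, hTX⟩, hTN⟩, hTs⟩, hTst⟩, hTu, hTl⟩ := hT
  obtain ⟨X', hX'⟩ := hTm.exists_stageModel hB hQ hTr hTA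
  have hgap : Q (S T - 1) / (2 * B) < X' := by
    rw [div_lt_iff₀ (by linarith)]
    linarith [hX'.gap]
  refine ⟨Ξ T, hTU, X', hX'.stage, hTX.trans_lt hgap, hTN.trans hgap.le, ?_, ?_, ?_⟩
  · intro x hx hxX hxX'
    have hxn := inorm_pos hx
    have hp1 : 0 ≤ 2 * B * 4 ^ τ * (4 * (2 * B) + 2 * C') * inorm x := by positivity
    have hp2 : 0 ≤ (8 * C' + 2 * (C' * C)) * inorm x := by positivity
    rcases lt_or_ge (2 * C' * inorm x) (Q 0) with hlt | hge
    · obtain ⟨h1, x', hx', h2, h3⟩ := hTs x (by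
        simp only [Set.Finite.mem_toFinset, Set.mem_ofPred_eq]
        rw [le_div_iff₀ (by linarith)]
        linarith) hx hxX hlt
      exact ⟨h1, x', hx', by linarith, h3⟩
    · obtain ⟨h1, x', hx', h2, h3⟩ := hX'.exists_idist_lt hB' hQ hQ0 (by linarith) hx hge hxX'
      exact ⟨h1, x', hx', by linarith, h3⟩
  · intro q hq hqX'
    rcases lt_or_ge (q : ℝ) (2 * B * Q 0) with hlt | hge
    · refine ⟨x₀, hx₀, hn₀.trans_le hq, hTst q ?_ hq⟩
      rw [Finset.mem_range]
      exact_mod_cast hlt.trans_le (Nat.le_ceil _)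
    · exact hX'.exists_idist_lt_rpow hB' hQ hQ0 (by linarith) hTu hge
  · exact ⟨_, hTX, hgap, fun x hx hxn => hX'.rpow_lt_idist hB' hQ hQ0 hTl hx hxn⟩

section

variable {m n : ℕ} {ξ : Matrix (Fin n) (Fin m) ℝ} {X X' : ℝ}

theorem eventually_lt_idist {x : Fin m → ℤ} {c : ℝ} (h : c < idist ξ x) :
    ∀ᶠ ξ' in 𝓝 ξ, c < idist ξ' x :=
  ((continuous_idist x).tendsto ξ).eventually_const_lt h

theorem eventually_idist_lt_const {x : Fin m → ℤ} {c : ℝ} (h : idist ξ x < c) :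
    ∀ᶠ ξ' in 𝓝 ξ, idist ξ' x < c :=
  ((continuous_idist x).tendsto ξ).eventually_lt_const h

theorem Wins.eventually {M : ℝ} (h : Wins M ξ X X') : ∀ᶠ ξ' in 𝓝 ξ, Wins M ξ' X X' := by
  have h1 : ∀ᶠ ξ' in 𝓝 ξ, ∀ x ∈ {x : Fin m → ℤ | inorm x ≤ X'}, x ≠ 0 → X ≤ inorm x →
      inorm x < X' → 0 < idist ξ' x ∧
        ∃ x', x' ≠ 0 ∧ inorm x' ≤ M * inorm x ∧ idist ξ' x' < idist ξ' x := by
    rw [eventually_all_finite (finite_inorm_le X')]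
    intro x _
    by_cases hx : x ≠ 0 ∧ X ≤ inorm x ∧ inorm x < X'
    · obtain ⟨hpos, x', hx', hn, hlt⟩ := h x hx.1 hx.2.1 hx.2.2
      filter_upwards [eventually_lt_idist hpos,
        ((continuous_idist x').tendsto ξ).eventually_lt ((continuous_idist x).tendsto ξ) hlt]
        with ξ' h1 h2
      exact fun _ _ _ => ⟨h1, x', hx', hn, h2⟩
    · exact Eventually.of_forall fun _ h1 h2 h3 => absurd ⟨h1, h2, h3⟩ hx
  filter_upwards [h1] with ξ' h2
  exact fun x hx hX hX' => h2 x hX'.le hx hX hX'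

theorem StaysBelow.eventually {u : ℝ} (h : StaysBelow u ξ X X') :
    ∀ᶠ ξ' in 𝓝 ξ, StaysBelow u ξ' X X' := by
  have h1 : ∀ᶠ ξ' in 𝓝 ξ, ∀ Q ∈ Finset.range ⌈X'⌉₊, X ≤ (Q : ℝ) → (Q : ℝ) < X' →
      ∃ x, x ≠ 0 ∧ inorm x ≤ Q ∧ idist ξ' x < (Q : ℝ) ^ (-u) := by
    rw [eventually_all_finset]
    intro Q _
    by_cases hQ : X ≤ (Q : ℝ) ∧ (Q : ℝ) < X'
    · obtain ⟨x, hx, hn, hlt⟩ := h Q hQ.1 hQ.2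
      filter_upwards [eventually_idist_lt_const hlt] with ξ' h1
      exact fun _ _ => ⟨x, hx, hn, h1⟩
    · exact Eventually.of_forall fun _ h1 h2 => absurd ⟨h1, h2⟩ hQ
  filter_upwards [h1] with ξ' h2
  refine fun Q hX hX' => h2 Q ?_ hX hX'
  rw [Finset.mem_range]
  exact_mod_cast hX'.trans_le (Nat.le_ceil _)

theorem RisesAbove.eventually {u : ℝ} (h : RisesAbove u ξ X X') :
    ∀ᶠ ξ' in 𝓝 ξ, RisesAbove u ξ' X X' := by
  obtain ⟨Q, hX, hX', h⟩ := h
  have h1 : ∀ᶠ ξ' in 𝓝 ξ, ∀ x ∈ {x : Fin m → ℤ | inorm x ≤ Q}, x ≠ 0 →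
      Q ^ (-u) < idist ξ' x := by
    rw [eventually_all_finite (finite_inorm_le Q)]
    intro x hxn
    by_cases hx : x = 0
    · exact Eventually.of_forall fun _ h1 => absurd hx h1
    · filter_upwards [eventually_lt_idist (h x hx hxn)] with ξ' h1
      exact fun _ => h1
  filter_upwards [h1] with ξ' h2
  exact ⟨Q, hX, hX', fun x hx hxn => h2 x hxn hx⟩

end

theorem isStage_zero {n : ℕ} {C : ℝ} (hC : 1 ≤ C) : IsStage C (0 : Matrix (Fin n) (Fin 3) ℝ) 1 := by
  have hk : ∀ x : Fin 3 → ℤ, IsKer (0 : Matrix (Fin n) (Fin 3) ℝ) x := fun x =>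
    ⟨0, by ext; simp [resHom]⟩
  have hs : ∀ i : Fin 3, inorm (Pi.single i 1 : Fin 3 → ℤ) ≤ 1 := fun i => by
    refine inorm_le zero_le_one fun j => ?_
    by_cases h : j = i <;> simp [h]
  have hne : (Pi.single 0 1 : Fin 3 → ℤ) ≠ 0 := by simp
  refine ⟨⟨1, by simp, fun i => hk _⟩, ⟨Pi.single 0 1, hne, hk _, ?_⟩,
    fun x hx _ => one_le_inorm hx, Pi.single 0 1, Pi.single 1 1, hk _, hk _, ?_, ?_, ?_⟩
  · exact le_antisymm (hs 0) (one_le_inorm hne)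
  · exact (hs 0).trans (by linarith)
  · exact (hs 1).trans (by linarith)
  · intro a b hab
    exact ⟨by simpa using congrFun hab 0, by simpa using congrFun hab 1⟩

theorem exists_limit_matrix {n : ℕ} (hn : 1 ≤ n) : ∃ M : ℝ, 1 ≤ M ∧
    ∀ w ε N : ℕ → ℝ, (∀ k, 3 < n * w k) → (∀ k, (n - 1) * w k < 3) → (∀ k, 0 < ε k) →
      (∀ k, ε k < w k) → ∃ (ξ : Matrix (Fin n) (Fin 3) ℝ) (X : ℕ → ℝ), X 0 = 1 ∧ StrictMono X ∧
        (∀ k, N k ≤ X (k + 1)) ∧ ∀ k, Wins M ξ (X k) (X (k + 1)) ∧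
          StaysBelow (w k - ε k) ξ (X k) (X (k + 1)) ∧
          RisesAbove (w k + ε k) ξ (X k) (X (k + 1)) := by
  obtain ⟨C, M, hC, hM, hnext⟩ := exists_next_stage hn
  refine ⟨M, hM, fun w ε N hw hw' hε hεw => ?_⟩
  have : LocallyCompactSpace (Matrix (Fin n) (Fin 3) ℝ) :=
    inferInstanceAs (LocallyCompactSpace (Fin n → Fin 3 → ℝ))
  let σ := {s : (Matrix (Fin n) (Fin 3) ℝ × ℝ) × Set (Matrix (Fin n) (Fin 3) ℝ) //
    IsStage C s.1.1 s.1.2 ∧ s.2 ∈ 𝓝 s.1.1 ∧ IsCompact s.2}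
  have step : ∀ (k : ℕ) (s : σ), ∃ s' : σ, s'.1.2 ⊆ s.1.2 ∧ s.1.1.2 < s'.1.1.2 ∧
      N k ≤ s'.1.1.2 ∧ ∀ ξ ∈ s'.1.2, Wins M ξ s.1.1.2 s'.1.1.2 ∧
        StaysBelow (w k - ε k) ξ s.1.1.2 s'.1.1.2 ∧
        RisesAbove (w k + ε k) ξ s.1.1.2 s'.1.1.2 := by
    rintro k ⟨⟨⟨ξ, X⟩, K⟩, hst, hK, hKc⟩
    obtain ⟨ξ', hξ', X', hst', hX, hN, h1, h2, h3⟩ := hnext ξ X hst (w k) (hw k) (hw' k) (ε k)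
      (hε k) (hεw k) (interior K) (interior_mem_nhds.2 hK) (N k)
    obtain ⟨K', hK', hK's, hK'c⟩ := local_compact_nhds (x := ξ')
      (((isOpen_interior.eventually_mem hξ').and h1.eventually).and
        (h2.eventually.and h3.eventually))
    exact ⟨⟨⟨⟨ξ', X'⟩, K'⟩, hst', hK', hK'c⟩, fun ξ h => interior_subset (hK's h).1.1, hX, hN,
      fun ξ h => ⟨(hK's h).1.2, (hK's h).2.1, (hK's h).2.2⟩⟩
  choose f hf using step
  obtain ⟨K₀, hK₀c, hK₀⟩ := exists_compact_mem_nhds (0 : Matrix (Fin n) (Fin 3) ℝ)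
  let s : ℕ → σ := fun k => Nat.rec ⟨⟨⟨0, 1⟩, K₀⟩, isStage_zero hC, hK₀, hK₀c⟩ f k
  have hs : ∀ k, s (k + 1) = f k (s k) := fun k => rfl
  obtain ⟨ξ, hξ⟩ := IsCompact.nonempty_iInter_of_sequence_nonempty_isCompact_isClosed
    (fun k => (s k).1.2) (fun k => by rw [hs]; exact (hf k (s k)).1)
    (fun k => ⟨_, mem_of_mem_nhds (s k).2.2.1⟩) (s 0).2.2.2 (fun k => (s k).2.2.2.isClosed)
  rw [Set.mem_iInter] at hξ
  refine ⟨ξ, fun k => (s k).1.1.2, rfl, strictMono_nat_of_lt_succ fun k => ?_, fun k => ?_,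
    fun k => ?_⟩
  · exact (hf k (s k)).2.1
  · exact (hf k (s k)).2.2.1
  · have := hξ (k + 1)
    rw [hs] at this
    exact (hf k (s k)).2.2.2 ξ this

/-- The distance function `D` has uniform exponent `ω`, every vector is beaten by one of comparable
size, and `D` is so often small that `∑ Q ^ a * Ψ(Q) ^ b` converges for a bound `Ψ(Q)` of its minimum
over the vectors of norm at most `Q`. -/
structure IsGood {m : ℕ} (a b : ℕ) (ω : EReal) (D : (Fin m → ℤ) → ℝ) : Prop where
  pos : ∀ x, x ≠ 0 → 0 < D x
  ratio : ∃ M Q₀ : ℝ, ∀ x, x ≠ 0 → Q₀ ≤ inorm x → ∃ x', x' ≠ 0 ∧ inorm x' ≤ M * inorm x ∧ D x' < D x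
  upper : ∀ τ : ℝ, τ < ω → ∀ᶠ Q : ℕ in atTop,
    ∃ x, x ≠ 0 ∧ inorm x ≤ Q ∧ D x ≤ ((Q + 1 : ℕ) : ℝ) ^ (-τ)
  lower : ∀ τ : ℝ, ω < τ → ∃ᶠ Q : ℝ in atTop, ∀ x, x ≠ 0 → inorm x ≤ Q → Q ^ (-τ) ≤ D x
  sum : ∃ Ψ : ℕ → ℝ, (∀ Q, 0 ≤ Ψ Q) ∧ Summable (fun Q : ℕ => (Q : ℝ) ^ a * Ψ Q ^ b) ∧
    ∀ᶠ Q : ℕ in atTop, ∃ x, x ≠ 0 ∧ inorm x ≤ Q ∧ D x ≤ Ψ Q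

theorem exists_nat_inorm {m : ℕ} (x : Fin m → ℤ) : ∃ q : ℕ, inorm x = q := by
  refine ⟨Finset.univ.sup fun j => (x j).natAbs, le_antisymm ?_ ?_⟩
  · refine inorm_le (Nat.cast_nonneg _) fun j => ?_
    have := Finset.le_sup (f := fun j => (x j).natAbs) (Finset.mem_univ j)
    rw [← Int.cast_abs, ← Nat.cast_natAbs]
    exact_mod_cast this
  · rcases (Finset.univ : Finset (Fin m)).eq_empty_or_nonempty with h | h
    · rw [h]
      simpa using inorm_nonneg x
    · obtain ⟨j, -, hj⟩ := Finset.exists_mem_eq_sup _ h fun j => (x j).natAbs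
      rw [hj, Nat.cast_natAbs, Int.cast_abs]
      exact abs_le_inorm x j

theorem exists_min_lex {m : ℕ} (D : (Fin m → ℤ) → ℝ) (P : (Fin m → ℤ) → Prop) (hP : ∃ x, P x) :
    ∃ x, P x ∧ ∀ x', P x' → inorm x ≤ inorm x' ∧ (inorm x' = inorm x → D x ≤ D x') := by
  obtain ⟨x₀, h₀⟩ := hP
  obtain ⟨x₁, ⟨h₁, hn₁⟩, hmin₁⟩ := Set.exists_min_image {x | P x ∧ inorm x ≤ inorm x₀} inorm
    ((finite_inorm_le (inorm x₀)).subset fun x hx => hx.2) ⟨x₀, h₀, le_rfl⟩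
  have hmin₁' : ∀ x, P x → inorm x₁ ≤ inorm x := fun x hx => by
    by_cases h : inorm x ≤ inorm x₀
    · exact hmin₁ x ⟨hx, h⟩
    · exact hn₁.trans (not_le.1 h).le
  obtain ⟨x₂, ⟨h₂, hn₂⟩, hmin₂⟩ := Set.exists_min_image {x | P x ∧ inorm x ≤ inorm x₁} D
    ((finite_inorm_le (inorm x₁)).subset fun x hx => hx.2) ⟨x₁, h₁, le_rfl⟩
  exact ⟨x₂, h₂, fun x hx => ⟨hn₂.trans (hmin₁' x hx), fun he => hmin₂ x ⟨hx, he.le.trans hn₂⟩⟩⟩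

section

variable {m n a b : ℕ} {ω : EReal}

theorem IsGood.exists_lt {D : (Fin m → ℤ) → ℝ} (h : IsGood a b ω D) (hω : 0 < ω) {c : ℝ}
    (hc : 0 < c) : ∃ x, x ≠ 0 ∧ D x < c := by
  obtain ⟨τ, hτ, hτω⟩ := EReal.lt_iff_exists_real_btwn.1 hω
  have hτ' : 0 < τ := by exact_mod_cast hτ
  have h1 : Tendsto (fun Q : ℕ => ((Q + 1 : ℕ) : ℝ) ^ (-τ)) atTop (𝓝 0) :=
    (tendsto_rpow_neg_atTop hτ').comp
      (tendsto_natCast_atTop_atTop.comp (tendsto_add_atTop_nat 1))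
  obtain ⟨Q, ⟨x, hx, -, hxD⟩, hQ⟩ := ((h.upper τ hτω).and (h1.eventually_lt_const hc)).exists
  exact ⟨x, hx, hxD.trans_lt hQ⟩

/-- The successive minimal points of a distance function. -/
theorem IsGood.exists_minimal_points {D : (Fin m → ℤ) → ℝ} (h : IsGood a b ω D) (hω : 0 < ω)
    (hm : 1 ≤ m) : ∃ x : ℕ → Fin m → ℤ, (∀ i, x i ≠ 0) ∧ inorm (x 0) = 1 ∧
      StrictMono (fun i => inorm (x i)) ∧ StrictAnti (fun i => D (x i)) ∧
      ∀ i u, u ≠ 0 → D u < D (x i) → inorm (x (i + 1)) ≤ inorm u := by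
  have step : ∀ x : {x : Fin m → ℤ // x ≠ 0}, ∃ x' : {x : Fin m → ℤ // x ≠ 0}, D x' < D x ∧
      ∀ u, u ≠ 0 → D u < D x → inorm x'.1 ≤ inorm u ∧ (inorm u = inorm x'.1 → D x' ≤ D u) := by
    rintro ⟨x, hx⟩
    obtain ⟨x', ⟨hx', hlt⟩, hmin⟩ := exists_min_lex D (fun u => u ≠ 0 ∧ D u < D x)
      (h.exists_lt hω (h.pos x hx))
    exact ⟨⟨x', hx'⟩, hlt, fun u hu hul => hmin u ⟨hu, hul⟩⟩
  choose f hf1 hf2 using step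
  have hne : (Pi.single ⟨0, hm⟩ 1 : Fin m → ℤ) ≠ 0 := by simp
  obtain ⟨x₀, h₀, hmin₀⟩ := exists_min_lex D (fun u => u ≠ 0) ⟨_, hne⟩
  have hx₀ : inorm x₀ = 1 := by
    refine le_antisymm ((hmin₀ _ hne).1.trans ?_) (one_le_inorm h₀)
    refine inorm_le zero_le_one fun j => ?_
    by_cases hj : j = ⟨0, hm⟩ <;> simp [hj]
  let x : ℕ → {x : Fin m → ℤ // x ≠ 0} := fun i => Nat.rec ⟨x₀, h₀⟩ (fun _ => f) i
  have hs : ∀ i, x (i + 1) = f (x i) := fun i => rfl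
  have hmin : ∀ i u, u ≠ 0 → inorm u ≤ inorm (x i).1 → D (x i).1 ≤ D u := by
    intro i
    induction i with
    | zero =>
      intro u hu hn
      exact (hmin₀ u hu).2 (le_antisymm hn (hmin₀ u hu).1)
    | succ i ih =>
      intro u hu hn
      rw [hs] at hn ⊢
      rcases lt_or_ge (D u) (D (x i).1) with hlt | hge
      · obtain ⟨h1, h2⟩ := hf2 (x i) u hu hlt
        exact h2 (le_antisymm hn h1)
      · exact (hf1 (x i)).le.trans hge
  refine ⟨fun i => (x i).1, fun i => (x i).2, hx₀, strictMono_nat_of_lt_succ fun i => ?_,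
    strictAnti_nat_of_succ_lt fun i => ?_, fun i u hu hlt => ?_⟩
  · by_contra! hcon
    exact absurd (hf1 (x i)) (not_lt.2 (hmin i _ (x (i + 1)).2 hcon))
  · exact hf1 (x i)
  · exact (hf2 (x i) u hu hlt).1

theorem IsGood.totallyIrrational {ξ : Matrix (Fin n) (Fin m) ℝ} (h : IsGood a b ω (idist ξ)) :
    TotallyIrrational ξ := by
  intro u v huv
  change 0 < ‖resHom ξ (u, v)‖
  by_cases hu : u = 0
  · refine norm_pos_iff.2 fun h0 => huv ?_
    exact eq_zero_of_resHom_eq_zero h0 hu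
  · exact (h.pos u hu).trans_le (idist_le ξ (u, v))

theorem IsGood.not_propA {ξ : Matrix (Fin n) (Fin m) ℝ} (hm : 1 ≤ m)
    (h : IsGood (m - 1) n ω (idist ξ)) : ¬ PropA ξ := by
  rintro ⟨c, hc, hA⟩
  obtain ⟨Ψ, hΨ, hsum, hev⟩ := h.sum
  refine Real.not_summable_one_div_natCast ?_
  have h1 : ∀ᶠ Q : ℕ in atTop, ‖1 / (Q : ℝ)‖ ≤ c⁻¹ * ((Q : ℝ) ^ (m - 1) * Ψ Q ^ n) := by
    filter_upwards [hev, eventually_ge_atTop 1] with Q hQ hQ1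
    obtain ⟨x, hx, hxn, hxD⟩ := hQ
    obtain ⟨y, hy⟩ := exists_idist_eq ξ x
    have h2 : c ≤ inorm x ^ m * idist ξ x ^ n := by
      rw [hy]
      exact hA x y hx
    have hQ' : (0 : ℝ) < Q := by exact_mod_cast hQ1
    have h3 : inorm x ^ m * idist ξ x ^ n ≤ (Q : ℝ) ^ m * Ψ Q ^ n :=
      mul_le_mul (pow_le_pow_left₀ (inorm_nonneg x) hxn m)
        (pow_le_pow_left₀ (idist_nonneg ξ x) hxD n) (pow_nonneg (idist_nonneg ξ x) n) (by positivity)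
    have e : (Q : ℝ) ^ m = Q * (Q : ℝ) ^ (m - 1) := by
      rw [← pow_succ', Nat.sub_add_cancel hm]
    rw [e] at h3
    rw [Real.norm_of_nonneg (by positivity), div_le_iff₀ hQ', inv_mul_eq_div, div_mul_eq_mul_div,
      le_div_iff₀ hc]
    linarith
  exact Summable.of_norm_bounded_eventually_nat (hsum.mul_left c⁻¹) h1

end

theorem inorm_natCast_strictMono {m : ℕ} {x : ℕ → Fin m → ℤ}
    (hx : StrictMono fun i => inorm (x i)) :
    ∃ q : ℕ → ℕ, StrictMono q ∧ ∀ i, inorm (x i) = q i := by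
  choose q hq using fun i => exists_nat_inorm (x i)
  refine ⟨q, fun i j hij => ?_, hq⟩
  have := hx hij
  simp only [hq] at this
  exact_mod_cast this

section

variable {m n a b : ℕ} {ω : EReal} {ξ : Matrix (Fin n) (Fin m) ℝ} {x : ℕ → Fin m → ℤ}

theorem IsGood.propB (h : IsGood a b ω (idist ξ)) (h0 : ∀ i, x i ≠ 0)
    (hmono : StrictMono fun i => inorm (x i))
    (hnext : ∀ i u, u ≠ 0 → idist ξ u < idist ξ (x i) → inorm (x (i + 1)) ≤ inorm u) : PropB x := by
  obtain ⟨q, hq, hqx⟩ := inorm_natCast_strictMono hmono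
  obtain ⟨M, Q₀, hM⟩ := h.ratio
  have hev : ∀ᶠ i in atTop, Xval x (i + 1) / Xval x i ≤ M := by
    filter_upwards [eventually_ge_atTop ⌈Q₀⌉₊] with i hi
    have hQ : Q₀ ≤ inorm (x i) := by
      rw [hqx]
      refine (Nat.le_ceil Q₀).trans ?_
      exact_mod_cast hi.trans (hq.id_le i)
    obtain ⟨x', hx', hn, hlt⟩ := hM (x i) (h0 i) hQ
    have h1 := (hnext i x' hx' hlt).trans hn
    exact (div_le_iff₀ (inorm_pos (h0 i))).2 h1
  obtain ⟨N, hN⟩ := eventually_atTop.1 hev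
  obtain ⟨M', hM'⟩ := ((Set.finite_Iio N).image fun i => Xval x (i + 1) / Xval x i).bddAbove
  refine ⟨max M M', fun i => ?_⟩
  rcases lt_or_ge i N with hi | hi
  · exact le_max_of_le_right (hM' ⟨i, hi, rfl⟩)
  · exact le_max_of_le_left (hN i hi)

theorem IsGood.unifExp_eq (h : IsGood a b ω (idist ξ)) (hω : 0 < ω) {y : ℕ → Fin n → ℤ}
    (h0 : ∀ i, x i ≠ 0) (hfirst : inorm (x 0) = 1) (hmono : StrictMono fun i => inorm (x i))
    (hy : ∀ i, Lval ξ x y i = idist ξ (x i))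
    (hnext : ∀ i u, u ≠ 0 → idist ξ u < idist ξ (x i) → inorm (x (i + 1)) ≤ inorm u) :
    unifExp ξ x y = ω := by
  obtain ⟨q, hq, hqx⟩ := inorm_natCast_strictMono hmono
  have hX : ∀ i, Xval x i = q i := hqx
  have hq0 : q 0 = 1 := by
    rw [hqx] at hfirst
    exact_mod_cast hfirst
  have hq2 : ∀ i, 1 < q (i + 1) := fun i => by
    have := hq (Nat.succ_pos i)
    rwa [hq0] at this
  have hlog : ∀ i, 0 < Real.log (q (i + 1)) := fun i => Real.log_pos (by exact_mod_cast hq2 i)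
  have hD : ∀ i, 0 < idist ξ (x i) := fun i => h.pos _ (h0 i)
  unfold unifExp
  simp only [hX, hy]
  refine le_antisymm ?_ ?_
  · refine le_of_forall_gt fun c hc => ?_
    obtain ⟨τ, hτ, hτc⟩ := EReal.lt_iff_exists_real_btwn.1 hc
    refine lt_of_le_of_lt (liminf_le_of_frequently_le ?_) hτc
    have hτ0 : 0 < τ := by exact_mod_cast hω.trans hτ
    rw [frequently_atTop]
    intro N
    obtain ⟨Q, hQN, hQ⟩ := frequently_atTop.1 (h.lower τ hτ) (q (N + 1))
    have hex : ∃ i, Q < q (i + 1) := by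
      obtain ⟨i, hi⟩ := exists_nat_gt Q
      exact ⟨i, hi.trans_le (by exact_mod_cast (Nat.le_succ i).trans (hq.id_le (i + 1)))⟩
    classical
    obtain ⟨i, hi, himin⟩ : ∃ i, Q < q (i + 1) ∧ ∀ j < i, (q (j + 1) : ℝ) ≤ Q :=
      ⟨Nat.find hex, Nat.find_spec hex, fun j hj => not_lt.1 (Nat.find_min hex hj)⟩
    have hNi : N < i := by
      have h1 : (q (N + 1) : ℝ) < q (i + 1) := hQN.trans_lt hi
      have h2 : q (N + 1) < q (i + 1) := by exact_mod_cast h1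
      have := hq.lt_iff_lt.1 h2
      omega
    have hqi : (q i : ℝ) ≤ Q := by
      have := himin (i - 1) (by omega)
      rwa [Nat.sub_add_cancel (by omega)] at this
    have hQpos : 0 < Q := by
      have : (0 : ℝ) < q (N + 1) := by exact_mod_cast zero_lt_one.trans (hq2 N)
      linarith
    refine ⟨i, hNi.le, ?_⟩
    rw [EReal.coe_le_coe_iff, div_le_iff₀ (hlog i)]
    have h1 := Real.log_le_log (by positivity) (hQ (x i) (h0 i) (by rw [hqx]; exact hqi))
    rw [Real.log_rpow hQpos] at h1
    have h2 := mul_le_mul_of_nonneg_left (Real.log_le_log hQpos hi.le) hτ0.le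
    linarith
  · refine le_of_forall_lt fun c hc => ?_
    obtain ⟨τ, hcτ, hτ⟩ := EReal.lt_iff_exists_real_btwn.1 hc
    refine lt_of_lt_of_le hcτ (le_liminf_of_le (by isBoundedDefault) ?_)
    have h1 : Tendsto (fun i => q (i + 1) - 1) atTop atTop :=
      (tendsto_sub_atTop_nat 1).comp (hq.tendsto_atTop.comp (tendsto_add_atTop_nat 1))
    filter_upwards [h1.eventually (h.upper τ hτ)] with i hi
    obtain ⟨u, hu, hun, huD⟩ := hi
    rw [Nat.sub_add_cancel (hq2 i).le] at huD
    rw [EReal.coe_le_coe_iff, le_div_iff₀ (hlog i)]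
    have h2 : idist ξ (x i) ≤ idist ξ u := by
      by_contra! hlt
      have h3 := (hnext i u hu hlt).trans hun
      rw [hqx] at h3
      have h4 : q (i + 1) ≤ q (i + 1) - 1 := by exact_mod_cast h3
      have := hq2 i
      omega
    have h3 := Real.log_le_log (hD i) (h2.trans huD)
    rw [Real.log_rpow (by exact_mod_cast zero_lt_one.trans (hq2 i))] at h3
    linarith

theorem IsGood.exists_bestApproxSeq (hm : 1 ≤ m) (h : IsGood (m - 1) n ω (idist ξ)) (hω : 0 < ω) :
    ∃ (x : ℕ → Fin m → ℤ) (y : ℕ → Fin n → ℤ), TotallyIrrational ξ ∧ IsBestApproxSeq ξ x y ∧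
      PropB x ∧ ¬ PropA ξ ∧ unifExp ξ x y = ω := by
  obtain ⟨x, h0, hfirst, hmono, hanti, hnext⟩ := h.exists_minimal_points hω hm
  choose y hy using fun i => exists_idist_eq ξ (x i)
  have hL : ∀ i, Lval ξ x y i = idist ξ (x i) := fun i => (hy i).symm
  refine ⟨x, y, h.totallyIrrational, ⟨h0, hfirst, hmono, ?_, fun i u v hu hlt => ?_⟩,
    h.propB h0 hmono hnext, h.not_propA hm, h.unifExp_eq hω h0 hfirst hmono hL hnext⟩
  · intro i j hij
    rw [hL, hL]
    exact hanti hij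
  · rw [hL]
    refine le_trans ?_ (idist_le ξ (u, v))
    by_contra! hcon
    exact absurd (hnext i u hu hcon) (not_le.2 hlt)

end

open MeasureTheory

/-- The matrix obtained from `ξ` by adding a first column `η`. -/
def addCol {m n : ℕ} (η : Fin n → ℝ) (ξ : Matrix (Fin n) (Fin m) ℝ) : Matrix (Fin n) (Fin (m + 1)) ℝ :=
  Matrix.of fun i => Fin.cons (η i) (ξ i)

section

variable {m n : ℕ} (η : Fin n → ℝ) (ξ : Matrix (Fin n) (Fin m) ℝ)

theorem addCol_mulVec (x : Fin (m + 1) → ℝ) (i : Fin n) :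
    (addCol η ξ *ᵥ x) i = η i * x 0 + (ξ *ᵥ Fin.tail x) i := by
  simp [addCol, mulVec, dotProduct, Fin.sum_univ_succ, Fin.tail]

theorem idist_addCol_cons_zero (x : Fin m → ℤ) :
    idist (addCol η ξ) (Fin.cons 0 x) = idist ξ x := by
  have h : (addCol η ξ *ᵥ fun j => ((Fin.cons 0 x : Fin (m + 1) → ℤ) j : ℝ)) =
      ξ *ᵥ fun j => (x j : ℝ) := by
    ext i
    rw [addCol_mulVec]
    simp [Fin.tail_def]
  unfold idist
  simp only [resHom, AddMonoidHom.coe_mk, ZeroHom.coe_mk, h]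

theorem idist_addCol_le_iff {x : Fin (m + 1) → ℤ} {δ : ℝ} (hδ : 0 ≤ δ) :
    idist (addCol η ξ) x ≤ δ ↔ ∀ i, x 0 • (η i : UnitAddCircle) +
      (((ξ *ᵥ fun j => (Fin.tail x j : ℝ)) i : ℝ) : UnitAddCircle) ∈ Metric.closedBall 0 δ := by
  unfold idist
  rw [pi_norm_le_iff_of_nonneg hδ]
  refine forall_congr' fun i => ?_
  rw [mem_closedBall_zero_iff, ← AddCircle.coe_zsmul, ← AddCircle.coe_add, UnitAddCircle.norm_eq]
  have h : (addCol η ξ *ᵥ fun j => (x j : ℝ)) i =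
      x 0 • η i + (ξ *ᵥ fun j => (Fin.tail x j : ℝ)) i := by
    rw [addCol_mulVec, zsmul_eq_mul, mul_comm]
    rfl
  simp only [resHom, AddMonoidHom.coe_mk, ZeroHom.coe_mk, Pi.sub_apply, h, Real.norm_eq_abs]

end

theorem volume_setOf_zsmul_add_le {n : ℕ} {z : ℤ} (hz : z ≠ 0) (c : Fin n → UnitAddCircle)
    (δ : ℝ) : volume {ζ : Fin n → UnitAddCircle | ∀ i, z • ζ i + c i ∈ Metric.closedBall 0 δ} ≤
      ENNReal.ofReal (2 * δ) ^ n := by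
  have h : {ζ : Fin n → UnitAddCircle | ∀ i, z • ζ i + c i ∈ Metric.closedBall 0 δ} =
      Set.univ.pi fun i => (fun t : UnitAddCircle => z • t + c i) ⁻¹' Metric.closedBall 0 δ := by
    ext ζ
    simp
  rw [h, volume_pi_pi]
  refine (Finset.prod_le_pow_card _ _ (ENNReal.ofReal (2 * δ)) fun i _ => ?_).trans (by simp)
  have hmp : MeasurePreserving (fun t : UnitAddCircle => z • t + c i) volume volume :=
    (measurePreserving_add_right volume (c i)).comp (Measure.measurePreserving_zsmul volume hz)
  rw [hmp.measure_preimage measurableSet_closedBall.nullMeasurableSet,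
    AddCircle.volume_closedBall]
  exact ENNReal.ofReal_le_ofReal (min_le_right _ _)

theorem exists_finset_inorm_eq (m Q : ℕ) : ∃ s : Finset (Fin (m + 1) → ℤ),
    (∀ x, inorm x = Q → x ∈ s) ∧ s.card ≤ 2 * (m + 1) * (2 * Q + 1) ^ m := by
  classical
  refine ⟨((Finset.univ ×ˢ {(Q : ℤ), -(Q : ℤ)}) ×ˢ
    Fintype.piFinset fun _ : Fin m => Finset.Icc (-(Q : ℤ)) Q).image
      fun p => Fin.insertNth p.1.1 p.1.2 p.2, fun x hx => ?_, ?_⟩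
  · have hle : ∀ j, |x j| ≤ (Q : ℤ) := fun j => by
      have := abs_le_inorm x j
      rw [hx] at this
      exact_mod_cast this
    obtain ⟨j, hj⟩ : ∃ j, |x j| = (Q : ℤ) := by
      by_contra! hne
      rcases Nat.eq_zero_or_pos Q with rfl | hQ
      · exact hne 0 (le_antisymm (hle 0) (abs_nonneg _))
      · have : inorm x ≤ Q - 1 := by
          refine inorm_le (by simp; exact_mod_cast hQ) fun j => ?_
          have := lt_of_le_of_ne (hle j) (hne j)
          have : |x j| ≤ (Q : ℤ) - 1 := by omega
          exact_mod_cast this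
        linarith
    rw [Finset.mem_image]
    refine ⟨((j, x j), fun i => x (j.succAbove i)), ?_, ?_⟩
    · simp only [Finset.mem_product, Finset.mem_univ, true_and, Finset.mem_insert,
        Finset.mem_singleton, Fintype.mem_piFinset, Finset.mem_Icc]
      exact ⟨(abs_eq (Nat.cast_nonneg Q)).1 hj, fun i => abs_le.1 (hle _)⟩
    · exact Fin.insertNth_self_removeNth j x
  · refine Finset.card_image_le.trans ?_
    rw [Finset.card_product, Finset.card_product, Fintype.card_piFinset_const]
    have h1 := Finset.card_le_two (a := (Q : ℤ)) (b := -(Q : ℤ))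
    have h2 : (Finset.Icc (-(Q : ℤ)) Q).card = 2 * Q + 1 := by
      rw [Int.card_Icc]
      omega
    rw [h2, Finset.card_univ, Fintype.card_fin]
    refine Nat.mul_le_mul_right _ ?_
    rw [mul_comm]
    exact Nat.mul_le_mul_right _ h1

theorem exists_column {m n : ℕ} (hn : 1 ≤ n) (ξ : Matrix (Fin n) (Fin m) ℝ) {Ψ : ℕ → ℝ}
    (hΨ : ∀ Q, 0 ≤ Ψ Q) (hsum : Summable fun Q : ℕ => (Q : ℝ) ^ m * Ψ Q ^ n) :
    ∃ η : Fin n → ℝ, (∀ x, x 0 ≠ 0 → 0 < idist (addCol η ξ) x) ∧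
      ∀ᶠ Q : ℕ in atTop, ∀ x, x 0 ≠ 0 → inorm x = Q → Ψ Q < idist (addCol η ξ) x := by
  set A : (Fin (m + 1) → ℤ) → ℝ → Set (Fin n → UnitAddCircle) := fun x δ =>
    {ζ | ∀ i, x 0 • ζ i + (((ξ *ᵥ fun j => (Fin.tail x j : ℝ)) i : ℝ) : UnitAddCircle) ∈
      Metric.closedBall 0 δ} with hA
  have hvol : ∀ x δ, x 0 ≠ 0 → volume (A x δ) ≤ ENNReal.ofReal (2 * δ) ^ n := fun x δ hx =>
    volume_setOf_zsmul_add_le hx _ δ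
  choose s hs hcard using exists_finset_inorm_eq m
  set E : ℕ → Set (Fin n → UnitAddCircle) := fun Q => ⋃ x ∈ (s Q).filter fun x => x 0 ≠ 0, A x (Ψ Q)
    with hE
  have hEvol : ∀ Q, volume (E Q) ≤
      ENNReal.ofReal ((2 * (m + 1) * (2 * Q + 1) ^ m : ℕ) * (2 * Ψ Q) ^ n) := fun Q => by
    refine (measure_biUnion_finset_le _ _).trans ?_
    refine (Finset.sum_le_card_nsmul _ _ (ENNReal.ofReal (2 * Ψ Q) ^ n) fun x hx =>
      hvol x _ (Finset.mem_filter.1 hx).2).trans ?_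
    rw [nsmul_eq_mul, ENNReal.ofReal_mul (Nat.cast_nonneg _), ENNReal.ofReal_natCast,
      ENNReal.ofReal_pow (mul_nonneg zero_le_two (hΨ Q))]
    refine mul_le_mul_left ?_ _
    exact_mod_cast (Finset.card_filter_le _ _).trans (hcard Q)
  have hEsum : ∑' Q, volume (E Q) ≠ ⊤ := by
    have h1 : Summable fun Q : ℕ =>
        ((2 * (m + 1) * (2 * Q + 1) ^ m : ℕ) : ℝ) * (2 * Ψ Q) ^ n := by
      refine Summable.of_norm_bounded_eventually_nat
        (hsum.mul_left (2 * (m + 1) * 3 ^ m * 2 ^ n : ℝ)) ?_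
      filter_upwards [eventually_ge_atTop 1] with Q hQ
      have hQ' : (1 : ℝ) ≤ Q := by exact_mod_cast hQ
      have h2 : (2 * (Q : ℝ) + 1) ^ m ≤ (3 * Q) ^ m :=
        pow_le_pow_left₀ (by positivity) (by linarith) m
      have h3 := pow_nonneg (hΨ Q) n
      rw [Real.norm_of_nonneg (mul_nonneg (Nat.cast_nonneg _)
        (pow_nonneg (mul_nonneg zero_le_two (hΨ Q)) n))]
      push_cast
      calc 2 * ((m : ℝ) + 1) * (2 * Q + 1) ^ m * (2 * Ψ Q) ^ n
          ≤ 2 * ((m : ℝ) + 1) * (3 * Q) ^ m * (2 * Ψ Q) ^ n := by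
            have := hΨ Q
            gcongr
        _ = _ := by rw [mul_pow, mul_pow]; ring
    refine ne_top_of_le_ne_top ?_ (ENNReal.tsum_le_tsum hEvol)
    rw [← ENNReal.ofReal_tsum_of_nonneg (fun Q => mul_nonneg (Nat.cast_nonneg _)
        (pow_nonneg (mul_nonneg zero_le_two (hΨ Q)) n)) h1]
    exact ENNReal.ofReal_ne_top
  have hzero : ∀ᵐ ζ : Fin n → UnitAddCircle, ∀ x : Fin (m + 1) → ℤ, x 0 ≠ 0 → ζ ∉ A x 0 := by
    rw [ae_all_iff]
    intro x
    by_cases hx : x 0 = 0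
    · exact Eventually.of_forall fun _ h => absurd hx h
    · have : volume (A x 0) = 0 := by
        have h1 := hvol x 0 hx
        rw [mul_zero, ENNReal.ofReal_zero, zero_pow (by omega)] at h1
        exact le_antisymm h1 zero_le
      filter_upwards [measure_eq_zero_iff_ae_notMem.1 this] with ζ h
      exact fun _ => h
  obtain ⟨ζ, hζ1, hζ2⟩ := (hzero.and (ae_eventually_notMem hEsum)).exists
  choose η hη using fun i => QuotientAddGroup.mk_surjective (ζ i)
  have hmem : ∀ x δ, 0 ≤ δ → (idist (addCol η ξ) x ≤ δ ↔ ζ ∈ A x δ) := fun x δ hδ => by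
    rw [idist_addCol_le_iff η ξ hδ]
    refine forall_congr' fun i => ?_
    rw [← hη]
  refine ⟨η, fun x hx => ?_, ?_⟩
  · have := mt (hmem x 0 le_rfl).1 (hζ1 x hx)
    exact not_le.1 this
  · filter_upwards [hζ2] with Q hQ x hx hxQ
    refine not_le.1 fun hle => hQ ?_
    rw [hE]
    refine Set.mem_biUnion (x := x) ?_ ((hmem x _ (hΨ Q)).1 hle)
    exact Finset.mem_coe.2 (Finset.mem_filter.2 ⟨hs Q x hxQ, hx⟩)

theorem inorm_cons_zero {m : ℕ} (x : Fin m → ℤ) : inorm (Fin.cons 0 x : Fin (m + 1) → ℤ) = inorm x := by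
  refine le_antisymm (inorm_le (inorm_nonneg x) fun j => ?_) (inorm_le (inorm_nonneg _) fun j => ?_)
  · refine Fin.cases ?_ (fun i => ?_) j
    · simpa using inorm_nonneg x
    · simpa using abs_le_inorm x i
  · simpa using abs_le_inorm (Fin.cons 0 x : Fin (m + 1) → ℤ) j.succ

theorem cons_zero_ne_zero {m : ℕ} {x : Fin m → ℤ} :
    (Fin.cons 0 x : Fin (m + 1) → ℤ) ≠ 0 ↔ x ≠ 0 := by
  refine not_congr ⟨fun h => funext fun i => ?_, fun h => ?_⟩
  · simpa using congrFun h i.succ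
  · subst h
    exact funext fun j => Fin.cases rfl (fun _ => rfl) j

theorem IsGood.exists_addCol {m n a : ℕ} {ω : EReal} {ξ : Matrix (Fin n) (Fin m) ℝ}
    (h : IsGood a n ω (idist ξ)) (ha : m ≤ a) (hn : 1 ≤ n) (hω : 0 < ω) :
    ∃ η, IsGood a n ω (idist (addCol η ξ)) := by
  obtain ⟨Ψ, hΨ, hsum, hΨx⟩ := h.sum
  obtain ⟨η, hpos, hη⟩ := exists_column hn ξ hΨ <| by
    refine Summable.of_norm_bounded_eventually_nat hsum ?_
    filter_upwards [eventually_ge_atTop 1] with Q hQ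
    have hQ' : (1 : ℝ) ≤ Q := by exact_mod_cast hQ
    have h1 := pow_nonneg (hΨ Q) n
    rw [Real.norm_of_nonneg (mul_nonneg (by positivity) h1)]
    exact mul_le_mul_of_nonneg_right (pow_le_pow_right₀ hQ' ha) h1
  have hcases : ∀ x : Fin (m + 1) → ℤ, x ≠ 0 →
      x 0 ≠ 0 ∨ ∃ z, z ≠ 0 ∧ x = Fin.cons 0 z := fun x hx => by
    by_cases h0 : x 0 = 0
    · have hxz : x = Fin.cons 0 (Fin.tail x) := by rw [← h0, Fin.cons_self_tail]
      exact Or.inr ⟨Fin.tail x, cons_zero_ne_zero.1 (hxz ▸ hx), hxz⟩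
    · exact Or.inl h0
  have hposx : ∀ x, x ≠ 0 → 0 < idist (addCol η ξ) x := fun x hx => by
    obtain h0 | ⟨z, hz, rfl⟩ := hcases x hx
    · exact hpos x h0
    · rw [idist_addCol_cons_zero]
      exact h.pos z hz
  obtain ⟨K, hK⟩ := eventually_atTop.1 (hΨx.and hη)
  have hbeat : ∀ x : Fin (m + 1) → ℤ, x 0 ≠ 0 → (K : ℝ) ≤ inorm x →
      ∃ z, z ≠ 0 ∧ inorm z ≤ inorm x ∧ idist ξ z < idist (addCol η ξ) x := fun x hx hxK => by
    obtain ⟨q, hq⟩ := exists_nat_inorm x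
    obtain ⟨⟨z, hz, hzq, hzΨ⟩, hq2⟩ := hK q (by rw [hq] at hxK; exact_mod_cast hxK)
    exact ⟨z, hz, hq ▸ hzq, hzΨ.trans_lt (hq2 x hx hq)⟩
  refine ⟨η, hposx, ?_, fun τ hτ => ?_, fun τ hτ => ?_, Ψ, hΨ, hsum, ?_⟩
  · obtain ⟨M, Q₀, hM⟩ := h.ratio
    refine ⟨max M 1, max Q₀ K, fun x hx hxQ => ?_⟩
    obtain h0 | ⟨z, hz, rfl⟩ := hcases x hx
    · obtain ⟨z, hz, hzx, hzD⟩ := hbeat x h0 ((le_max_right _ _).trans hxQ)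
      refine ⟨Fin.cons 0 z, cons_zero_ne_zero.2 hz, ?_, by rwa [idist_addCol_cons_zero]⟩
      rw [inorm_cons_zero]
      exact hzx.trans (le_mul_of_one_le_left (inorm_nonneg x) (le_max_right _ _))
    · rw [inorm_cons_zero] at hxQ
      obtain ⟨z', hz', hzz, hzD⟩ := hM z hz ((le_max_left _ _).trans hxQ)
      refine ⟨Fin.cons 0 z', cons_zero_ne_zero.2 hz', ?_, by rwa [idist_addCol_cons_zero,
        idist_addCol_cons_zero]⟩
      rw [inorm_cons_zero, inorm_cons_zero]
      exact hzz.trans (mul_le_mul_of_nonneg_right (le_max_left _ _) (inorm_nonneg z))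
  · filter_upwards [h.upper τ hτ] with Q ⟨z, hz, hzQ, hzD⟩
    exact ⟨Fin.cons 0 z, cons_zero_ne_zero.2 hz, by rwa [inorm_cons_zero],
      by rwa [idist_addCol_cons_zero]⟩
  · have hτ0 : 0 < τ := by exact_mod_cast hω.trans hτ
    obtain ⟨c, hc, hcx⟩ : ∃ c > 0, ∀ x : Fin (m + 1) → ℤ, x ≠ 0 → inorm x ≤ K →
        c ≤ idist (addCol η ξ) x := by
      have hfin : {x : Fin (m + 1) → ℤ | x ≠ 0 ∧ inorm x ≤ K}.Finite :=
        (finite_inorm_le K).subset fun x hx => hx.2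
      rcases Set.eq_empty_or_nonempty {x : Fin (m + 1) → ℤ | x ≠ 0 ∧ inorm x ≤ K} with he | hne
      · exact ⟨1, one_pos, fun x hx hxK => absurd (show x ∈ {x | x ≠ 0 ∧ inorm x ≤ K} from
          ⟨hx, hxK⟩) (he ▸ Set.notMem_empty x)⟩
      · obtain ⟨x, hx, hmin⟩ := Set.exists_min_image _ (idist (addCol η ξ)) hfin hne
        exact ⟨_, hposx x hx.1, fun x' h1 h2 => hmin x' ⟨h1, h2⟩⟩
    have hev := (tendsto_rpow_neg_atTop hτ0).eventually_lt_const hc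
    refine ((h.lower τ hτ).and_eventually hev).mono fun Q ⟨hQ, hQc⟩ x hx hxQ => ?_
    obtain h0 | ⟨z, hz, rfl⟩ := hcases x hx
    · rcases le_total (inorm x) K with hxK | hxK
      · exact hQc.le.trans (hcx x hx hxK)
      · obtain ⟨z, hz, hzx, hzD⟩ := hbeat x h0 hxK
        exact (hQ z hz (hzx.trans hxQ)).trans hzD.le
    · rw [inorm_cons_zero] at hxQ
      rw [idist_addCol_cons_zero]
      exact hQ z hz hxQ
  · filter_upwards [hΨx] with Q ⟨z, hz, hzQ, hzD⟩
    exact ⟨Fin.cons 0 z, cons_zero_ne_zero.2 hz, by rwa [inorm_cons_zero],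
      by rwa [idist_addCol_cons_zero]⟩

theorem IsGood.exists_of_le {m l n a : ℕ} {ω : EReal} {ξ : Matrix (Fin n) (Fin l) ℝ}
    (h : IsGood a n ω (idist ξ)) (hlm : l ≤ m) (hma : m ≤ a + 1) (hn : 1 ≤ n) (hω : 0 < ω) :
    ∃ ξ' : Matrix (Fin n) (Fin m) ℝ, IsGood a n ω (idist ξ') := by
  induction m, hlm using Nat.le_induction with
  | base => exact ⟨ξ, h⟩
  | succ k hk ih =>
    obtain ⟨ξ', hξ'⟩ := ih (by omega)
    obtain ⟨η, hη⟩ := hξ'.exists_addCol (by omega) hn hω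
    exact ⟨_, hη⟩

/-- The matrix obtained from `ξ` by adding zero rows. -/
def padRows {m p : ℕ} (n : ℕ) (ξ : Matrix (Fin p) (Fin m) ℝ) : Matrix (Fin n) (Fin m) ℝ :=
  Matrix.of fun i j => if h : (i : ℕ) < p then ξ ⟨i, h⟩ j else 0

theorem idist_padRows {m n p : ℕ} (hpn : p ≤ n) (ξ : Matrix (Fin p) (Fin m) ℝ) :
    idist (padRows n ξ) = idist ξ := by
  ext x
  have h1 : ∀ (i : Fin n) (h : (i : ℕ) < p), (padRows n ξ *ᵥ fun j => (x j : ℝ)) i =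
      (ξ *ᵥ fun j => (x j : ℝ)) ⟨i, h⟩ := fun i h => by
    simp [padRows, mulVec, dotProduct, h]
  have h2 : ∀ i : Fin n, ¬ (i : ℕ) < p → (padRows n ξ *ᵥ fun j => (x j : ℝ)) i = 0 := fun i h => by
    simp [padRows, mulVec, dotProduct, h]
  unfold idist
  simp only [resHom, AddMonoidHom.coe_mk, ZeroHom.coe_mk]
  refine le_antisymm ?_ ?_
  · refine (pi_norm_le_iff_of_nonneg (norm_nonneg _)).2 fun i => ?_
    by_cases h : (i : ℕ) < p
    · simp only [Pi.sub_apply, h1 i h]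
      exact norm_le_pi_norm ((ξ *ᵥ fun j => (x j : ℝ)) -
        fun k => (round ((ξ *ᵥ fun j => (x j : ℝ)) k) : ℝ)) ⟨i, h⟩
    · simp [h2 i h]
  · refine (pi_norm_le_iff_of_nonneg (norm_nonneg _)).2 fun i => ?_
    have h3 := norm_le_pi_norm ((padRows n ξ *ᵥ fun j => (x j : ℝ)) -
        fun k => (round ((padRows n ξ *ᵥ fun j => (x j : ℝ)) k) : ℝ)) (Fin.castLE hpn i)
    simp only [Pi.sub_apply, h1 (Fin.castLE hpn i) i.2] at h3
    exact h3

theorem exists_forall_sum_le {f : ℕ → ℝ} (hf : Summable f) {c : ℝ} (hc : 0 < c) (K : ℕ) :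
    ∃ N : ℕ, K ≤ N ∧ ∀ s : Finset ℕ, (∀ Q ∈ s, N ≤ Q) → ∑ Q ∈ s, f Q ≤ c := by
  obtain ⟨t, ht⟩ := summable_iff_vanishing_norm.1 hf c hc
  refine ⟨max K (t.sup id + 1), le_max_left _ _, fun s hs =>
    (le_abs_self _).trans (ht s (Finset.disjoint_left.2 fun Q hQ hQt => ?_)).le⟩
  have h1 := (le_max_right _ _).trans (hs Q hQ)
  have h2 := Finset.le_sup (f := id) hQt
  simp only [id] at h2
  omega

theorem summable_pow_mul_rpow_neg_pow {a b : ℕ} {u : ℝ} (h : a + 1 < b * u) :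
    Summable fun Q : ℕ => (Q : ℝ) ^ a * ((Q : ℝ) ^ (-u)) ^ b := by
  refine Summable.of_norm_bounded_eventually_nat
    (Real.summable_nat_rpow.2 (show (a : ℝ) - b * u < -1 by linarith)) ?_
  filter_upwards [eventually_ge_atTop 1] with Q hQ
  have hQ' : (0 : ℝ) < Q := by exact_mod_cast hQ
  rw [Real.norm_of_nonneg (by positivity), ← Real.rpow_natCast, ← Real.rpow_natCast,
    ← Real.rpow_mul hQ'.le, ← Real.rpow_add hQ']
  exact (congrArg _ (by ring)).le

theorem eventually_rpow_neg_le {τ τ' : ℝ} (hτ : 0 ≤ τ) (h : τ < τ') :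
    ∀ᶠ Q : ℕ in atTop, (Q : ℝ) ^ (-τ') ≤ ((Q + 1 : ℕ) : ℝ) ^ (-τ) := by
  have h1 : Tendsto (fun Q : ℕ => (Q : ℝ) ^ (τ' - τ)) atTop atTop :=
    (tendsto_rpow_atTop (sub_pos.2 h)).comp tendsto_natCast_atTop_atTop
  filter_upwards [eventually_ge_atTop 1, h1.eventually_ge_atTop (2 ^ τ)] with Q hQ hQ2
  have hQ' : (1 : ℝ) ≤ Q := by exact_mod_cast hQ
  have hQ0 : (0 : ℝ) < Q := by linarith
  rw [Real.rpow_neg hQ0.le, Real.rpow_neg (Nat.cast_nonneg _)]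
  refine inv_anti₀ (Real.rpow_pos_of_pos (by positivity) _) ?_
  calc ((Q + 1 : ℕ) : ℝ) ^ τ ≤ (2 * Q) ^ τ :=
        Real.rpow_le_rpow (Nat.cast_nonneg _) (by push_cast; linarith) hτ
    _ = 2 ^ τ * (Q : ℝ) ^ τ := Real.mul_rpow zero_le_two hQ0.le
    _ ≤ (Q : ℝ) ^ (τ' - τ) * (Q : ℝ) ^ τ := by gcongr
    _ = (Q : ℝ) ^ τ' := by rw [← Real.rpow_add hQ0]; ring_nf

theorem exists_mem_Ico_of_tendsto {X : ℕ → ℝ} (hX : Tendsto X atTop atTop) {t : ℝ} (ht : X 0 ≤ t) :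
    ∃ k, X k ≤ t ∧ t < X (k + 1) := by
  classical
  have hex : ∃ k, t < X k := (hX.eventually_gt_atTop t).exists
  have h0 : Nat.find hex ≠ 0 := fun h => by
    have := Nat.find_spec hex
    rw [h] at this
    linarith
  obtain ⟨k, hk⟩ := Nat.exists_eq_succ_of_ne_zero h0
  refine ⟨k, not_lt.1 (Nat.find_min hex (by omega)), ?_⟩
  have := Nat.find_spec hex
  rwa [hk] at this

theorem exists_isGood {a n p : ℕ} {ω : EReal} (hp : 1 ≤ p) (hω : 0 < ω) {w ε : ℕ → ℝ}
    (hw : ∀ k, 3 < p * w k) (hw' : ∀ k, (p - 1) * w k < 3) (hε : ∀ k, 0 < ε k)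
    (hεw : ∀ k, ε k < w k) (hu : ∀ k, a + 1 < n * (w k - ε k))
    (hup : ∀ τ : ℝ, τ < ω → ∃ τ' > τ, ∀ᶠ k in atTop, τ' ≤ w k - ε k)
    (hlow : ∀ τ : ℝ, ω < τ → ∀ᶠ k in atTop, w k + ε k ≤ τ) :
    ∃ ξ : Matrix (Fin p) (Fin 3) ℝ, IsGood a n ω (idist ξ) := by
  obtain ⟨M, -, hM⟩ := exists_limit_matrix hp
  set g : ℕ → ℕ → ℝ := fun k Q => (Q : ℝ) ^ a * ((Q : ℝ) ^ (-(w k - ε k))) ^ n with hg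
  have hgs : ∀ k, Summable (g k) := fun k => summable_pow_mul_rpow_neg_pow (hu k)
  have hg0 : ∀ k Q, 0 ≤ g k Q := fun k Q => by
    have := Real.rpow_nonneg (Nat.cast_nonneg (α := ℝ) Q) (-(w k - ε k))
    positivity
  choose N hN hNs using fun k : ℕ => exists_forall_sum_le (hgs (k + 1))
    (show (0 : ℝ) < (1 / 2) ^ (k + 1) by positivity) (k + 2)
  obtain ⟨ξ, X, hX0, hXm, hNX, hξ⟩ := hM w ε (fun k => N k) hw hw' hε hεw
  have hXt : Tendsto X atTop atTop := by
    refine (tendsto_add_atTop_iff_nat 1).1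
      (tendsto_atTop_mono (fun k => ?_) tendsto_natCast_atTop_atTop)
    refine le_trans ?_ (hNX k)
    exact_mod_cast (by have := hN k; omega : k ≤ N k)
  have hX1 : ∀ k, 1 ≤ X k := fun k => hX0 ▸ hXm.monotone (Nat.zero_le k)
  have hpiece : ∀ x : Fin 3 → ℤ, x ≠ 0 → ∃ k, X k ≤ inorm x ∧ inorm x < X (k + 1) := fun x hx =>
    exists_mem_Ico_of_tendsto hXt (hX0 ▸ one_le_inorm hx)
  choose κ hκ using fun Q : ℕ =>
    exists_mem_Ico_of_tendsto hXt (t := max (Q : ℝ) 1) (hX0 ▸ le_max_right _ _)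
  have hκ' : ∀ Q : ℕ, 1 ≤ Q → X (κ Q) ≤ Q ∧ (Q : ℝ) < X (κ Q + 1) := fun Q hQ => by
    have := hκ Q
    rwa [max_eq_left (by exact_mod_cast hQ)] at this
  have hbelow : ∀ Q : ℕ, 1 ≤ Q → ∃ x, x ≠ 0 ∧ inorm x ≤ Q ∧
      idist ξ x ≤ (Q : ℝ) ^ (-(w (κ Q) - ε (κ Q))) := fun Q hQ => by
    obtain ⟨x, hx, hxQ, hxD⟩ := (hξ (κ Q)).2.1 Q (hκ' Q hQ).1 (hκ' Q hQ).2
    exact ⟨x, hx, hxQ, hxD.le⟩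
  refine ⟨ξ, fun x hx => ?_, ⟨M, 0, fun x hx _ => ?_⟩, fun τ hτ => ?_, fun τ hτ => ?_,
    fun Q => (Q : ℝ) ^ (-(w (κ Q) - ε (κ Q))), fun Q => by positivity, ?_, ?_⟩
  · obtain ⟨k, hk1, hk2⟩ := hpiece x hx
    exact ((hξ k).1 x hx hk1 hk2).1
  · obtain ⟨k, hk1, hk2⟩ := hpiece x hx
    exact ((hξ k).1 x hx hk1 hk2).2
  · obtain ⟨τ', hττ', hev⟩ := hup (max τ 0) (by
      rcases max_choice τ 0 with h | h <;> rw [h]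
      · exact hτ
      · exact_mod_cast hω)
    obtain ⟨K, hK⟩ := eventually_atTop.1 hev
    filter_upwards [eventually_rpow_neg_le (le_max_right τ 0) hττ', eventually_ge_atTop 1,
      tendsto_natCast_atTop_atTop.eventually_ge_atTop (X K)] with Q h1 hQ hQK
    obtain ⟨x, hx, hxQ, hxD⟩ := hbelow Q hQ
    have hQ' : (1 : ℝ) ≤ Q := by exact_mod_cast hQ
    have hKκ : K ≤ κ Q := by
      have := hXm.lt_iff_lt.1 (hQK.trans_lt (hκ' Q hQ).2)
      omega
    refine ⟨x, hx, hxQ, hxD.trans ?_⟩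
    refine (Real.rpow_le_rpow_of_exponent_le hQ' (neg_le_neg (hK _ hKκ))).trans (h1.trans ?_)
    exact Real.rpow_le_rpow_of_exponent_le (by simp) (neg_le_neg (le_max_left _ _))
  · refine frequently_atTop.2 fun A => ?_
    obtain ⟨k, hk1, hk2⟩ := ((hlow τ hτ).and (hXt.eventually_ge_atTop A)).exists
    obtain ⟨Q, hQ, -, hQx⟩ := (hξ k).2.2
    refine ⟨Q, hk2.trans hQ, fun x hx hxQ => le_trans ?_ (hQx x hx hxQ).le⟩
    exact Real.rpow_le_rpow_of_exponent_le ((hX1 k).trans hQ) (neg_le_neg hk1)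
  · set C : ℝ := max (∑' Q, g 0 Q) 1 with hC
    have hC1 : 1 ≤ C := le_max_right _ _
    refine summable_of_sum_le (c := C * ∑' k : ℕ, (1 / 2 : ℝ) ^ k) (fun Q => hg0 (κ Q) Q)
      fun s => ?_
    have hsplit := Finset.sum_fiberwise_of_maps_to (s := s) (t := s.image κ) (g := κ)
      (fun Q hQ => Finset.mem_image_of_mem κ hQ) (fun Q => g (κ Q) Q)
    rw [← tsum_mul_left]
    refine hsplit.symm.le.trans (le_trans (Finset.sum_le_sum fun k _ => ?_)
      ((summable_geometric_two.mul_left C).sum_le_tsum (s.image κ) fun k _ => by positivity))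
    have h1 : ∑ Q ∈ s with κ Q = k, g (κ Q) Q = ∑ Q ∈ s with κ Q = k, g k Q :=
      Finset.sum_congr rfl fun Q hQ => by rw [(Finset.mem_filter.1 hQ).2]
    rw [h1]
    rcases k with _ | k
    · rw [pow_zero, mul_one]
      exact ((hgs 0).sum_le_tsum _ fun Q _ => hg0 0 Q).trans (le_max_left _ _)
    · refine (hNs k _ fun Q hQ => ?_).trans (le_mul_of_one_le_left (by positivity) hC1)
      have h2 := (hκ Q).1
      rw [(Finset.mem_filter.1 hQ).2] at h2
      have h3 : N k ≤ max Q 1 := by exact_mod_cast (hNX k).trans h2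
      have := hN k
      omega
  · filter_upwards [eventually_ge_atTop 1] with Q hQ
    exact hbelow Q hQ

theorem exists_isGood_top {m n : ℕ} (hn : 1 ≤ n) :
    ∃ p, 1 ≤ p ∧ p ≤ n ∧ ∃ ξ : Matrix (Fin p) (Fin 3) ℝ, IsGood (m - 1) n ⊤ (idist ξ) := by
  have hn' : (1 : ℝ) ≤ n := by exact_mod_cast hn
  have hm : ((m - 1 : ℕ) : ℝ) ≤ m := by exact_mod_cast Nat.sub_le m 1
  refine ⟨1, le_rfl, hn, exists_isGood (w := fun k => k + m + 4) (ε := fun _ => 1) le_rfl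
    EReal.zero_lt_top (fun k => ?_) (fun k => ?_) (fun k => one_pos) (fun k => ?_) (fun k => ?_)
    (fun τ _ => ⟨τ + 1, by simp, ?_⟩) fun τ hτ => absurd hτ not_top_lt⟩
  · have : (0 : ℝ) ≤ k + m := by positivity
    push_cast
    linarith
  · simp
  · have : (0 : ℝ) ≤ k + m := by positivity
    linarith
  · have h1 : (0 : ℝ) ≤ k + m := by positivity
    have h2 : (k + m + 4 - 1 : ℝ) ≤ n * (k + m + 4 - 1) :=
      le_mul_of_one_le_left (by linarith) hn'
    have h3 : (0 : ℝ) ≤ k := Nat.cast_nonneg k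
    linarith
  · filter_upwards [tendsto_natCast_atTop_atTop.eventually_ge_atTop (τ + 1)] with k hk
    have : (0 : ℝ) ≤ m := Nat.cast_nonneg m
    linarith

theorem exists_isGood_coe {m n : ℕ} (hm : 3 ≤ m) (hn : 1 ≤ n) {ω : ℝ} (hω : m ≤ n * ω) :
    ∃ p, 1 ≤ p ∧ p ≤ n ∧ ∃ ξ : Matrix (Fin p) (Fin 3) ℝ, IsGood (m - 1) n ω (idist ξ) := by
  classical
  have hn' : (1 : ℝ) ≤ n := by exact_mod_cast hn
  have hm' : (3 : ℝ) ≤ m := by exact_mod_cast hm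
  have hω0 : 0 < ω := by
    by_contra! h
    nlinarith
  have hex : ∃ p : ℕ, 3 ≤ p * ω := ⟨n, hm'.trans hω⟩
  set p := Nat.find hex with hp
  have hp3 : 3 ≤ p * ω := Nat.find_spec hex
  have hpn : p ≤ n := Nat.find_min' hex (hm'.trans hω)
  have hp1 : 1 ≤ p := by
    by_contra! h
    have : p = 0 := by omega
    rw [this] at hp3
    norm_num at hp3
  have hp1' : (1 : ℝ) ≤ p := by exact_mod_cast hp1
  have hlt : (p - 1) * ω < 3 := by
    have h := not_le.1 (Nat.find_min hex (show p - 1 < Nat.find hex by omega))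
    rwa [Nat.cast_sub hp1, Nat.cast_one] at h
  set δ : ℝ := (3 - (p - 1) * ω) / (4 * p) with hδ
  have hδ0 : 0 < δ := div_pos (by linarith) (by linarith)
  have hδp : (p - 1) * (ω + 2 * δ) < 3 := by
    have h1 : δ * (4 * p) = 3 - (p - 1) * ω := div_mul_cancel₀ _ (by positivity)
    nlinarith
  have hd : ∀ k : ℕ, 0 < δ / (k + 1) := fun k => by positivity
  have hd' : ∀ k : ℕ, δ / (k + 1) ≤ δ := fun k => div_le_self hδ0.le (by simp)
  refine ⟨p, hp1, hpn, exists_isGood (w := fun k => ω + 2 * (δ / (k + 1)))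
    (ε := fun k => δ / (k + 1)) hp1 (by exact_mod_cast hω0) (fun k => ?_) (fun k => ?_) hd
    (fun k => ?_) (fun k => ?_) (fun τ hτ => ⟨ω, by exact_mod_cast hτ, ?_⟩) fun τ hτ => ?_⟩
  · have := hd k
    nlinarith
  · refine lt_of_le_of_lt (mul_le_mul_of_nonneg_left ?_ (by linarith)) hδp
    have := hd' k
    linarith
  · have := hd k
    linarith
  · have h1 := hd k
    have h2 : ((m - 1 : ℕ) : ℝ) + 1 = m := by rw [Nat.cast_sub (by omega)]; simp
    rw [h2]
    nlinarith
  · refine Eventually.of_forall fun k => ?_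
    have := hd k
    linarith
  · have hτ' : ω < τ := by exact_mod_cast hτ
    have h1 : Tendsto (fun k : ℕ => ω + 2 * (δ / (k + 1)) + δ / (k + 1)) atTop (𝓝 ω) := by
      have h2 : Tendsto (fun k : ℕ => δ / ((k : ℝ) + 1)) atTop (𝓝 0) := by
        simpa [div_eq_mul_inv] using tendsto_one_div_add_atTop_nhds_zero_nat.const_mul δ
      simpa using ((h2.const_mul 2).const_add ω).add h2
    exact h1.eventually_le_const hτ'

end

/-- For `m ≥ 3, n ≥ 1` and any extended real `ω̂ ∈ [m/n, +∞]`, there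
is a totally irrational `ξ` satisfying (B), not (A), with uniform exponent `ω̂`. -/
theorem stmt_15 (m n : ℕ) (hm : 3 ≤ m) (hn : 1 ≤ n)
    (ωhat : EReal) (hω : (((m : ℝ) / (n : ℝ)) : EReal) ≤ ωhat) :
    ∃ (ξ : Matrix (Fin n) (Fin m) ℝ) (x : ℕ → Fin m → ℤ) (y : ℕ → Fin n → ℤ),
      TotallyIrrational ξ ∧ IsBestApproxSeq ξ x y ∧ PropB x ∧ ¬ PropA ξ ∧
      unifExp ξ x y = ωhat := by
  have hn0 : (0 : ℝ) < n := by exact_mod_cast hn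
  have hq : 0 < (m : ℝ) / n := div_pos (by exact_mod_cast (by omega : 0 < m)) hn0
  have hω' : (((m : ℝ) / (n : ℝ) : ℝ) : EReal) ≤ ωhat := hω
  have hω0 : 0 < ωhat := lt_of_lt_of_le (by exact_mod_cast hq) hω'
  obtain ⟨p, -, hpn, ξ, hξ⟩ : ∃ p, 1 ≤ p ∧ p ≤ n ∧ ∃ ξ : Matrix (Fin p) (Fin 3) ℝ,
      IsGood (m - 1) n ωhat (idist ξ) := by
    induction ωhat with
    | bot => exact absurd hω0 not_lt_bot
    | top => exact exists_isGood_top hn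
    | coe ω =>
      refine exists_isGood_coe hm hn ?_
      have h : (m : ℝ) / n ≤ ω := by exact_mod_cast hω'
      rwa [div_le_iff₀' hn0] at h
  rw [← idist_padRows hpn] at hξ
  obtain ⟨ξ', hξ'⟩ := hξ.exists_of_le hm (by omega) hn hω0
  exact ⟨ξ', hξ'.exists_bestApproxSeq (by omega) hω0⟩
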